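/- arXiv:2405.12088 — 2 statements merged into one kernel-verified Lean document; each statement's English description precedes it below -/
import Mathlib

section
/- F_{6,3}(n) = (1 + o(1))·(n·log log n)/(log n) as n → ∞; equivalently, F_{6,3}(n)·log n/(n·log log n) tends to 1 as n → ∞. -/
open Finset Filter

/-- `Fkd k d n` is the maximum cardinality of a set `A ⊆ {1,…,n}` such that there are no
`a_1 < a_2 < ⋯ < a_k` in `A` and positive integer `x` with `a_1 ⋯ a_k = x ^ d`. -/
noncomputable def Fkd (k d n : ℕ) : ℕ :=
  sSup {m : ℕ | ∃ A : Finset ℕ, A ⊆ Finset.Icc 1 n ∧ A.card = m ∧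
    ∀ (a : Fin k → ℕ) (x : ℕ), (∀ i, a i ∈ A) → StrictMono a → 0 < x →
      (∏ i, a i) ≠ x ^ d}

open Finset Filter

namespace PNTaux
open MeasureTheory Topology ArithmeticFunction

noncomputable def beta (u : ℝ) : ℝ := Chebyshev.psi (Real.exp u) * Real.exp (-u)

noncomputable def aux (s : ℂ) : ℂ := vonMangoldt.LFunctionResidueClassAux (q := 1) 1 s

noncomputable def G (s : ℂ) : ℂ := (aux s - 1) / s

lemma continuousOn_G : ContinuousOn G {s | 1 ≤ s.re} := by
  unfold G
  refine ContinuousOn.div ?_ continuousOn_id ?_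
  · exact (vonMangoldt.continuousOn_LFunctionResidueClassAux (q := 1) 1).sub continuousOn_const
  · intro s hs h
    simp only [Set.mem_ofPred_eq] at hs h
    rw [h] at hs
    norm_num at hs

lemma beta_nonneg (u : ℝ) : 0 ≤ beta u :=
  mul_nonneg (Chebyshev.psi_nonneg _) (Real.exp_pos _).le

lemma beta_le (u : ℝ) : beta u ≤ Real.log 4 + 4 := by
  unfold beta
  have := Chebyshev.psi_le_const_mul_self (Real.exp_pos u).le
  calc _ ≤ ((Real.log 4 + 4) * Real.exp u) * Real.exp (-u) := by gcongr
    _ = _ := by rw [mul_assoc, ← Real.exp_add]; simp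

lemma beta_mono {u v : ℝ} (h : u ≤ v) : beta u ≤ beta v * Real.exp (v - u) := by
  unfold beta
  rw [mul_assoc, ← Real.exp_add]
  have : -v + (v - u) = -u := by ring
  rw [this]
  exact mul_le_mul_of_nonneg_right (Chebyshev.psi_mono (Real.exp_le_exp.mpr h)) (Real.exp_pos _).le

lemma beta_neg {u : ℝ} (h : u ≤ 0) : beta u = 0 := by
  unfold beta
  rw [Chebyshev.psi_eq_zero_of_le_one (by simpa using h), zero_mul]

lemma measurable_beta : Measurable beta := by
  unfold beta
  exact (Chebyshev.psi_mono.measurable.comp Real.measurable_exp).mul (by fun_prop)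

lemma LS (s : ℂ) (hs : 1 < s.re) :
    LSeries (fun n => ((vonMangoldt n : ℝ) : ℂ)) s = aux s + 1 / (s - 1) := by
  have h := vonMangoldt.eqOn_LFunctionResidueClassAux (q := 1) (a := 1) isUnit_one hs
  simp only [Nat.totient_one, Nat.cast_one, inv_one] at h
  unfold aux
  rw [h, sub_add_cancel]
  congr 1
  ext n
  simp [vonMangoldt.residueClass, Set.indicator, Subsingleton.elim (n : ZMod 1) 1]

lemma integral_beta (s : ℂ) (hs : 1 < s.re) :
    ∫ u in Set.Ioi (0 : ℝ), (beta u : ℂ) * Complex.exp (-(s - 1) * u) =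
      (aux s + 1 / (s - 1)) / s := by
  have hs0 : s ≠ 0 := by
    rintro rfl
    norm_num at hs
  have hO : (fun n : ℕ ↦ ∑ k ∈ Icc 1 n, vonMangoldt k) =O[atTop] fun n ↦ (n : ℝ) ^ (1 : ℝ) := by
    refine Asymptotics.IsBigO.of_bound (Real.log 4 + 4) (Eventually.of_forall fun n => ?_)
    have h1 : ∑ k ∈ Icc 1 n, vonMangoldt k = Chebyshev.psi n := by
      simp [Chebyshev.psi, ← Finset.Icc_succ_left_eq_Ioc]
    rw [h1, Real.norm_of_nonneg (Chebyshev.psi_nonneg _)]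
    simpa using Chebyshev.psi_le_const_mul_self (x := n) (by positivity)
  have h := LSeries_eq_mul_integral_of_nonneg (fun n => vonMangoldt n) zero_le_one hs hO
    (fun n => vonMangoldt_nonneg)
  rw [LS s hs] at h
  rw [h, mul_div_cancel_left₀ _ hs0]
  have himg : Real.exp '' (Set.Ioi 0) = Set.Ioi 1 := by
    ext x
    simp only [Set.mem_image, Set.mem_Ioi]
    constructor
    · rintro ⟨y, hy, rfl⟩
      simpa using hy
    · intro hx
      exact ⟨Real.log x, Real.log_pos hx, Real.exp_log (by linarith)⟩
  rw [← himg, integral_image_eq_integral_abs_deriv_smul measurableSet_Ioi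
    (fun x _ => (Real.hasDerivAt_exp x).hasDerivWithinAt) (Real.exp_injective.injOn)]
  refine setIntegral_congr_fun measurableSet_Ioi fun u hu => ?_
  have h2 : ∑ k ∈ Icc 1 ⌊Real.exp u⌋₊, ((vonMangoldt k : ℝ) : ℂ)
      = ((Chebyshev.psi (Real.exp u) : ℝ) : ℂ) := by
    simp [Chebyshev.psi, ← Finset.Icc_succ_left_eq_Ioc]
  simp only [h2, beta]
  rw [abs_of_pos (Real.exp_pos u), Complex.real_smul]
  push_cast
  rw [Complex.cpow_def_of_ne_zero (Complex.exp_ne_zero _), ← Complex.ofReal_exp,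
    ← Complex.ofReal_log (Real.exp_pos u).le, Real.log_exp, Complex.ofReal_exp]
  rw [mul_assoc, ← Complex.exp_add, mul_comm (Complex.exp u), mul_assoc, ← Complex.exp_add]
  congr 2
  ring

lemma integral_one (s : ℂ) (hs : 1 < s.re) :
    ∫ u in Set.Ioi (0 : ℝ), Complex.exp (-(s - 1) * u) = 1 / (s - 1) := by
  have := integral_exp_mul_complex_Ioi (a := -(s-1)) (by simpa using hs) 0
  rw [this, Complex.ofReal_zero, mul_zero, Complex.exp_zero, neg_div_neg_eq]

lemma integrable_exp (s : ℂ) (hs : 1 < s.re) :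
    IntegrableOn (fun u : ℝ => Complex.exp (-(s - 1) * u)) (Set.Ioi 0) :=
  integrableOn_exp_mul_complex_Ioi (a := -(s-1)) (by simpa using hs) 0

lemma integral_G (s : ℂ) (hs : 1 < s.re) :
    ∫ u in Set.Ioi (0 : ℝ), ((beta u - 1 : ℝ) : ℂ) * Complex.exp (-(s - 1) * u) = G s := by
  have hs0 : s ≠ 0 := by
    rintro rfl
    norm_num at hs
  have hs1 : s - 1 ≠ 0 := by
    intro h
    rw [sub_eq_zero.mp h] at hs
    norm_num at hs
  have hi := integrable_exp s hs
  have hb : IntegrableOn (fun u : ℝ => (beta u : ℂ) * Complex.exp (-(s - 1) * u)) (Set.Ioi 0) := by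
    refine hi.bdd_mul (c := Real.log 4 + 4)
      (Complex.measurable_ofReal.comp measurable_beta).aestronglyMeasurable ?_
    refine Eventually.of_forall fun u => ?_
    rw [Complex.norm_real, Real.norm_of_nonneg (beta_nonneg u)]
    exact beta_le u
  have : ∀ u : ℝ, ((beta u - 1 : ℝ) : ℂ) * Complex.exp (-(s - 1) * u)
      = (beta u : ℂ) * Complex.exp (-(s - 1) * u) - Complex.exp (-(s - 1) * u) := by
    intro u; push_cast; ring
  simp_rw [this]
  rw [integral_sub hb hi, integral_beta s hs, integral_one s hs, G]
  field_simp
  ring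

end PNTaux

open Finset Filter

namespace PNTaux
open MeasureTheory Topology ArithmeticFunction

noncomputable def ker (w : ℝ) : ℝ := (1 - Real.cos w) / w ^ 2

lemma ker_nonneg (w : ℝ) : 0 ≤ ker w :=
  div_nonneg (by linarith [Real.cos_le_one w]) (sq_nonneg w)

lemma measurable_ker : Measurable ker := by unfold ker; fun_prop

lemma ker_le (w : ℝ) : ker w ≤ 3 * (1 + w ^ 2)⁻¹ := by
  unfold ker
  rcases eq_or_ne w 0 with rfl | hw
  · simp
  have h1 := Real.one_sub_sq_div_two_le_cos (x := w)
  have h2 := Real.neg_one_le_cos w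
  have hw2 : 0 < w ^ 2 := by positivity
  rw [← div_eq_mul_inv, div_le_div_iff₀ hw2 (by positivity)]
  nlinarith

lemma integrable_ker : Integrable ker := by
  refine (integrable_inv_one_add_sq.const_mul 3).mono' measurable_ker.aestronglyMeasurable ?_
  refine Eventually.of_forall fun w => ?_
  rw [Real.norm_of_nonneg (ker_nonneg w)]
  exact ker_le w

lemma ker_int_pos : 0 < ∫ w, ker w := by
  rw [integral_pos_iff_support_of_nonneg (fun w => ker_nonneg w) integrable_ker]
  have : Set.Ioo (0 : ℝ) 1 ⊆ Function.support ker := by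
    intro w hw
    have h3 : Real.cos w < 1 := by
      have := Real.cos_lt_cos_of_nonneg_of_le_pi (x := 0) (y := w) le_rfl
        (by linarith [hw.2, Real.pi_gt_three]) hw.1
      simpa using this
    have : 0 < ker w := div_pos (by linarith) (by have := hw.1; positivity)
    exact this.ne'
  refine lt_of_lt_of_le ?_ (measure_mono this)
  simp

lemma ker_eq {w : ℝ} (hw : w ≠ 0) : ∫ t in (0:ℝ)..1, (1 - t) * Real.cos (t * w) = ker w := by
  have hd : ∀ t ∈ Set.uIcc (0:ℝ) 1, HasDerivAt
      (fun t : ℝ => (1 - t) * (Real.sin (t * w) / w) - Real.cos (t * w) / w ^ 2)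
      ((1 - t) * Real.cos (t * w)) t := by
    intro t _
    have hm : HasDerivAt (fun t : ℝ => t * w) w t := by simpa using (hasDerivAt_id t).mul_const w
    have h1 := (((hasDerivAt_id t).const_sub 1).mul ((hm.sin).div_const w)).sub
      ((hm.cos).div_const (w^2))
    refine h1.congr_deriv ?_
    simp only [id]
    field_simp
    ring
  rw [intervalIntegral.integral_eq_sub_of_hasDerivAt hd
    (Continuous.intervalIntegrable (by fun_prop) _ _)]
  simp [ker]
  ring

lemma fub (T a v : ℝ) (hT : 0 < T) (ha : 0 < a) :
    ∫ t in (0:ℝ)..1, (1 - t) * (Complex.exp ((T * t * v : ℝ) * Complex.I) *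
      G ((1 + a : ℝ) + (T * t : ℝ) * Complex.I)).re =
    ∫ u in Set.Ioi (0:ℝ), (beta u - 1) * Real.exp (-a * u) * ker (T * (v - u)) := by
  have hb1 : ∀ u, |beta u - 1| ≤ Real.log 4 + 5 := by
    intro u
    have := beta_nonneg u
    have := beta_le u
    have : 0 ≤ Real.log 4 := Real.log_nonneg (by norm_num)
    rw [abs_le]; constructor <;> linarith
  have hexp : IntegrableOn (fun u : ℝ => Real.exp (-a * u)) (Set.Ioi 0) := by
    have := exp_neg_integrableOn_Ioi 0 ha
    simpa using this
  have h1 : ∀ t : ℝ, (Complex.exp ((T * t * v : ℝ) * Complex.I) *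
      G ((1 + a : ℝ) + (T * t : ℝ) * Complex.I)).re =
      ∫ u in Set.Ioi (0:ℝ), (beta u - 1) * Real.exp (-a * u) * Real.cos (t * (T * (v - u))) := by
    intro t
    have hs : 1 < (((1 + a : ℝ) : ℂ) + (T * t : ℝ) * Complex.I).re := by simp [ha]
    rw [← integral_G _ hs, ← integral_const_mul]
    have hint : IntegrableOn (fun u : ℝ => Complex.exp ((T * t * v : ℝ) * Complex.I) *
        (((beta u - 1 : ℝ) : ℂ) *
          Complex.exp (-((((1 + a : ℝ) : ℂ) + (T * t : ℝ) * Complex.I) - 1) * u))) (Set.Ioi 0) := by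
      refine Integrable.const_mul ?_ _
      refine (integrable_exp _ hs).bdd_mul (c := Real.log 4 + 5)
        (Complex.measurable_ofReal.comp (measurable_beta.sub_const 1)).aestronglyMeasurable ?_
      refine Eventually.of_forall fun u => ?_
      rw [Complex.norm_real]
      exact hb1 u
    have := integral_re hint
    simp only [RCLike.re_eq_complex_re] at this
    rw [← this]
    refine setIntegral_congr_fun measurableSet_Ioi fun u hu => ?_
    have h3 : Complex.exp ((T * t * v : ℝ) * Complex.I) *
        (((beta u - 1 : ℝ) : ℂ) *
          Complex.exp (-((((1 + a : ℝ) : ℂ) + (T * t : ℝ) * Complex.I) - 1) * u)) =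
        ((beta u - 1 : ℝ) : ℂ) * (Complex.exp ((-a * u : ℝ) + (t * (T * (v - u)) : ℝ) * Complex.I)) := by
      rw [mul_left_comm, ← Complex.exp_add]
      congr 2
      push_cast; ring
    rw [h3, Complex.re_ofReal_mul, Complex.exp_re]
    simp
    ring
  simp_rw [h1]
  simp_rw [← integral_const_mul]
  rw [intervalIntegral.integral_of_le zero_le_one, integral_integral_swap]
  · refine integral_congr_ae ?_
    have hne : ∀ᵐ u ∂(volume.restrict (Set.Ioi (0:ℝ))), u ≠ v := by
      refine ae_restrict_of_ae ?_
      exact compl_mem_ae_iff.mpr (measure_singleton v)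
    filter_upwards [hne] with u hu
    rw [← ker_eq (w := T * (v - u)) (mul_ne_zero hT.ne' (sub_ne_zero.mpr hu.symm)),
      intervalIntegral.integral_of_le zero_le_one, ← integral_const_mul]
    congr 1; ext t; ring
  · have h5 : Integrable (fun z : ℝ × ℝ => (1:ℝ) * ((Real.log 4 + 5) * Real.exp (-a * z.2)))
        ((volume.restrict (Set.Ioc (0:ℝ) 1)).prod (volume.restrict (Set.Ioi (0:ℝ)))) :=
      Integrable.mul_prod (f := fun _ : ℝ => (1:ℝ))
        (g := fun u : ℝ => (Real.log 4 + 5) * Real.exp (-a * u)) (by simp) (hexp.const_mul _)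
    refine h5.mono' ?_ ?_
    · refine Measurable.aestronglyMeasurable ?_
      unfold Function.uncurry
      have := measurable_beta
      fun_prop
    · have : ∀ᵐ z ∂((volume.restrict (Set.Ioc (0:ℝ) 1)).prod (volume.restrict (Set.Ioi (0:ℝ)))),
          z ∈ Set.Ioc (0:ℝ) 1 ×ˢ Set.Ioi (0:ℝ) := by
        rw [Measure.prod_restrict]
        exact ae_restrict_mem (measurableSet_Ioc.prod measurableSet_Ioi)
      filter_upwards [this] with z hz
      obtain ⟨⟨h01, h02⟩, h03⟩ := hz
      simp only [Function.uncurry, Real.norm_eq_abs, abs_mul, Real.abs_exp]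
      have e1 : |1 - z.1| ≤ 1 := by rw [abs_le]; constructor <;> linarith
      have e2 := hb1 z.2
      have e3 := Real.abs_cos_le_one (z.1 * (T * (v - z.2)))
      calc _ ≤ 1 * ((Real.log 4 + 5) * Real.exp (-a * z.2) * 1) := by gcongr
        _ = _ := by ring

end PNTaux

open Finset Filter

namespace PNTaux
open MeasureTheory Topology ArithmeticFunction

lemma abs_beta_sub (u : ℝ) : |beta u - 1| ≤ Real.log 4 + 5 := by
  have := beta_nonneg u
  have := beta_le u
  have : 0 ≤ Real.log 4 := Real.log_nonneg (by norm_num)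
  rw [abs_le]; constructor <;> linarith

lemma integrable_ker_shift (T v : ℝ) (hT : 0 < T) : Integrable (fun u => ker (T * (v - u))) := by
  have h := (integrable_ker.comp_mul_left' hT.ne').comp_sub_left v
  exact h

lemma fub0 (T v : ℝ) (hT : 0 < T) :
    ∫ t in (0:ℝ)..1, (1 - t) * (Complex.exp ((T * t * v : ℝ) * Complex.I) *
      G ((1 : ℝ) + (T * t : ℝ) * Complex.I)).re =
    ∫ u in Set.Ioi (0:ℝ), (beta u - 1) * ker (T * (v - u)) := by
  have hl : Tendsto (fun a : ℝ => ∫ t in (0:ℝ)..1, (1 - t) *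
      (Complex.exp ((T * t * v : ℝ) * Complex.I) *
      G ((1 + a : ℝ) + (T * t : ℝ) * Complex.I)).re) (𝓝[>] 0)
      (𝓝 (∫ t in (0:ℝ)..1, (1 - t) * (Complex.exp ((T * t * v : ℝ) * Complex.I) *
      G ((1 : ℝ) + (T * t : ℝ) * Complex.I)).re)) := by
    have hcomp : IsCompact (Set.Icc (1:ℝ) 2 ×ℂ Set.Icc (0:ℝ) T) :=
      isCompact_Icc.reProdIm isCompact_Icc
    obtain ⟨M, hM⟩ := hcomp.exists_bound_of_continuousOn (f := G)
      (continuousOn_G.mono (fun s hs => hs.1.1))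
    have hev : ∀ᶠ a : ℝ in 𝓝[>] 0, a ∈ Set.Ioo (0:ℝ) 1 := Ioo_mem_nhdsGT one_pos
    refine intervalIntegral.tendsto_integral_filter_of_dominated_convergence (fun _ => M) ?_ ?_ ?_ ?_
    · filter_upwards [hev] with a ha
      refine ContinuousOn.aestronglyMeasurable ?_ measurableSet_uIoc
      refine ContinuousOn.mul (by fun_prop) ?_
      refine Complex.continuous_re.comp_continuousOn ?_
      refine ContinuousOn.mul (by fun_prop) ?_
      refine continuousOn_G.comp (by fun_prop) ?_
      intro t ht
      simp [ha.1.le]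
    · filter_upwards [hev] with a ha
      refine Eventually.of_forall fun t ht => ?_
      rw [Set.uIoc_of_le zero_le_one] at ht
      rw [norm_mul, Real.norm_eq_abs, Real.norm_eq_abs]
      have e1 : |1 - t| ≤ 1 := by rw [abs_le]; constructor <;> linarith [ht.1, ht.2]
      have e2 := Complex.abs_re_le_norm (Complex.exp ((T * t * v : ℝ) * Complex.I) *
        G ((1 + a : ℝ) + (T * t : ℝ) * Complex.I))
      rw [norm_mul, Complex.norm_exp_ofReal_mul_I, one_mul] at e2
      have e3 := hM (((1 + a : ℝ) : ℂ) + (T * t : ℝ) * Complex.I) (by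
        refine ⟨?_, ?_⟩
        · simp only [Set.mem_preimage, Complex.add_re, Complex.ofReal_re, Complex.mul_re,
            Complex.I_re, Complex.ofReal_im, Complex.I_im, Set.mem_Icc]
          constructor <;> linarith [ha.1, ha.2]
        · simp only [Set.mem_preimage, Complex.add_im, Complex.ofReal_im, Complex.mul_im,
            Complex.I_re, Complex.ofReal_re, Complex.I_im, Set.mem_Icc]
          constructor <;> nlinarith [ht.1, ht.2])
      calc _ ≤ 1 * M := mul_le_mul e1 (e2.trans e3) (abs_nonneg _) zero_le_one
        _ = M := one_mul M
    · simp
    · refine Eventually.of_forall fun t ht => ?_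
      refine Tendsto.const_mul _ ?_
      refine (Complex.continuous_re.tendsto _).comp ?_
      refine Tendsto.const_mul _ ?_
      have hc : ContinuousWithinAt G {s | 1 ≤ s.re} ((1 : ℝ) + (T * t : ℝ) * Complex.I) :=
        continuousOn_G _ (by simp)
      refine hc.tendsto.comp (tendsto_nhdsWithin_iff.mpr ⟨?_, ?_⟩)
      · have : Continuous (fun a : ℝ => ((1 + a : ℝ) : ℂ) + (T * t : ℝ) * Complex.I) := by fun_prop
        have h := this.tendsto 0
        simp only [add_zero] at h
        exact h.mono_left nhdsWithin_le_nhds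
      · filter_upwards [hev] with a ha
        simp [ha.1.le]
  have hr : Tendsto (fun a : ℝ => ∫ u in Set.Ioi (0:ℝ),
      (beta u - 1) * Real.exp (-a * u) * ker (T * (v - u))) (𝓝[>] 0)
      (𝓝 (∫ u in Set.Ioi (0:ℝ), (beta u - 1) * ker (T * (v - u)))) := by
    have hev : ∀ᶠ a : ℝ in 𝓝[>] 0, 0 < a := self_mem_nhdsWithin
    have hmk := measurable_ker
    have hmb := measurable_beta
    refine tendsto_integral_filter_of_dominated_convergence
      (fun u => (Real.log 4 + 5) * ker (T * (v - u))) ?_ ?_ ?_ ?_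
    · refine Eventually.of_forall fun a => Measurable.aestronglyMeasurable ?_
      fun_prop
    · filter_upwards [hev] with a ha
      filter_upwards [ae_restrict_mem measurableSet_Ioi] with u hu
      rw [norm_mul, norm_mul, Real.norm_eq_abs, Real.norm_of_nonneg (Real.exp_pos _).le,
        Real.norm_of_nonneg (ker_nonneg _)]
      have e1 := abs_beta_sub u
      have e2 : Real.exp (-a * u) ≤ 1 := by
        rw [Real.exp_le_one_iff]
        have : (0:ℝ) < u := hu
        nlinarith
      have e3 := ker_nonneg (T * (v - u))
      calc _ ≤ (Real.log 4 + 5) * 1 * ker (T * (v - u)) := by gcongr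
        _ = _ := by ring
    · exact ((integrable_ker_shift T v hT).const_mul _).integrableOn
    · refine Eventually.of_forall fun u => ?_
      have : Continuous (fun a : ℝ => (beta u - 1) * Real.exp (-a * u) * ker (T * (v - u))) := by
        fun_prop
      have h := this.tendsto 0
      simp only [neg_zero, zero_mul, Real.exp_zero, mul_one] at h
      exact h.mono_left nhdsWithin_le_nhds
  refine tendsto_nhds_unique hl (hr.congr' ?_)
  filter_upwards [self_mem_nhdsWithin] with a ha
  exact (fub T a v hT ha).symm

lemma RL (T : ℝ) (hT : 0 < T) : Tendsto (fun v : ℝ =>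
    ∫ u in Set.Ioi (0:ℝ), (beta u - 1) * ker (T * (v - u))) atTop (𝓝 0) := by
  simp_rw [← fub0 T _ hT]
  have hcontG : Continuous (fun t : ℝ => G ((1 : ℝ) + (T * t : ℝ) * Complex.I)) :=
    continuousOn_G.comp_continuous (by fun_prop) (by simp)
  set f : ℝ → ℂ := Set.indicator (Set.Ioc (0:ℝ) 1)
    (fun t => ((1 - t : ℝ) : ℂ) * G ((1 : ℝ) + (T * t : ℝ) * Complex.I)) with hf
  have h := Real.tendsto_integral_exp_smul_cocompact f
  have h2 : Tendsto (fun v : ℝ => -(T * v / (2 * Real.pi))) atTop (cocompact ℝ) := by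
    refine Tendsto.mono_right ?_ atBot_le_cocompact
    refine tendsto_neg_atTop_atBot.comp ?_
    refine Tendsto.atTop_div_const (by positivity) ?_
    exact tendsto_id.const_mul_atTop hT
  have h3 := (Complex.continuous_re.tendsto _).comp (h.comp h2)
  simp only [Complex.zero_re] at h3
  refine h3.congr fun v => ?_
  simp only [Function.comp]
  have hc : Continuous (fun t : ℝ => Complex.exp ((T * t * v : ℝ) * Complex.I) *
      (((1 - t : ℝ) : ℂ) * G ((1 : ℝ) + (T * t : ℝ) * Complex.I))) := by fun_prop
  have h4 : ∀ t : ℝ, Real.fourierChar (-(t * -(T * v / (2 * Real.pi)))) • f t =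
      Set.indicator (Set.Ioc (0:ℝ) 1) (fun t => Complex.exp ((T * t * v : ℝ) * Complex.I) *
      (((1 - t : ℝ) : ℂ) * G ((1 : ℝ) + (T * t : ℝ) * Complex.I))) t := by
    intro t
    simp only [hf, Set.indicator]
    split_ifs
    · rw [Circle.smul_def, Real.fourierChar_apply, smul_eq_mul]
      congr 3
      push_cast
      have : (Real.pi : ℂ) ≠ 0 := by exact_mod_cast Real.pi_ne_zero
      field_simp
    · simp
  simp_rw [h4]
  rw [integral_indicator measurableSet_Ioc, intervalIntegral.integral_of_le zero_le_one]
  have := integral_re (𝕜 := ℂ) (hc.integrableOn_Ioc (a := 0) (b := 1) (μ := volume))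
  simp only [RCLike.re_eq_complex_re] at this
  rw [← this]
  congr 1
  ext t
  rw [mul_left_comm, Complex.re_ofReal_mul]

lemma RL2 (T : ℝ) (hT : 0 < T) : Tendsto (fun v : ℝ =>
    ∫ y, beta (v - y / T) * ker y) atTop (𝓝 (∫ y, ker y)) := by
  have hmk := measurable_ker
  have hmb := measurable_beta
  have hbint : ∀ v, Integrable (fun u => (beta u - 1) * ker (T * (v - u))) := by
    intro v
    refine (integrable_ker_shift T v hT).bdd_mul (c := Real.log 4 + 5)
      (by fun_prop) (Eventually.of_forall fun u => abs_beta_sub u)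
  have h1 : Tendsto (fun v : ℝ => ∫ u in Set.Iic (0:ℝ), (beta u - 1) * ker (T * (v - u)))
      atTop (𝓝 0) := by
    have hk : Tendsto (fun v : ℝ => ∫ u in Set.Iic (0:ℝ), (beta u - 1) * ker (T * (v - u)))
      atTop (𝓝 (∫ u in Set.Iic (0:ℝ), (0:ℝ))) := by
      refine tendsto_integral_filter_of_dominated_convergence
        (fun u => (Real.log 4 + 5) * (3 * (1 + (T * u) ^ 2)⁻¹)) ?_ ?_ ?_ ?_
      · exact Eventually.of_forall fun v => (hbint v).aestronglyMeasurable.restrict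
      · filter_upwards [eventually_ge_atTop 0] with v hv
        filter_upwards [ae_restrict_mem measurableSet_Iic] with u hu
        rw [norm_mul, Real.norm_eq_abs, Real.norm_of_nonneg (ker_nonneg _)]
        have hu' : u ≤ 0 := hu
        have e4 : (T * u) ^ 2 ≤ (T * (v - u)) ^ 2 := by
          rw [mul_pow, mul_pow]
          have : u ^ 2 ≤ (v - u) ^ 2 := by nlinarith
          gcongr
        have : 0 ≤ Real.log 4 := Real.log_nonneg (by norm_num)
        calc _ ≤ (Real.log 4 + 5) * (3 * (1 + (T * (v - u)) ^ 2)⁻¹) :=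
              mul_le_mul (abs_beta_sub u) (ker_le _) (ker_nonneg _) (by linarith)
          _ ≤ _ := by gcongr
      · have := (integrable_inv_one_add_sq.comp_mul_left' hT.ne')
        exact ((this.const_mul 3).const_mul _).integrableOn
      · refine Eventually.of_forall fun u => ?_
        have : Tendsto (fun v : ℝ => ker (T * (v - u))) atTop (𝓝 0) := by
          have hz : Tendsto (fun w : ℝ => 3 * (1 + w ^ 2)⁻¹) atTop (𝓝 (3 * 0)) := by
            refine Tendsto.const_mul _ (tendsto_inv_atTop_zero.comp ?_)
            exact tendsto_atTop_add_const_left _ _ (tendsto_pow_atTop two_ne_zero)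
          rw [mul_zero] at hz
          have hk0 : Tendsto ker atTop (𝓝 0) :=
            squeeze_zero ker_nonneg ker_le hz
          refine hk0.comp (Tendsto.const_mul_atTop hT ?_)
          exact tendsto_atTop_add_const_right _ _ tendsto_id
        simpa using this.const_mul (beta u - 1)
    simpa using hk
  have h2 : Tendsto (fun v : ℝ => ∫ u, (beta u - 1) * ker (T * (v - u))) atTop (𝓝 0) := by
    have := h1.add (RL T hT)
    rw [add_zero] at this
    refine this.congr fun v => ?_
    exact intervalIntegral.integral_Iic_add_Ioi (hbint v).integrableOn (hbint v).integrableOn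
  have h3 := (h2.const_mul T).add_const (∫ y, ker y)
  rw [mul_zero, zero_add] at h3
  refine h3.congr fun v => ?_
  have h5 : Integrable (fun y => beta (v - y / T) * ker y) := by
    refine integrable_ker.bdd_mul (c := Real.log 4 + 4)
      (hmb.comp (by fun_prop : Measurable fun y : ℝ => v - y / T)).aestronglyMeasurable (Eventually.of_forall fun u => ?_)
    rw [Real.norm_of_nonneg (beta_nonneg _)]
    exact beta_le _
  have h4 : ∫ u, (beta u - 1) * ker (T * (v - u)) = T⁻¹ * ∫ y, (beta (v - y / T) - 1) * ker y := by
    rw [← integral_sub_left_eq_self (fun u => (beta u - 1) * ker (T * (v - u))) volume v]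
    have := Measure.integral_comp_mul_left (fun y => (beta (v - y / T) - 1) * ker y) T
    rw [abs_of_pos (inv_pos.mpr hT), smul_eq_mul] at this
    rw [← this]
    congr 1; ext u
    rw [mul_div_cancel_left₀ _ hT.ne', sub_sub_cancel]
  rw [h4, mul_inv_cancel_left₀ hT.ne']
  simp_rw [sub_mul, one_mul]
  rw [integral_sub h5 integrable_ker]
  ring

end PNTaux

open Finset Filter

namespace PNTaux
open MeasureTheory Topology ArithmeticFunction

lemma ker_trunc : Tendsto (fun R : ℝ => ∫ y in (-R)..R, ker y) atTop (𝓝 (∫ y, ker y)) :=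
  intervalIntegral_tendsto_integral integrable_ker tendsto_neg_atTop_atBot tendsto_id

lemma integrable_bk (T v : ℝ) : Integrable (fun y => beta (v - y / T) * ker y) := by
  refine integrable_ker.bdd_mul (c := Real.log 4 + 4)
    (measurable_beta.comp (by fun_prop : Measurable fun y : ℝ => v - y / T)).aestronglyMeasurable
    (Eventually.of_forall fun u => ?_)
  rw [Real.norm_of_nonneg (beta_nonneg _)]
  exact beta_le _

lemma upper_ineq (T R v : ℝ) (hT : 0 < T) (hR : 0 < R) :
    beta v * Real.exp (-(2 * R / T)) * (∫ y in (-R)..R, ker y) ≤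
      ∫ y, beta ((v + R / T) - y / T) * ker y := by
  have hRR : -R ≤ R := by linarith
  calc _ = ∫ y in Set.Ioc (-R) R, beta v * Real.exp (-(2 * R / T)) * ker y := by
        rw [integral_const_mul, intervalIntegral.integral_of_le hRR]
    _ ≤ ∫ y in Set.Ioc (-R) R, beta ((v + R / T) - y / T) * ker y := by
        refine setIntegral_mono_on (integrable_ker.const_mul _).integrableOn
          (integrable_bk T _).integrableOn measurableSet_Ioc fun y hy => ?_
        refine mul_le_mul_of_nonneg_right ?_ (ker_nonneg y)
        have h1 : v ≤ v + R / T - y / T := by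
          have : y / T ≤ R / T := by gcongr; exact hy.2
          linarith
        have h2 := beta_mono h1
        have h3 : v + R / T - y / T - v ≤ 2 * R / T := by
          have : -R / T ≤ y / T := by gcongr; exact hy.1.le
          have e : 2 * R / T = R / T + R / T := by ring
          have e' : -R / T = - (R / T) := by ring
          linarith
        calc beta v * Real.exp (-(2 * R / T)) ≤ (beta (v + R / T - y / T) *
              Real.exp (2 * R / T)) * Real.exp (-(2 * R / T)) := by
              refine mul_le_mul_of_nonneg_right (h2.trans ?_) (Real.exp_pos _).le
              exact mul_le_mul_of_nonneg_left (Real.exp_le_exp.mpr h3) (beta_nonneg _)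
          _ = _ := by rw [mul_assoc, ← Real.exp_add]; simp
    _ ≤ _ := setIntegral_le_integral (integrable_bk T _)
        (Eventually.of_forall fun y => mul_nonneg (beta_nonneg _) (ker_nonneg _))

lemma lower_ineq (T R v : ℝ) (hT : 0 < T) (hR : 0 < R) :
    (∫ y, beta ((v - R / T) - y / T) * ker y) ≤
      beta v * Real.exp (2 * R / T) * (∫ y, ker y) +
      (Real.log 4 + 4) * ((∫ y, ker y) - ∫ y in (-R)..R, ker y) := by
  have hRR : -R ≤ R := by linarith
  have hsplit := integral_add_compl (μ := volume) (s := Set.Ioc (-R) R) measurableSet_Ioc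
    (integrable_bk T (v - R / T))
  have hsplit2 := integral_add_compl (μ := volume) (s := Set.Ioc (-R) R) measurableSet_Ioc
    integrable_ker
  rw [← hsplit, intervalIntegral.integral_of_le hRR]
  refine add_le_add ?_ ?_
  · calc _ ≤ ∫ y in Set.Ioc (-R) R, beta v * Real.exp (2 * R / T) * ker y := by
          refine setIntegral_mono_on (integrable_bk T _).integrableOn
            (integrable_ker.const_mul _).integrableOn measurableSet_Ioc fun y hy => ?_
          refine mul_le_mul_of_nonneg_right ?_ (ker_nonneg y)
          have h0 : -R / T ≤ y / T := by gcongr; exact hy.1.le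
          have h0' : y / T ≤ R / T := by gcongr; exact hy.2
          have e : 2 * R / T = R / T + R / T := by ring
          have e' : -R / T = - (R / T) := by ring
          have h1 : v - R / T - y / T ≤ v := by linarith
          have h3 : v - (v - R / T - y / T) ≤ 2 * R / T := by linarith
          exact (beta_mono h1).trans
            (mul_le_mul_of_nonneg_left (Real.exp_le_exp.mpr h3) (beta_nonneg _))
      _ ≤ _ := by
          rw [integral_const_mul]
          refine mul_le_mul_of_nonneg_left ?_ (mul_nonneg (beta_nonneg _) (Real.exp_pos _).le)
          exact setIntegral_le_integral integrable_ker (Eventually.of_forall ker_nonneg)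
  · rw [← hsplit2, add_sub_cancel_left, ← integral_const_mul]
    refine integral_mono (integrable_bk T _).integrableOn
      (integrable_ker.const_mul _).integrableOn fun y => ?_
    exact mul_le_mul_of_nonneg_right (beta_le _) (ker_nonneg y)

theorem tendsto_beta : Tendsto beta atTop (𝓝 1) := by
  set K := ∫ y, ker y with hK
  have hKp : 0 < K := ker_int_pos
  set C := Real.log 4 + 4 with hC
  have hCp : 0 < C := by
    have : 0 ≤ Real.log 4 := Real.log_nonneg (by norm_num)
    linarith
  rw [tendsto_order]
  constructor
  · intro c hc
    -- lower bound
    have hlim : Tendsto (fun R : ℝ => K - C * (K - ∫ y in (-R)..R, ker y)) atTop (𝓝 K) := by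
      have := ((ker_trunc.const_sub K).const_mul C).const_sub K
      rw [← hK, sub_self, mul_zero, sub_zero] at this
      exact this
    have hc' : max c 0 < 1 := by simp [hc]
    set c' := max c 0 with hcc
    have hcK : c' * K < K := by nlinarith
    obtain ⟨c2, h2a, h2b⟩ := exists_between hcK
    obtain ⟨R, hR1, hR0⟩ := ((hlim.eventually (lt_mem_nhds h2b)).and (eventually_gt_atTop 0)).exists
    have hlimT : Tendsto (fun T : ℝ => c' * Real.exp (2 * R / T) * K) atTop (𝓝 (c' * K)) := by
      have h := (Real.continuous_exp.tendsto 0).comp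
        (Tendsto.div_atTop (tendsto_const_nhds (x := 2 * R)) tendsto_id)
      have := (h.const_mul c').mul_const K
      simpa using this
    obtain ⟨T, hT1, hT0⟩ :=
      ((hlimT.eventually (gt_mem_nhds h2a)).and (eventually_gt_atTop 0)).exists
    have h3 : Tendsto (fun v : ℝ => ∫ y, beta ((v - R / T) - y / T) * ker y) atTop (𝓝 K) :=
      (RL2 T hT0).comp (tendsto_atTop_add_const_right _ _ tendsto_id)
    have h4 : c' * Real.exp (2 * R / T) * K + C * (K - ∫ y in (-R)..R, ker y) < K := by linarith
    filter_upwards [h3.eventually (lt_mem_nhds h4)] with v hv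
    have h5 := hv.trans_le (lower_ineq T R v hT0 hR0)
    have h6 : c' * (Real.exp (2 * R / T) * K) < beta v * (Real.exp (2 * R / T) * K) := by
      linarith
    have h7 : c' < beta v := lt_of_mul_lt_mul_right h6 (by positivity)
    exact (le_max_left c 0).trans_lt h7
  · intro c hc
    have hcK : K < c * K := by nlinarith
    obtain ⟨c2, h2a, h2b⟩ := exists_between hcK
    have hlim : Tendsto (fun R : ℝ => c * ∫ y in (-R)..R, ker y) atTop (𝓝 (c * K)) :=
      ker_trunc.const_mul c
    obtain ⟨R, hR1, hR0⟩ := ((hlim.eventually (lt_mem_nhds h2b)).and (eventually_gt_atTop 0)).exists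
    have hlimT : Tendsto (fun T : ℝ => c * Real.exp (-(2 * R / T)) * ∫ y in (-R)..R, ker y) atTop
        (𝓝 (c * ∫ y in (-R)..R, ker y)) := by
      have h := (Real.continuous_exp.tendsto (-0)).comp
        (Tendsto.div_atTop (tendsto_const_nhds (x := 2 * R)) tendsto_id).neg
      have := (h.const_mul c).mul_const (∫ y in (-R)..R, ker y)
      simpa using this
    obtain ⟨T, hT1, hT0⟩ :=
      ((hlimT.eventually (lt_mem_nhds hR1)).and (eventually_gt_atTop 0)).exists
    have h3 : Tendsto (fun v : ℝ => ∫ y, beta ((v + R / T) - y / T) * ker y) atTop (𝓝 K) :=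
      (RL2 T hT0).comp (tendsto_atTop_add_const_right _ _ tendsto_id)
    filter_upwards [h3.eventually (gt_mem_nhds (h2a.trans hT1))] with v hv
    have h5 := (upper_ineq T R v hT0 hR0).trans_lt hv
    have hp : 0 < ∫ y in (-R)..R, ker y := by
      by_contra hcon
      have : c * ∫ y in (-R)..R, ker y ≤ 0 := mul_nonpos_of_nonneg_of_nonpos (by linarith) (by linarith)
      linarith
    rw [mul_assoc, mul_assoc] at h5
    exact lt_of_mul_lt_mul_right h5 (by positivity)

theorem tendsto_psi : Tendsto (fun x : ℝ => Chebyshev.psi x / x) atTop (𝓝 1) := by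
  refine (tendsto_beta.comp Real.tendsto_log_atTop).congr' ?_
  filter_upwards [eventually_gt_atTop 0] with x hx
  simp only [Function.comp, beta, Real.exp_neg, Real.exp_log hx]
  rfl

theorem tendsto_theta : Tendsto (fun x : ℝ => Chebyshev.theta x / x) atTop (𝓝 1) := by
  have h1 : Tendsto (fun x : ℝ => (Chebyshev.psi x - Chebyshev.theta x) / x) atTop (𝓝 0) := by
    have : (fun x : ℝ => √x) =o[atTop] (fun x : ℝ => x) := by
      rw [Asymptotics.isLittleO_iff_tendsto']
      · refine (tendsto_inv_atTop_zero.comp Real.tendsto_sqrt_atTop).congr' ?_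
        filter_upwards [eventually_gt_atTop 0] with x hx
        simp only [Function.comp]
        rw [Real.sqrt_div_self]
      · filter_upwards [eventually_gt_atTop 0] with x hx h
        exact absurd h hx.ne'
    exact (Chebyshev.isBigO_psi_sub_theta_sqrt.trans_isLittleO this).tendsto_div_nhds_zero
  have := tendsto_psi.sub h1
  rw [sub_zero] at this
  refine this.congr fun x => ?_
  ring

theorem pnt : Tendsto (fun x : ℝ => (Nat.primeCounting ⌊x⌋₊ : ℝ) * Real.log x / x) atTop (𝓝 1) := by
  have h1 := Chebyshev.primeCounting_sub_theta_div_log_isBigO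
  have h2 : (fun x : ℝ => (Nat.primeCounting ⌊x⌋₊ : ℝ) - Chebyshev.theta x / Real.log x)
      =o[atTop] (fun x : ℝ => x / Real.log x) := by
    refine h1.trans_isLittleO ?_
    rw [Asymptotics.isLittleO_iff_tendsto']
    · refine (tendsto_inv_atTop_zero.comp Real.tendsto_log_atTop).congr' ?_
      filter_upwards [eventually_gt_atTop 1] with x hx
      have := Real.log_pos hx
      simp only [Function.comp]
      field_simp
    · filter_upwards [eventually_gt_atTop 1] with x hx h
      have := Real.log_pos hx
      have : 0 < x / Real.log x := by positivity
      linarith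
  have h3 := tendsto_theta.add h2.tendsto_div_nhds_zero
  rw [add_zero] at h3
  refine h3.congr' ?_
  filter_upwards [eventually_gt_atTop 1] with x hx
  have := Real.log_pos hx
  field_simp
  ring

end PNTaux

open Finset Filter

namespace PNTaux
open Topology

noncomputable def S (n : ℕ) : ℝ := ∑ p ∈ Nat.primesLE n, (1 : ℝ) / p

lemma S_mono : Monotone S := by
  intro a b h
  unfold S
  exact sum_le_sum_of_subset_of_nonneg (Nat.primesLE_mono h) (fun _ _ _ => by positivity)

lemma S_nonneg (n : ℕ) : 0 ≤ S n := sum_nonneg fun _ _ => by positivity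

lemma S_tele (n : ℕ) : ∑ i ∈ range n, (Nat.primeCounting (i+2) : ℝ) / (((i:ℝ)+2) * ((i:ℝ)+3)) =
    S (n+2) - (Nat.primeCounting (n+2) : ℝ) / ((n:ℝ)+2) := by
  induction n with
  | zero =>
    have h2 : Nat.primesLE 2 = {2} := by decide
    have h3 : Nat.primeCounting 2 = 1 := by decide
    simp [S, h2, h3]
  | succ n ih =>
    rw [sum_range_succ, ih]
    have e1 : S (n+1+2) = S (n+2) + (if (n+3).Prime then (1:ℝ)/((n:ℝ)+3) else 0) := by
      unfold S
      rw [show n+1+2 = (n+2)+1 by ring, Nat.primesLE_succ]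
      split_ifs with h
      · rw [sum_insert (Nat.notMem_primesLE _)]
        push_cast
        ring_nf
      · simp
    have e2 : (Nat.primeCounting (n+1+2) : ℝ) = Nat.primeCounting (n+2) + (if (n+3).Prime then (1:ℝ) else 0) := by
      rw [← Nat.primesLE_card_eq_primeCounting, ← Nat.primesLE_card_eq_primeCounting,
        show n+1+2 = (n+2)+1 by ring, Nat.primesLE_succ]
      split_ifs with h
      · rw [card_insert_of_notMem (Nat.notMem_primesLE _)]
        push_cast
        ring
      · simp
    rw [e1, e2]
    push_cast
    have : (n:ℝ)+2 ≠ 0 := by positivity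
    have : (n:ℝ)+3 ≠ 0 := by positivity
    have : (n:ℝ)+1+2 ≠ 0 := by positivity
    split_ifs <;> field_simp <;> ring

noncomputable def LL (x : ℝ) : ℝ := Real.log (Real.log x)

lemma tendsto_LL : Tendsto LL atTop atTop := Real.tendsto_log_atTop.comp Real.tendsto_log_atTop

lemma LL_slope (i : ℕ) : ∃ c ∈ Set.Ioo ((i:ℝ)+2) ((i:ℝ)+3),
    LL ((i:ℝ)+3) - LL ((i:ℝ)+2) = 1 / (c * Real.log c) := by
  have hd : ∀ x ∈ Set.Icc ((i:ℝ)+2) ((i:ℝ)+3), HasDerivAt LL (1 / (x * Real.log x)) x := by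
    intro x hx
    have hx2 : (2:ℝ) ≤ x := by have : (0:ℝ) ≤ i := by positivity
                               linarith [hx.1]
    have hl : 0 < Real.log x := Real.log_pos (by linarith)
    have := (Real.hasDerivAt_log (by linarith : x ≠ 0)).log hl.ne'
    refine this.congr_deriv ?_
    field_simp
  obtain ⟨c, hc, h⟩ := exists_hasDerivAt_eq_slope LL (fun x => 1 / (x * Real.log x))
    (by linarith : (i:ℝ)+2 < (i:ℝ)+3)
    (fun x hx => (hd x hx).continuousAt.continuousWithinAt)
    (fun x hx => hd x (Set.Ioo_subset_Icc_self hx))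
  refine ⟨c, hc, ?_⟩
  rw [h]
  field_simp
  ring

lemma pnt_nat : Tendsto (fun n : ℕ => (Nat.primeCounting n : ℝ) * Real.log n / n) atTop (𝓝 1) := by
  refine (pnt.comp tendsto_natCast_atTop_atTop).congr fun n => ?_
  simp

lemma mertens_nat : Tendsto (fun n : ℕ => S n / LL n) atTop (𝓝 1) := by
  choose c hc1 hc2 using LL_slope
  set g : ℕ → ℝ := fun i => LL ((i:ℝ)+3) - LL ((i:ℝ)+2) with hg
  set a : ℕ → ℝ := fun i => (Nat.primeCounting (i+2) : ℝ) / (((i:ℝ)+2) * ((i:ℝ)+3)) with ha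
  have hcpos : ∀ i, 0 < c i * Real.log (c i) := by
    intro i
    have := (hc1 i).1
    have h0 : (0:ℝ) ≤ i := by positivity
    exact mul_pos (by linarith) (Real.log_pos (by linarith))
  have hgpos : ∀ i, 0 < g i := by
    intro i
    simp only [hg, hc2 i]
    exact one_div_pos.mpr (hcpos i)
  have htel : ∀ n : ℕ, ∑ i ∈ range n, g i = LL ((n:ℝ)+2) - LL 2 := by
    intro n
    induction n with
    | zero => simp
    | succ n ih =>
      rw [sum_range_succ, ih]
      simp only [hg]
      push_cast
      ring_nf
  have hLL2 : Tendsto (fun n : ℕ => LL ((n:ℝ)+2)) atTop atTop :=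
    tendsto_LL.comp (tendsto_atTop_add_const_right _ _ tendsto_natCast_atTop_atTop)
  have hdiv : Tendsto (fun n : ℕ => ∑ i ∈ range n, g i) atTop atTop := by
    simp_rw [htel]
    exact tendsto_atTop_add_const_right _ _ hLL2
  -- ratio
  have hn2 : Tendsto (fun n : ℕ => ((n + 2 : ℕ))) atTop atTop := tendsto_add_atTop_nat 2
  have hpn := pnt_nat.comp hn2
  have hr1 : Tendsto (fun n : ℕ => ((n:ℝ)+2) / ((n:ℝ)+3)) atTop (𝓝 1) := by
    have : Tendsto (fun n : ℕ => 1 - 1 / ((n:ℝ)+3)) atTop (𝓝 (1 - 0)) := by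
      refine Tendsto.const_sub _ (Tendsto.div_atTop tendsto_const_nhds ?_)
      exact tendsto_atTop_add_const_right _ _ tendsto_natCast_atTop_atTop
    rw [sub_zero] at this
    refine this.congr fun n => ?_
    have : (n:ℝ)+3 ≠ 0 := by positivity
    field_simp
    ring
  have hr2 : Tendsto (fun n : ℕ => Real.log ((n:ℝ)+3) / Real.log ((n:ℝ)+2)) atTop (𝓝 1) := by
    have hl2 : Tendsto (fun n : ℕ => Real.log ((n:ℝ)+2)) atTop atTop :=
      Real.tendsto_log_atTop.comp
        (tendsto_atTop_add_const_right _ _ tendsto_natCast_atTop_atTop)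
    have hz : Tendsto (fun n : ℕ => 1 - Real.log (((n:ℝ)+2) / ((n:ℝ)+3)) / Real.log ((n:ℝ)+2)) atTop
        (𝓝 (1 - 0)) := by
      refine Tendsto.const_sub _ ?_
      refine Tendsto.div_atTop (a := Real.log 1) ?_ hl2
      exact (Real.continuousAt_log one_ne_zero).tendsto.comp hr1
    rw [sub_zero] at hz
    refine hz.congr fun n => ?_
    have h2 : 0 < Real.log ((n:ℝ)+2) := Real.log_pos (by have : (0:ℝ) ≤ n := by positivity
                                                         linarith)
    rw [Real.log_div (by positivity) (by positivity)]
    field_simp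
    ring
  have hratio : Tendsto (fun i => a i / g i) atTop (𝓝 1) := by
    have hlow : Tendsto (fun n : ℕ => ((Nat.primeCounting (n+2) : ℝ) * Real.log ((n:ℝ)+2) / ((n:ℝ)+2))
        * (((n:ℝ)+2) / ((n:ℝ)+3))) atTop (𝓝 1) := by
      have := hpn.mul hr1
      rw [mul_one] at this
      refine this.congr fun n => ?_
      simp
    have hup : Tendsto (fun n : ℕ => ((Nat.primeCounting (n+2) : ℝ) * Real.log ((n:ℝ)+2) / ((n:ℝ)+2))
        * (Real.log ((n:ℝ)+3) / Real.log ((n:ℝ)+2))) atTop (𝓝 1) := by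
      have := hpn.mul hr2
      rw [mul_one] at this
      refine this.congr fun n => ?_
      simp
    refine tendsto_of_tendsto_of_tendsto_of_le_of_le hlow hup ?_ ?_
    · intro i
      simp only [ha, hg, hc2 i]
      have h0 : (0:ℝ) ≤ i := by positivity
      have h2 : 0 < Real.log ((i:ℝ)+2) := Real.log_pos (by linarith)
      have h3 := hc1 i
      have h4 : Real.log ((i:ℝ)+2) ≤ Real.log (c i) := Real.log_le_log (by linarith) h3.1.le
      rw [div_div_eq_mul_div, div_one]
      calc _ = (Nat.primeCounting (i+2) : ℝ) / (((i:ℝ)+2) * ((i:ℝ)+3)) * (((i:ℝ)+2) * Real.log ((i:ℝ)+2)) := by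
            field_simp
        _ ≤ _ := by
            have := h3.1.le
            have h6 : (0:ℝ) ≤ c i := by linarith
            gcongr
    · intro i
      simp only [ha, hg, hc2 i]
      have h0 : (0:ℝ) ≤ i := by positivity
      have h2 : 0 < Real.log ((i:ℝ)+2) := Real.log_pos (by linarith)
      have h3 := hc1 i
      have h4 : Real.log (c i) ≤ Real.log ((i:ℝ)+3) := Real.log_le_log (by linarith [h3.1]) h3.2.le
      have h5 : 0 ≤ Real.log (c i) := Real.log_nonneg (by linarith [h3.1])
      rw [div_div_eq_mul_div, div_one]
      calc _ ≤ (Nat.primeCounting (i+2) : ℝ) / (((i:ℝ)+2) * ((i:ℝ)+3)) * (((i:ℝ)+3) * Real.log ((i:ℝ)+3)) := by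
            have := h3.2.le
            gcongr
        _ = _ := by
            field_simp
  have ho : (fun i => a i - g i) =o[atTop] g := by
    rw [Asymptotics.isLittleO_iff_tendsto (fun i h => absurd h (hgpos i).ne')]
    have := hratio.sub_const 1
    rw [sub_self] at this
    refine this.congr fun i => ?_
    have := (hgpos i).ne'
    field_simp
  have hsum := (ho.sum_range (fun i => (hgpos i).le) hdiv).tendsto_div_nhds_zero
  have hA : Tendsto (fun n : ℕ => (∑ i ∈ range n, a i) / ∑ i ∈ range n, g i) atTop (𝓝 1) := by
    have := hsum.add_const 1
    rw [zero_add] at this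
    refine this.congr' ?_
    filter_upwards [hdiv.eventually_gt_atTop 0] with n hn
    rw [sum_sub_distrib]
    field_simp
    ring
  have hB : Tendsto (fun n : ℕ => (∑ i ∈ range n, g i) / LL ((n:ℝ)+2)) atTop (𝓝 1) := by
    have : Tendsto (fun n : ℕ => 1 - LL 2 / LL ((n:ℝ)+2)) atTop (𝓝 (1 - 0)) :=
      Tendsto.const_sub _ (Tendsto.div_atTop tendsto_const_nhds hLL2)
    rw [sub_zero] at this
    refine this.congr' ?_
    filter_upwards [hLL2.eventually_gt_atTop 0] with n hn
    rw [htel]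
    field_simp
  have hC : Tendsto (fun n : ℕ => (Nat.primeCounting (n+2) : ℝ) / ((n:ℝ)+2) / LL ((n:ℝ)+2)) atTop (𝓝 0) := by
    refine squeeze_zero' (g := fun n : ℕ => 1 / LL ((n:ℝ)+2)) ?_ ?_ ?_
    · filter_upwards [hLL2.eventually_gt_atTop 0] with n hn
      positivity
    · filter_upwards [hLL2.eventually_gt_atTop 0] with n hn
      gcongr
      rw [div_le_one (by positivity)]
      have : Nat.primeCounting (n+2) ≤ n + 2 := by
        rw [← Nat.primesLE_card_eq_primeCounting]
        calc _ ≤ (Finset.Icc 1 (n+2)).card := card_le_card (by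
                intro p hp
                rw [Nat.mem_primesLE] at hp
                simp [hp.1, hp.2.one_le])
          _ = _ := by simp
      exact_mod_cast this
    · exact Tendsto.div_atTop tendsto_const_nhds hLL2
  have hD := (hA.mul hB).add hC
  rw [mul_one, add_zero] at hD
  rw [← tendsto_add_atTop_iff_nat 2]
  refine hD.congr' ?_
  filter_upwards [hdiv.eventually_gt_atTop 0, hLL2.eventually_gt_atTop 0] with n hn hn2
  rw [S_tele]
  push_cast
  rw [div_mul_div_cancel₀ hn.ne']
  ring

lemma mertens (α : ℝ) (hα : 0 < α) :
    Tendsto (fun n : ℕ => S ⌊(n:ℝ) ^ α⌋₊ / LL n) atTop (𝓝 1) := by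
  have hpow : Tendsto (fun n : ℕ => (n:ℝ) ^ α) atTop atTop :=
    (tendsto_rpow_atTop hα).comp tendsto_natCast_atTop_atTop
  have hfl : Tendsto (fun n : ℕ => ⌊(n:ℝ) ^ α⌋₊) atTop atTop := tendsto_nat_floor_atTop.comp hpow
  have h1 := mertens_nat.comp hfl
  have hLLn : Tendsto (fun n : ℕ => LL n) atTop atTop := tendsto_LL.comp tendsto_natCast_atTop_atTop
  have h2 : Tendsto (fun n : ℕ => LL (⌊(n:ℝ) ^ α⌋₊) / LL n) atTop (𝓝 1) := by
    have hlow : Tendsto (fun n : ℕ => 1 + (Real.log α - Real.log 2) / LL n) atTop (𝓝 (1 + 0)) :=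
      Tendsto.const_add _ (Tendsto.div_atTop tendsto_const_nhds hLLn)
    have hup : Tendsto (fun n : ℕ => 1 + (Real.log α) / LL n) atTop (𝓝 (1 + 0)) :=
      Tendsto.const_add _ (Tendsto.div_atTop tendsto_const_nhds hLLn)
    rw [add_zero] at hlow hup
    have key : ∀ᶠ n : ℕ in atTop, LL n + (Real.log α - Real.log 2) ≤ LL (⌊(n:ℝ) ^ α⌋₊) ∧
        LL (⌊(n:ℝ) ^ α⌋₊) ≤ LL n + Real.log α := by
      filter_upwards [hpow.eventually_ge_atTop 4, eventually_gt_atTop 1] with n hn hn1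
      have hn1' : (1:ℝ) < n := by exact_mod_cast hn1
      have hlog : 0 < Real.log n := Real.log_pos hn1'
      have hlp : Real.log ((n:ℝ) ^ α) = α * Real.log n := Real.log_rpow (by linarith) α
      set y := (n:ℝ) ^ α with hy
      have hf1 : (⌊y⌋₊ : ℝ) ≤ y := Nat.floor_le (by linarith)
      have hf2 : y < ⌊y⌋₊ + 1 := Nat.lt_floor_add_one y
      have e1 : LL n + Real.log α = LL y := by
        unfold LL
        rw [hlp, Real.log_mul hα.ne' hlog.ne', add_comm]
      have hly : 0 < Real.log y := Real.log_pos (by linarith)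
      constructor
      · rw [← add_sub_assoc, e1]
        unfold LL
        rw [← Real.log_div hly.ne' two_ne_zero]
        refine Real.log_le_log (by positivity) ?_
        have : Real.log y = Real.log (√y) + Real.log (√y) := by
          rw [← Real.log_mul (by positivity) (by positivity), Real.mul_self_sqrt (by linarith)]
        have h5 : Real.log (√y) ≤ Real.log ⌊y⌋₊ := by
          refine Real.log_le_log (by positivity) ?_
          rw [Real.sqrt_le_left (by positivity)]
          have : y - 1 ≤ ⌊y⌋₊ := by linarith
          nlinarith
        linarith
      · rw [e1]
        unfold LL
        refine Real.log_le_log (Real.log_pos (by linarith)) (Real.log_le_log (by linarith) hf1)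
    refine tendsto_of_tendsto_of_tendsto_of_le_of_le' hlow hup ?_ ?_
    · filter_upwards [key, hLLn.eventually_gt_atTop 0] with n hk hn
      rw [le_div_iff₀ hn, add_mul, div_mul_cancel₀ _ hn.ne', one_mul]
      exact hk.1
    · filter_upwards [key, hLLn.eventually_gt_atTop 0] with n hk hn
      rw [div_le_iff₀ hn, add_mul, div_mul_cancel₀ _ hn.ne', one_mul]
      exact hk.2
  have h3 := h1.mul h2
  rw [mul_one] at h3
  refine h3.congr' ?_
  have hne : ∀ᶠ n : ℕ in atTop, LL (⌊(n:ℝ) ^ α⌋₊) ≠ 0 :=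
    ((tendsto_LL.comp tendsto_natCast_atTop_atTop).comp hfl).eventually_ne_atTop 0
  filter_upwards [hne] with n hn
  simp only [Function.comp]
  rw [div_mul_div_cancel₀ hn]

end PNTaux

open Finset Filter

namespace PNTaux
open Topology

lemma pnt_bounds (η : ℝ) (hη : 0 < η) : ∃ x0 : ℝ, 2 ≤ x0 ∧ ∀ x ≥ x0,
    (1 - η) * (x / Real.log x) ≤ (Nat.primeCounting ⌊x⌋₊ : ℝ) ∧
    (Nat.primeCounting ⌊x⌋₊ : ℝ) ≤ (1 + η) * (x / Real.log x) := by
  have h := pnt.eventually (Ioo_mem_nhds (show (1:ℝ) - η < 1 by linarith)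
    (show (1:ℝ) < 1 + η by linarith))
  obtain ⟨x0, hx0⟩ := eventually_atTop.1 h
  refine ⟨max x0 2, le_max_right _ _, fun x hx => ?_⟩
  have h2 : 2 ≤ x := (le_max_right _ _).trans hx
  have h1 := hx0 x ((le_max_left _ _).trans hx)
  have hl : 0 < Real.log x := Real.log_pos (by linarith)
  have hd : 0 < x / Real.log x := by positivity
  have e : (Nat.primeCounting ⌊x⌋₊ : ℝ) * Real.log x / x * (x / Real.log x) =
      (Nat.primeCounting ⌊x⌋₊ : ℝ) := by field_simp
  constructor
  · rw [← e]; exact mul_le_mul_of_nonneg_right h1.1.le hd.le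
  · rw [← e]; exact mul_le_mul_of_nonneg_right h1.2.le hd.le

lemma cheb : ∃ C : ℝ, 1 ≤ C ∧ ∀ x : ℝ, 2 ≤ x →
    (Nat.primeCounting ⌊x⌋₊ : ℝ) ≤ C * (x / Real.log x) := by
  obtain ⟨x0, h2, h⟩ := pnt_bounds 1 one_pos
  refine ⟨2 + x0, by linarith, fun x hx => ?_⟩
  have hl : 0 < Real.log x := Real.log_pos (by linarith)
  have hd : 0 < x / Real.log x := by positivity
  have hd1 : 1 ≤ x / Real.log x := by
    rw [le_div_iff₀ hl]
    linarith [Real.log_le_sub_one_of_pos (show 0 < x by linarith)]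
  by_cases hc : x0 ≤ x
  · refine (h x hc).2.trans ?_
    apply mul_le_mul_of_nonneg_right _ hd.le
    linarith
  · push Not at hc
    have h3 : (Nat.primeCounting ⌊x⌋₊ : ℝ) ≤ x0 := by
      have h4 : Nat.primeCounting ⌊x⌋₊ ≤ ⌊x⌋₊ := by
        rw [← Nat.primesLE_card_eq_primeCounting, Nat.primesLE_eq_filter_Icc_one]
        refine (card_filter_le _ _).trans ?_
        simp
      calc (Nat.primeCounting ⌊x⌋₊ : ℝ) ≤ (⌊x⌋₊ : ℝ) := by exact_mod_cast h4
        _ ≤ x := Nat.floor_le (by linarith)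
        _ ≤ x0 := hc.le
    nlinarith

noncomputable def SP (n : ℕ) : Finset (ℕ × ℕ) :=
  (Nat.primesLE n ×ˢ Nat.primesLE n).filter (fun t => t.1 ≤ t.2 ∧ t.1 * t.2 ≤ n)

lemma mem_SP {n : ℕ} {t : ℕ × ℕ} : t ∈ SP n ↔ t.1.Prime ∧ t.2.Prime ∧ t.1 ≤ t.2 ∧ t.1 * t.2 ≤ n := by
  unfold SP
  simp only [mem_filter, mem_product, Nat.mem_primesLE]
  constructor
  · tauto
  · rintro ⟨h1, h2, h3, h4⟩
    refine ⟨⟨⟨?_, h1⟩, ?_, h2⟩, h3, h4⟩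
    · exact (Nat.le_mul_of_pos_right _ h2.pos).trans h4
    · exact (Nat.le_mul_of_pos_left _ h1.pos).trans h4

lemma SP_card_le (n : ℕ) : ((SP n).card : ℝ) ≤
    ∑ p ∈ Nat.primesLE ⌊(n:ℝ) ^ (1/2:ℝ)⌋₊, (Nat.primeCounting ⌊(n:ℝ) / p⌋₊ : ℝ) := by
  have h : ∀ t ∈ SP n, t.1 ∈ Nat.primesLE ⌊(n:ℝ) ^ (1/2:ℝ)⌋₊ := by
    intro t ht
    rw [mem_SP] at ht
    rw [Nat.mem_primesLE]
    refine ⟨Nat.le_floor ?_, ht.1⟩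
    rw [← Real.sqrt_eq_rpow]
    apply Real.le_sqrt_of_sq_le
    have : t.1 ^ 2 ≤ n := by nlinarith [ht.2.2]
    exact_mod_cast this
  rw [card_eq_sum_card_fiberwise h, Nat.cast_sum]
  refine sum_le_sum fun p hp => ?_
  rw [Nat.floor_div_eq_div, ← Nat.primesLE_card_eq_primeCounting]
  norm_cast
  refine card_le_card_of_injOn (fun t => t.2) ?_ ?_
  · intro t ht
    simp only [coe_filter, Set.mem_ofPred_eq, mem_SP] at ht
    obtain ⟨⟨h1, h2, h3, h4⟩, rfl⟩ := ht
    simp only [SetLike.mem_coe, Nat.mem_primesLE]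
    refine ⟨?_, h2⟩
    rw [Nat.le_div_iff_mul_le h1.pos, mul_comm]
    exact h4
  · intro a ha b hb hab
    simp only [coe_filter, Set.mem_ofPred_eq] at ha hb
    ext
    · rw [ha.2, hb.2]
    · exact hab

lemma SP_upper (ε : ℝ) (hε : 0 < ε) :
    ∀ᶠ n : ℕ in atTop, ((SP n).card : ℝ) ≤ (1 + ε) * (n * LL n / Real.log n) := by
  wlog hε1 : ε ≤ 1 generalizing ε
  · filter_upwards [this 1 one_pos le_rfl, (tendsto_LL.comp tendsto_natCast_atTop_atTop).eventually_gt_atTop 0,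
      eventually_gt_atTop 1] with n hn hL h1
    refine hn.trans ?_
    have : 0 < Real.log n := Real.log_pos (by exact_mod_cast h1)
    simp only [Function.comp] at hL
    gcongr
    linarith
  set η := ε / 8 with hη
  have hη0 : 0 < η := by positivity
  obtain ⟨x0, hx2, hx0⟩ := pnt_bounds η hη0
  have hhalf : (0:ℝ) < 1/2 := by norm_num
  have hm1 := mertens η hη0
  have hm2 := mertens (1/2) hhalf
  set c := (1 + η) / (1 - η) with hc
  have hlim : Tendsto (fun n : ℕ => c * (S ⌊(n:ℝ) ^ η⌋₊ / LL n) +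
      4 * (S ⌊(n:ℝ) ^ (1/2:ℝ)⌋₊ / LL n - S ⌊(n:ℝ) ^ η⌋₊ / LL n)) atTop (𝓝 c) := by
    have := (hm1.const_mul c).add ((hm2.sub hm1).const_mul 4)
    simpa using this
  have hcε : c < 1 + ε := by
    rw [hc, div_lt_iff₀ (by linarith)]
    nlinarith
  have hpow : Tendsto (fun n : ℕ => (n:ℝ) ^ (1/2:ℝ)) atTop atTop :=
    (tendsto_rpow_atTop hhalf).comp tendsto_natCast_atTop_atTop
  filter_upwards [hlim.eventually_lt_const hcε, hpow.eventually_ge_atTop x0,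
    (tendsto_LL.comp tendsto_natCast_atTop_atTop).eventually_gt_atTop 0,
      eventually_gt_atTop 1] with n hn hnx hL h1
  simp only [Function.comp] at hL
  have hn1 : (1:ℝ) < n := by exact_mod_cast h1
  have hl : 0 < Real.log n := Real.log_pos hn1
  have hsub : Nat.primesLE ⌊(n:ℝ) ^ η⌋₊ ⊆ Nat.primesLE ⌊(n:ℝ) ^ (1/2:ℝ)⌋₊ := by
    apply Nat.primesLE_mono
    apply Nat.floor_mono
    apply Real.rpow_le_rpow_of_exponent_le hn1.le
    linarith
  have hc1 : ∀ p : ℕ, ∀ β : ℝ, 0 < β → β ≤ 1/2 → p ∈ Nat.primesLE ⌊(n:ℝ) ^ β⌋₊ →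
      (Nat.primeCounting ⌊(n:ℝ) / p⌋₊ : ℝ) ≤ (1 + η) / (1 - β) * (n / Real.log n) * (1 / p) := by
    intro p β hβ0 hβ hp
    rw [Nat.mem_primesLE] at hp
    have hp0 : (0:ℝ) < p := by exact_mod_cast hp.2.pos
    have hpb : (p:ℝ) ≤ (n:ℝ) ^ β := (Nat.le_floor_iff (by positivity)).1 hp.1
    have hdiv : (n:ℝ) ^ (1 - β) ≤ n / p := by
      rw [Real.rpow_sub (by linarith), Real.rpow_one]
      gcongr
    have hge : x0 ≤ (n:ℝ) / p := by
      refine hnx.trans (le_trans ?_ hdiv)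
      apply Real.rpow_le_rpow_of_exponent_le hn1.le
      linarith
    refine (hx0 _ hge).2.trans ?_
    have hlog : (1 - β) * Real.log n ≤ Real.log (n / p) := by
      rw [← Real.log_rpow (by linarith)]
      exact Real.log_le_log (by positivity) hdiv
    have hb : 0 < 1 - β := by linarith
    calc (1 + η) * ((n:ℝ) / p / Real.log (n / p)) ≤ (1 + η) * ((n:ℝ) / p / ((1 - β) * Real.log n)) := by
          gcongr
      _ = _ := by field_simp
  have hsum : ((SP n).card : ℝ) ≤ (n / Real.log n) * (c * S ⌊(n:ℝ) ^ η⌋₊ +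
      4 * (S ⌊(n:ℝ) ^ (1/2:ℝ)⌋₊ - S ⌊(n:ℝ) ^ η⌋₊)) := by
    refine (SP_card_le n).trans ?_
    have hS : S ⌊(n:ℝ) ^ (1/2:ℝ)⌋₊ - S ⌊(n:ℝ) ^ η⌋₊ =
      ∑ p ∈ Nat.primesLE ⌊(n:ℝ) ^ (1/2:ℝ)⌋₊ \ Nat.primesLE ⌊(n:ℝ) ^ η⌋₊, (1:ℝ) / p := by
      unfold S
      rw [← sum_sdiff hsub]; ring
    rw [hS, ← sum_sdiff hsub]
    have e1 : ∑ p ∈ Nat.primesLE ⌊(n:ℝ) ^ η⌋₊, (Nat.primeCounting ⌊(n:ℝ) / p⌋₊ : ℝ) ≤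
        (n / Real.log n) * (c * S ⌊(n:ℝ) ^ η⌋₊) := by
      unfold S
      rw [← mul_assoc, mul_sum]
      refine sum_le_sum fun p hp => ?_
      refine (hc1 p η hη0 (by linarith) hp).trans (le_of_eq ?_)
      rw [hc]; ring
    have e2 : ∑ p ∈ Nat.primesLE ⌊(n:ℝ) ^ (1/2:ℝ)⌋₊ \ Nat.primesLE ⌊(n:ℝ) ^ η⌋₊,
        (Nat.primeCounting ⌊(n:ℝ) / p⌋₊ : ℝ) ≤
        (n / Real.log n) * (4 * ∑ p ∈ Nat.primesLE ⌊(n:ℝ) ^ (1/2:ℝ)⌋₊ \ Nat.primesLE ⌊(n:ℝ) ^ η⌋₊, (1:ℝ) / p) := by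
      rw [← mul_assoc, mul_sum]
      refine sum_le_sum fun p hp => ?_
      refine (hc1 p (1/2) hhalf le_rfl (mem_sdiff.1 hp).1).trans ?_
      rw [mul_comm _ (4:ℝ)]
      gcongr
      rw [div_le_iff₀ (by norm_num)]
      linarith
    rw [mul_add]
    linarith
  refine hsum.trans ?_
  have hfin : c * S ⌊(n:ℝ) ^ η⌋₊ + 4 * (S ⌊(n:ℝ) ^ (1/2:ℝ)⌋₊ - S ⌊(n:ℝ) ^ η⌋₊) ≤ (1 + ε) * LL n := by
    have := mul_le_mul_of_nonneg_right hn.le hL.le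
    refine le_trans (le_of_eq ?_) this
    field_simp
  calc _ ≤ (n / Real.log n) * ((1 + ε) * LL n) := by gcongr
    _ = _ := by ring

noncomputable def LP (n : ℕ) : Finset (ℕ × ℕ) :=
  (Nat.primesLE ⌊(n:ℝ) ^ (1/4:ℝ)⌋₊ ×ˢ Nat.primesLE n).filter
    (fun t => ⌊(n:ℝ) ^ (1/4:ℝ)⌋₊ < t.2 ∧ t.1 * t.2 ≤ n)

lemma LP_card_ge (n : ℕ) : ∑ p ∈ Nat.primesLE ⌊(n:ℝ) ^ (1/4:ℝ)⌋₊,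
    ((Nat.primeCounting ⌊(n:ℝ) / p⌋₊ : ℝ) - (n:ℝ) ^ (1/4:ℝ)) ≤ (LP n).card := by
  set y := ⌊(n:ℝ) ^ (1/4:ℝ)⌋₊ with hy
  have h : ∀ t ∈ LP n, t.1 ∈ Nat.primesLE y := by
    intro t ht
    simp only [LP, mem_filter, mem_product] at ht
    exact ht.1.1
  rw [card_eq_sum_card_fiberwise h, Nat.cast_sum]
  refine sum_le_sum fun p hp => ?_
  have hpp := Nat.prime_of_mem_primesLE hp
  rw [Nat.floor_div_eq_div, ← Nat.primesLE_card_eq_primeCounting]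
  have h1 : (Nat.primesLE (n / p)).card ≤ ({t ∈ LP n | t.1 = p} : Finset _).card + y := by
    have h2 : (Nat.primesLE (n / p) \ Icc 1 y).card ≤ ({t ∈ LP n | t.1 = p} : Finset _).card := by
      refine card_le_card_of_injOn (fun q => (p, q)) ?_ ?_
      · intro q hq
        simp only [coe_sdiff, Set.mem_sdiff, mem_coe, Nat.mem_primesLE, mem_Icc, not_and, not_le] at hq
        simp only [coe_filter, Set.mem_ofPred_eq, LP, mem_filter, mem_product, and_true]
        have h5 := (Nat.le_div_iff_mul_le hpp.pos).1 hq.1.1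
        refine ⟨⟨hp, ?_⟩, hq.2 hq.1.2.pos, by rwa [mul_comm]⟩
        rw [Nat.mem_primesLE]
        exact ⟨(Nat.le_mul_of_pos_right _ hpp.pos).trans h5, hq.1.2⟩
      · intro a _ b _ hab
        exact (Prod.mk.inj hab).2
    have h3 := le_card_sdiff (Icc 1 y) (Nat.primesLE (n / p))
    rw [Nat.card_Icc] at h3
    omega
  have h2 : (y:ℝ) ≤ (n:ℝ) ^ (1/4:ℝ) := Nat.floor_le (by positivity)
  have h3 : ((Nat.primesLE (n / p)).card : ℝ) ≤ (({t ∈ LP n | t.1 = p} : Finset _).card : ℝ) + y := by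
    exact_mod_cast h1
  linarith

lemma LP_lower (ε : ℝ) (hε : 0 < ε) :
    ∀ᶠ n : ℕ in atTop, (1 - ε) * (n * LL n / Real.log n) ≤ ((LP n).card : ℝ) := by
  set η := ε / 4 with hη
  have hη0 : 0 < η := by positivity
  obtain ⟨x0, hx2, hx0⟩ := pnt_bounds η hη0
  have hq : (0:ℝ) < 1/4 := by norm_num
  have hm1 := mertens (1/4) hq
  have hlim : Tendsto (fun n : ℕ => (1 - η) * (S ⌊(n:ℝ) ^ (1/4:ℝ)⌋₊ / LL n)) atTop (𝓝 (1 - η)) := by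
    have := (hm1.const_mul (1 - η))
    simpa using this
  have hcε : 1 - 2 * η < 1 - η := by linarith
  have hpow : Tendsto (fun n : ℕ => (n:ℝ) ^ (1/4:ℝ)) atTop atTop :=
    (tendsto_rpow_atTop hq).comp tendsto_natCast_atTop_atTop
  have hsm : ∀ᶠ n : ℕ in atTop, Real.log (n:ℝ) ≤ η * (n:ℝ) ^ (1/2:ℝ) := by
    have := (isLittleO_log_rpow_atTop (show (0:ℝ) < 1/2 by norm_num)).def hη0
    have := tendsto_natCast_atTop_atTop (R := ℝ) |>.eventually this
    filter_upwards [this, eventually_gt_atTop 1] with n hn h1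
    have hl : 0 < Real.log n := Real.log_pos (by exact_mod_cast h1)
    rw [Real.norm_of_nonneg hl.le, Real.norm_of_nonneg (by positivity)] at hn
    exact hn
  filter_upwards [hlim.eventually_const_lt hcε, hpow.eventually_ge_atTop x0, hsm,
    (tendsto_LL.comp tendsto_natCast_atTop_atTop).eventually_gt_atTop 1,
      eventually_gt_atTop 1] with n hn hnx hs hL h1
  simp only [Function.comp] at hL
  have hn1 : (1:ℝ) < n := by exact_mod_cast h1
  have hl : 0 < Real.log n := Real.log_pos hn1
  refine le_trans ?_ (LP_card_ge n)
  set y := ⌊(n:ℝ) ^ (1/4:ℝ)⌋₊ with hy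
  have hyy : (y:ℝ) ≤ (n:ℝ) ^ (1/4:ℝ) := Nat.floor_le (by positivity)
  rw [sum_sub_distrib, sum_const, nsmul_eq_mul]
  have hcard : ((Nat.primesLE y).card : ℝ) * (n:ℝ) ^ (1/4:ℝ) ≤ (n:ℝ) ^ (1/2:ℝ) := by
    have : (Nat.primesLE y).card ≤ y := by
      rw [Nat.primesLE_eq_filter_Icc_one]
      refine (card_filter_le _ _).trans ?_
      simp
    have h' : ((Nat.primesLE y).card : ℝ) ≤ y := by exact_mod_cast this
    calc ((Nat.primesLE y).card : ℝ) * (n:ℝ) ^ (1/4:ℝ) ≤ (n:ℝ) ^ (1/4:ℝ) * (n:ℝ) ^ (1/4:ℝ) := by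
          gcongr
          linarith
      _ = _ := by
          rw [← Real.rpow_add (by linarith)]; norm_num
  have hhalf : (n:ℝ) ^ (1/2:ℝ) * (n:ℝ) ^ (1/2:ℝ) = n := by
    rw [← Real.rpow_add (by linarith)]; norm_num
  by_cases hη1 : 1 ≤ η
  · have : (1 - ε) * (n * LL n / Real.log n) ≤ - (n * LL n / Real.log n) := by
      have : 0 < (n * LL n / Real.log n) := by positivity
      nlinarith
    have h5 : (n:ℝ)^(1/2:ℝ) ≤ η * (n * LL n / Real.log n) := by
      rw [mul_div_assoc', le_div_iff₀ hl]
      calc (n:ℝ)^(1/2:ℝ) * Real.log n ≤ (n:ℝ)^(1/2:ℝ) * (η * (n:ℝ)^(1/2:ℝ)) := by gcongr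
        _ = η * n := by rw [mul_left_comm, hhalf]
        _ ≤ η * (n * LL n) := by
          gcongr
          nlinarith
    have h6 : 0 ≤ ∑ p ∈ Nat.primesLE y, (Nat.primeCounting ⌊(n:ℝ) / p⌋₊ : ℝ) :=
      sum_nonneg fun _ _ => by positivity
    have : 0 < (n * LL n / Real.log n) := by positivity
    nlinarith
  push Not at hη1
  have hmain : (n / Real.log n) * ((1 - η) * S y) ≤
      ∑ p ∈ Nat.primesLE y, (Nat.primeCounting ⌊(n:ℝ) / p⌋₊ : ℝ) := by
    unfold S
    rw [← mul_assoc, mul_sum]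
    refine sum_le_sum fun p hp => ?_
    rw [Nat.mem_primesLE] at hp
    have hp0 : (0:ℝ) < p := by exact_mod_cast hp.2.pos
    have hp1 : (1:ℝ) ≤ p := by exact_mod_cast hp.2.one_le
    have hpb : (p:ℝ) ≤ (n:ℝ) ^ (1/4:ℝ) := (Nat.le_floor_iff (by positivity)).1 hp.1
    have hge : (n:ℝ) ^ (1/4:ℝ) ≤ (n:ℝ) / p := by
      rw [le_div_iff₀ hp0]
      calc (n:ℝ) ^ (1/4:ℝ) * p ≤ (n:ℝ) ^ (1/4:ℝ) * (n:ℝ) ^ (1/4:ℝ) := by gcongr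
        _ = (n:ℝ) ^ (1/2:ℝ) := by rw [← Real.rpow_add (by linarith)]; norm_num
        _ ≤ (n:ℝ) ^ (1:ℝ) := Real.rpow_le_rpow_of_exponent_le hn1.le (by norm_num)
        _ = n := Real.rpow_one _
    refine le_trans ?_ (hx0 _ (hnx.trans hge)).1
    have hnp : (n:ℝ)/p ≤ n := div_le_self (by linarith) hp1
    have h2 : 2 ≤ (n:ℝ)/p := hx2.trans (hnx.trans hge)
    have hlog : Real.log ((n:ℝ)/p) ≤ Real.log n := Real.log_le_log (by linarith) hnp
    have hl2 : 0 < Real.log ((n:ℝ)/p) := Real.log_pos (by linarith)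
    calc _ = (1 - η) * ((n:ℝ) / p / Real.log n) := by ring
      _ ≤ _ := by
        gcongr
  have h4 : (n:ℝ)^(1/2:ℝ) ≤ η * (n * LL n / Real.log n) := by
    rw [mul_div_assoc', le_div_iff₀ hl]
    calc (n:ℝ)^(1/2:ℝ) * Real.log n ≤ (n:ℝ)^(1/2:ℝ) * (η * (n:ℝ)^(1/2:ℝ)) := by gcongr
      _ = η * n := by rw [mul_left_comm, hhalf]
      _ ≤ η * (n * LL n) := by
        gcongr
        nlinarith
  have h5 : (1 - 2 * η) * LL n ≤ (1 - η) * S y := by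
    have := mul_le_mul_of_nonneg_right hn.le (zero_le_one.trans hL.le)
    refine this.trans (le_of_eq ?_)
    field_simp
  have h6 : (n / Real.log n) * ((1 - 2 * η) * LL n) ≤ (n / Real.log n) * ((1 - η) * S y) := by
    gcongr
  have h7 : (n / Real.log n) * ((1 - 2 * η) * LL n) = (1 - 2 * η) * (n * LL n / Real.log n) := by ring
  have : 0 < (n * LL n / Real.log n) := by positivity
  nlinarith

end PNTaux

open Finset Filter

namespace PNTaux
open Topology

def Good (A : Finset ℕ) : Prop := ∀ (a : Fin 6 → ℕ) (x : ℕ), (∀ i, a i ∈ A) → StrictMono a → 0 < x →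
  (∏ i, a i) ≠ x ^ 3

lemma six_edges (P Q : Fin 6 → ℕ) (hinj : ∀ i j, P i = P j → Q i = Q j → i = j)
    (hP : ∀ i, 3 ∣ (univ.filter (fun j => P j = P i)).card)
    (hQ : ∀ i, 3 ∣ (univ.filter (fun j => Q j = Q i)).card) : False := by
  set F := univ.filter (fun j => P j = P 0) with hF
  have h3 : ∀ R : Fin 6 → ℕ, ∀ i, 3 ∣ (univ.filter (fun j => R j = R i)).card →
      3 ≤ (univ.filter (fun j => R j = R i)).card := by
    intro R i h
    refine Nat.le_of_dvd (card_pos.2 ⟨i, by simp⟩) h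
  have hF3 : 3 ≤ F.card := h3 P 0 (hP 0)
  have hQinj : (F.image Q).card = F.card := by
    apply card_image_of_injOn
    intro i hi j hj hij
    simp only [hF, coe_filter, mem_univ, true_and, Set.mem_ofPred_eq] at hi hj
    exact hinj i j (hi.trans hj.symm) hij
  have h1 : ∑ b ∈ F.image Q, 3 ≤ ∑ b ∈ F.image Q, (univ.filter (fun j => Q j = b)).card := by
    refine sum_le_sum fun b hb => ?_
    obtain ⟨i, _, rfl⟩ := mem_image.1 hb
    exact h3 Q i (hQ i)
  have h2 : ∑ b ∈ F.image Q, (univ.filter (fun j => Q j = b)).card ≤ 6 := by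
    rw [← card_biUnion]
    · exact (card_le_univ _).trans (by simp)
    · intro a _ b _ hab
      simp only [Function.onFun]
      rw [disjoint_left]
      intro j hj hj'
      simp only [mem_filter, mem_univ, true_and] at hj hj'
      exact hab (hj.symm.trans hj')
  rw [sum_const, smul_eq_mul, hQinj] at h1
  omega

lemma fact_prod (P Q : Fin 6 → ℕ) (hP : ∀ i, (P i).Prime) (hQ : ∀ i, (Q i).Prime) (l : ℕ) (hl : l.Prime) :
    (∏ i, P i * Q i).factorization l = (univ.filter (fun j => P j = l)).card +
      (univ.filter (fun j => Q j = l)).card := by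
  rw [Nat.factorization_prod (fun i _ => Nat.mul_ne_zero (hP i).ne_zero (hQ i).ne_zero)]
  have : ∀ i, ((P i * Q i).factorization l) = (if P i = l then 1 else 0) + (if Q i = l then 1 else 0) := by
    intro i
    rw [Nat.factorization_mul (hP i).ne_zero (hQ i).ne_zero, (hP i).factorization, (hQ i).factorization]
    simp [Finsupp.single_apply]
  rw [Finsupp.coe_finsetSum, Finset.sum_apply]
  simp_rw [this]
  rw [sum_add_distrib, card_filter, card_filter]

lemma good_semi (y : ℕ) (T : Finset (ℕ × ℕ)) (hT : ∀ t ∈ T, t.1.Prime ∧ t.2.Prime ∧ t.1 ≤ y ∧ y < t.2) :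
    Good (T.image (fun t => t.1 * t.2)) ∧ (T.image (fun t => t.1 * t.2)).card = T.card := by
  constructor
  · intro a x ha hmono hx heq
    have : ∀ i, ∃ t ∈ T, t.1 * t.2 = a i := fun i => by simpa using ha i
    choose t ht hta using this
    have hf : ∀ l : ℕ, l.Prime → 3 ∣ (univ.filter (fun j => (t j).1 = l)).card +
      (univ.filter (fun j => (t j).2 = l)).card := by
      intro l hl
      rw [← fact_prod (fun i => (t i).1) (fun i => (t i).2) (fun i => (hT _ (ht i)).1)
        (fun i => (hT _ (ht i)).2.1) l hl]
      simp_rw [hta]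
      rw [heq, Nat.factorization_pow]
      simp
    refine six_edges (fun i => (t i).1) (fun i => (t i).2) ?_ ?_ ?_
    · intro i j h1 h2
      apply hmono.injective
      rw [← hta i, ← hta j]
      rw [h1, h2]
    · intro i
      have h := hf _ (hT _ (ht i)).1
      have h0 : (univ.filter (fun j => (t j).2 = (t i).1)) = ∅ := by
        apply filter_eq_empty_iff.2
        intro j _
        have := hT _ (ht i)
        have := hT _ (ht j)
        omega
      rw [h0] at h
      simpa using h
    · intro i
      have h := hf _ (hT _ (ht i)).2.1
      have h0 : (univ.filter (fun j => (t j).1 = (t i).2)) = ∅ := by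
        apply filter_eq_empty_iff.2
        intro j _
        have := hT _ (ht i)
        have := hT _ (ht j)
        omega
      rw [h0] at h
      simpa using h
  · apply card_image_of_injOn
    intro s hs t ht h
    obtain ⟨a1, a2, a3, a4⟩ := hT s hs
    obtain ⟨b1, b2, b3, b4⟩ := hT t ht
    simp only at h
    have h1 : s.1 ∣ t.1 * t.2 := h ▸ Dvd.intro _ rfl
    have h2 : s.1 = t.1 := by
      rcases (Nat.Prime.dvd_mul a1).1 h1 with h2 | h2
      · exact (Nat.prime_dvd_prime_iff_eq a1 b1).1 h2
      · have := (Nat.prime_dvd_prime_iff_eq a1 b2).1 h2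
        omega
    rw [h2] at h
    exact Prod.ext h2 (Nat.eq_of_mul_eq_mul_left b1.pos h)

def K222free (E : Finset (ℕ × ℕ × ℕ)) : Prop := ∀ u₁ u₂ v₁ v₂ w₁ w₂ : ℕ, u₁ ≠ u₂ → v₁ ≠ v₂ → w₁ ≠ w₂ →
  (u₁, v₁, w₁) ∈ E → (u₁, v₁, w₂) ∈ E → (u₁, v₂, w₁) ∈ E → (u₁, v₂, w₂) ∈ E →
  (u₂, v₁, w₁) ∈ E → (u₂, v₁, w₂) ∈ E → (u₂, v₂, w₁) ∈ E → (u₂, v₂, w₂) ∈ E → False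

lemma good_set {A : Finset ℕ} (hA : Good A) (B : Finset ℕ) (hB : B ⊆ A) (hc : B.card = 6) (x : ℕ) (hx : 0 < x) :
    ∏ b ∈ B, b ≠ x ^ 3 := by
  have := hA (B.orderEmbOfFin hc) x (fun i => hB (B.orderEmbOfFin_mem hc i)) (B.orderEmbOfFin hc).strictMono hx
  intro h
  apply this
  rw [← h, ← Finset.prod_image (g := B.orderEmbOfFin hc) (s := univ) (f := fun b => b)]
  · rw [image_orderEmbOfFin_univ]
  · intro i _ j _ h
    exact (B.orderEmbOfFin hc).injective h

lemma good_K222 {A : Finset ℕ} (hA : Good A) (hA0 : 0 ∉ A) (E : Finset (ℕ × ℕ × ℕ))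
    (hE : ∀ t ∈ E, t.1 * t.2.1 * t.2.2 ∈ A)
    (hinj : Set.InjOn (fun t : ℕ × ℕ × ℕ => t.1 * t.2.1 * t.2.2) E) : K222free E := by
  intro u₁ u₂ v₁ v₂ w₁ w₂ hu hv hw h1 h2 h3 h4 h5 h6 h7 h8
  set B : Finset (ℕ × ℕ × ℕ) := {(u₁, v₁, w₂), (u₁, v₂, w₁), (u₁, v₂, w₂), (u₂, v₁, w₁), (u₂, v₁, w₂), (u₂, v₂, w₁)} with hB
  have hBE : B ⊆ E := by
    intro t ht
    simp only [hB, mem_insert, mem_singleton] at ht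
    rcases ht with rfl | rfl | rfl | rfl | rfl | rfl <;> assumption
  have hBc : B.card = 6 := by
    rw [hB]
    simp [card_insert_of_notMem, hu, hv, hw, hu.symm, hv.symm, hw.symm]
  have hinjB := hinj.mono (coe_subset.2 hBE)
  refine good_set hA (B.image (fun t : ℕ × ℕ × ℕ => t.1 * t.2.1 * t.2.2)) ?_ ?_ (u₁*u₂*v₁*v₂*w₁*w₂) ?_ ?_
  · intro a ha
    obtain ⟨t, ht, rfl⟩ := mem_image.1 ha
    exact hE t (hBE ht)
  · rw [card_image_of_injOn hinjB, hBc]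
  · have e1 := hE _ h1
    have e2 := hE _ h8
    simp only at e1 e2
    apply Nat.pos_of_ne_zero
    intro h0
    apply hA0
    simp only [mul_eq_zero] at h0
    rcases h0 with ((((rfl | rfl) | rfl) | rfl) | rfl) | rfl
    · simpa using e1
    · simpa using e2
    · simpa using e1
    · simpa using e2
    · simpa using e1
    · simpa using e2
  · rw [prod_image hinjB, hB]
    simp [prod_insert, hu, hv, hw, hu.symm, hv.symm, hw.symm]
    ring

lemma split_div (m P : ℕ) (hm : 0 < m) (hP1 : 1 ≤ P) (hP : ∀ l, l.Prime → l ∣ m → l ≤ P) (z : ℝ) (hz1 : 1 ≤ z)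
    (hz : z ≤ m) : ∃ d, d ∣ m ∧ z ≤ d ∧ (d:ℝ) ≤ z * P := by
  classical
  have hex : ∃ d : ℕ, d ∣ m ∧ z ≤ d := ⟨m, dvd_rfl, hz⟩
  obtain ⟨h1, h2⟩ := Nat.find_spec hex
  set d := Nat.find hex with hd
  have hPr : (1:ℝ) ≤ P := by exact_mod_cast hP1
  refine ⟨d, h1, h2, ?_⟩
  by_cases hd1 : d = 1
  · rw [hd1, Nat.cast_one]; nlinarith
  · obtain ⟨l, hl, hld⟩ := Nat.exists_prime_and_dvd hd1
    obtain ⟨e, he⟩ := hld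
    have hd0 : 0 < d := Nat.pos_of_dvd_of_pos h1 hm
    have he0 : 0 < e := by
      rcases Nat.eq_zero_or_pos e with h | h
      · rw [h] at he; omega
      · exact h
    have hlt : e < d := by
      rw [he]; have := hl.two_le; nlinarith
    have := Nat.find_min hex (m := e) hlt
    push Not at this
    have hez := this ((Dvd.intro_left l he.symm).trans h1)
    have hlP : (l:ℝ) ≤ P := by exact_mod_cast hP l hl ((Dvd.intro e he.symm).trans h1)
    rw [he]; push_cast
    have : (0:ℝ) ≤ l := by positivity
    have : (0:ℝ) ≤ e := by positivity
    nlinarith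

lemma C4_bound (V W : Finset ℕ) (G : Finset (ℕ × ℕ)) (hG : G ⊆ V ×ˢ W)
    (hC4 : ∀ v₁ v₂ w₁ w₂ : ℕ, v₁ ≠ v₂ → w₁ ≠ w₂ → (v₁, w₁) ∈ G → (v₁, w₂) ∈ G → (v₂, w₁) ∈ G →
      (v₂, w₂) ∈ G → False) :
    (G.card : ℝ) ≤ W.card + V.card * √(W.card) := by
  set d : ℕ → ℕ := fun w => (G.filter (fun t => t.2 = w)).card with hd
  have he : G.card = ∑ w ∈ W, d w := by
    apply card_eq_sum_card_fiberwise
    intro t ht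
    exact (mem_product.1 (hG ht)).2
  have hpairs : ∑ w ∈ W, (d w * d w - d w) ≤ V.card * V.card := by
    have h1 : ∀ w, d w * d w - d w = ((G.filter (fun t => t.2 = w)).offDiag).card := fun w => by
      rw [offDiag_card]
    simp_rw [h1]
    rw [← card_sigma, ← card_product]
    refine card_le_card_of_injOn (fun s => (s.2.1.1, s.2.2.1)) ?_ ?_
    · rintro ⟨w, s1, s2⟩ hs
      simp only [mem_coe, mem_sigma, mem_offDiag, mem_filter] at hs
      simp only [coe_product, Set.mem_prod, mem_coe]
      exact ⟨(mem_product.1 (hG hs.2.1.1)).1, (mem_product.1 (hG hs.2.2.1.1)).1⟩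
    · rintro ⟨w, ⟨a, b⟩, ⟨a', b'⟩⟩ hs ⟨w', ⟨e, f⟩, ⟨e', f'⟩⟩ hs' h
      simp only [mem_coe, mem_sigma, mem_offDiag, mem_filter] at hs hs'
      simp only [Prod.mk.injEq] at h
      obtain ⟨rfl, rfl⟩ := h
      obtain ⟨hw, ⟨h1, rfl⟩, ⟨h2, rfl⟩, h3⟩ := hs
      obtain ⟨hw', ⟨h1', rfl⟩, ⟨h2', rfl⟩, h3'⟩ := hs'
      have haa : a ≠ a' := by
        rintro rfl; exact h3 rfl
      have : b' = f' := by
        by_contra hne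
        exact hC4 a a' b' f' haa hne h1 h1' h2 h2'
      subst this
      rfl
  have hCS : (G.card : ℝ)^2 ≤ W.card * ∑ w ∈ W, (d w : ℝ)^2 := by
    rw [he]; push_cast
    exact sq_sum_le_card_mul_sum_sq
  have hsq : ∑ w ∈ W, (d w : ℝ)^2 ≤ V.card * V.card + G.card := by
    have : ∑ w ∈ W, (d w * d w) ≤ V.card * V.card + G.card := by
      rw [he]
      calc ∑ w ∈ W, d w * d w = ∑ w ∈ W, ((d w * d w - d w) + d w) := by
            refine sum_congr rfl fun w _ => ?_
            have : d w ≤ d w * d w := Nat.le_mul_self _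
            omega
        _ ≤ _ := by rw [sum_add_distrib]; omega
    have h2 : ((∑ w ∈ W, (d w * d w) : ℕ) : ℝ) ≤ ((V.card * V.card + G.card : ℕ) : ℝ) := by exact_mod_cast this
    push_cast at h2
    simpa [sq] using h2
  set s := √(W.card : ℝ) with hs
  have hs2 : s * s = W.card := Real.mul_self_sqrt (by positivity)
  have hs0 : 0 ≤ s := Real.sqrt_nonneg _
  by_contra hcon
  push Not at hcon
  have hW0 : (0:ℝ) ≤ W.card := by positivity
  have hV0 : (0:ℝ) ≤ V.card := by positivity
  have h1 : (G.card:ℝ)^2 ≤ W.card * (V.card * V.card + G.card) :=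
    hCS.trans (mul_le_mul_of_nonneg_left hsq hW0)
  set e := (G.card : ℝ)
  set v := (V.card : ℝ)
  set w := (W.card : ℝ)
  have h2 : e * (e - w) ≤ (v * s) * (v * s) := by
    have : (v*s)*(v*s) = w * (v * v) := by rw [← hs2]; ring
    nlinarith
  have hvs : 0 ≤ v * s := by positivity
  have h3 : v * s < e - w := by linarith
  have h4 : v * s < e := by linarith
  nlinarith

lemma H_bound (U V W : Finset ℕ) (E : Finset (ℕ × ℕ × ℕ)) (hE : E ⊆ U ×ˢ V ×ˢ W) (hK : K222free E)
    (L : ℝ) (hL : 1 ≤ L) :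
    (E.card : ℝ) ≤ L * (E.image (fun t => t.2)).card +
      1 / L * ((U.card : ℝ)^2 * (W.card + V.card * √(W.card))) := by
  set PP := E.image (fun t => t.2) with hPP
  set d : ℕ × ℕ → ℕ := fun b => (E.filter (fun t => t.2 = b)).card with hd
  have he : E.card = ∑ b ∈ PP, d b := by
    apply card_eq_sum_card_fiberwise
    intro t ht
    exact mem_image_of_mem _ ht
  have hL0 : 0 < L := by linarith
  set G : ℕ × ℕ → Finset (ℕ × ℕ) := fun u => PP.filter (fun b => (u.1, b) ∈ E ∧ (u.2, b) ∈ E) with hGdef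
  have hpairs : ∑ b ∈ PP, (d b * d b - d b) ≤ ∑ u ∈ U.offDiag, (G u).card := by
    have h1 : ∀ b, d b * d b - d b = ((E.filter (fun t => t.2 = b)).offDiag).card := fun w => by
      rw [offDiag_card]
    simp_rw [h1]
    rw [← card_sigma, ← card_sigma]
    refine card_le_card_of_injOn (fun s => ⟨(s.2.1.1, s.2.2.1), s.1⟩) ?_ ?_
    · rintro ⟨b, ⟨a, b1⟩, ⟨a', b2⟩⟩ hs
      simp only [mem_coe, mem_sigma, mem_offDiag, mem_filter] at hs
      obtain ⟨hb, ⟨h1, rfl⟩, ⟨h2, rfl⟩, h3⟩ := hs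
      simp only [mem_coe, mem_sigma, mem_offDiag, hGdef, mem_filter]
      refine ⟨⟨(mem_product.1 (hE h1)).1, (mem_product.1 (hE h2)).1, ?_⟩, hb, h1, h2⟩
      rintro rfl; exact h3 rfl
    · rintro ⟨b, ⟨a, b1⟩, ⟨a', b2⟩⟩ hs ⟨c, ⟨a2, c1⟩, ⟨a2', c2⟩⟩ hs' h
      simp only [mem_coe, mem_sigma, mem_offDiag, mem_filter] at hs hs'
      obtain ⟨hb, ⟨h1, rfl⟩, ⟨h2, rfl⟩, h3⟩ := hs
      obtain ⟨hb', ⟨h1', rfl⟩, ⟨h2', rfl⟩, h3'⟩ := hs'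
      simp only [Sigma.mk.injEq, Prod.mk.injEq, heq_eq_eq] at h
      obtain ⟨⟨rfl, rfl⟩, rfl⟩ := h
      rfl
  have hGb : ∀ u ∈ U.offDiag, ((G u).card : ℝ) ≤ W.card + V.card * √(W.card) := by
    intro u hu
    rw [mem_offDiag] at hu
    apply C4_bound
    · intro b hb
      have := (mem_filter.1 hb).2.1
      exact (mem_product.1 (hE this)).2
    · intro v₁ v₂ w₁ w₂ hv hw h1 h2 h3 h4
      simp only [hGdef, mem_filter] at h1 h2 h3 h4
      exact hK u.1 u.2 v₁ v₂ w₁ w₂ hu.2.2 hv hw h1.2.1 h2.2.1 h3.2.1 h4.2.1 h1.2.2 h2.2.2 h3.2.2 h4.2.2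
  have hdd : ∀ b, (d b : ℝ) ≤ L + 1 / L * ((d b * d b - d b : ℕ) : ℝ) := by
    intro b
    have h1 : d b ≤ d b * d b := Nat.le_mul_self _
    rw [Nat.cast_sub h1]
    push_cast
    set x := (d b : ℝ)
    have : x * L ≤ L * L + (x * x - x) := by nlinarith [sq_nonneg (2 * x - (1 + L)), sq_nonneg (L - 1)]
    have h2 : x * L / L ≤ (L * L + (x * x - x)) / L := by gcongr
    have e1 : x * L / L = x := by field_simp
    have e2 : (L * L + (x * x - x)) / L = L + 1 / L * (x * x - x) := by field_simp
    rwa [e1, e2] at h2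
  have hB0 : (0:ℝ) ≤ W.card + V.card * √(W.card) := by positivity
  calc (E.card : ℝ) = ∑ b ∈ PP, (d b : ℝ) := by rw [he]; push_cast; rfl
    _ ≤ ∑ b ∈ PP, (L + 1 / L * ((d b * d b - d b : ℕ) : ℝ)) := sum_le_sum fun b _ => hdd b
    _ = L * PP.card + 1 / L * ((∑ b ∈ PP, (d b * d b - d b) : ℕ) : ℝ) := by
        rw [sum_add_distrib, sum_const, nsmul_eq_mul, ← mul_sum, mul_comm]
        push_cast; rfl
    _ ≤ L * PP.card + 1 / L * ((U.card : ℝ)^2 * (W.card + V.card * √(W.card))) := by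
        gcongr
        calc ((∑ b ∈ PP, (d b * d b - d b) : ℕ) : ℝ) ≤ ((∑ u ∈ U.offDiag, (G u).card : ℕ) : ℝ) := by
              exact_mod_cast hpairs
          _ = ∑ u ∈ U.offDiag, ((G u).card : ℝ) := by push_cast; rfl
          _ ≤ ∑ u ∈ U.offDiag, (W.card + V.card * √(W.card) : ℝ) := sum_le_sum hGb
          _ = U.offDiag.card * (W.card + V.card * √(W.card) : ℝ) := by rw [sum_const, nsmul_eq_mul]
          _ ≤ _ := by
            gcongr
            rw [offDiag_card, sq]
            have : U.card * U.card - U.card ≤ U.card * U.card := Nat.sub_le _ _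
            exact_mod_cast this

end PNTaux

open Finset Filter

namespace PNTaux
open Topology

lemma blk {A : Finset ℕ} (hA : Good A) (hA0 : 0 ∉ A) (B : Finset ℕ) (hB : B ⊆ A) (f : ℕ → ℕ × ℕ × ℕ)
    (U V W : Finset ℕ) (hf : ∀ a ∈ B, (f a).1 * (f a).2.1 * (f a).2.2 = a)
    (hf2 : ∀ a ∈ B, (f a).1 ∈ U ∧ (f a).2.1 ∈ V ∧ (f a).2.2 ∈ W) (L : ℝ) (hL : 1 ≤ L) :
    (B.card : ℝ) ≤ L * (B.image (fun a => (f a).2)).card +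
      1 / L * ((U.card : ℝ)^2 * (W.card + V.card * √(W.card))) := by
  have hc : (B.image f).card = B.card := by
    apply card_image_of_injOn
    intro a ha b hb h
    rw [← hf a ha, ← hf b hb, h]
  have hK : K222free (B.image f) := by
    apply good_K222 hA hA0
    · intro t ht
      obtain ⟨a, ha, rfl⟩ := mem_image.1 ht
      rw [hf a ha]; exact hB ha
    · intro s hs t ht h
      obtain ⟨a, ha, rfl⟩ := mem_image.1 (mem_coe.1 hs)
      obtain ⟨b, hb, rfl⟩ := mem_image.1 (mem_coe.1 ht)
      simp only at h
      rw [hf a ha, hf b hb] at h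
      rw [h]
  have := H_bound U V W (B.image f) (by
    intro t ht
    obtain ⟨a, ha, rfl⟩ := mem_image.1 ht
    simp only [mem_product]
    exact hf2 a ha) hK L hL
  rw [hc, image_image] at this
  exact this

lemma alg1 (n s b X κ : ℝ) (hn : 1 ≤ n) (hs : 1 ≤ s) (hb : s ^ 8 ≤ b) (hX : X * (s ^ 8 * b) = n) (hκ : 0 ≤ κ)
    (h34 : n ^ (1/4:ℝ) ≤ X) (w : ℝ) (hw0 : 0 ≤ w) (hw : w ≤ κ * X) (hwX : w ≤ X) :
    s ^ 7 * (b * w) + 1 / s ^ 7 * ((s ^ 8) ^ 2 * (w + b * √w)) ≤ 2 * κ * n * (1 / s) + n ^ (59/64:ℝ) := by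
  have hs0 : 0 < s := by linarith
  have hs8 : 1 ≤ s ^ 8 := one_le_pow₀ hs
  have hb0 : 0 < b := by linarith
  have hX0 : 0 < X := lt_of_lt_of_le (by positivity) h34
  have e1 : s ^ 7 * (b * w) ≤ κ * n * (1 / s) := by
    calc s ^ 7 * (b * w) ≤ s ^ 7 * (b * (κ * X)) := by gcongr
      _ = κ * n * (1 / s) := by rw [← hX]; field_simp
  have e2 : 1 / s ^ 7 * ((s ^ 8) ^ 2 * w) ≤ κ * n * (1 / s) := by
    calc 1 / s ^ 7 * ((s ^ 8) ^ 2 * w) = s ^ 9 * w := by field_simp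
      _ ≤ s ^ 9 * (κ * X) := by gcongr
      _ ≤ (s ^ 7 * b) * (κ * X) := by
        gcongr
        calc s ^ 9 ≤ s ^ 15 := pow_le_pow_right₀ hs (by norm_num)
          _ = s ^ 7 * s ^ 8 := by ring
          _ ≤ s ^ 7 * b := by gcongr
      _ = _ := by rw [← hX]; field_simp
  have hn0 : 0 < n := by linarith
  have hprod : s ^ 8 * b ≤ n ^ (3/4:ℝ) := by
    have h1 : n ^ (1/4:ℝ) * (s ^ 8 * b) ≤ n ^ (1/4:ℝ) * n ^ (3/4:ℝ) := by
      rw [← Real.rpow_add hn0]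
      calc n ^ (1/4:ℝ) * (s ^ 8 * b) ≤ X * (s ^ 8 * b) := by gcongr
        _ = n := hX
        _ = _ := by norm_num
    exact le_of_mul_le_mul_left h1 (by positivity)
  have hs16 : s ^ 16 ≤ n ^ (3/4:ℝ) := by
    calc s ^ 16 = s ^ 8 * s ^ 8 := by ring
      _ ≤ s ^ 8 * b := by gcongr
      _ ≤ _ := hprod
  have hs2 : s ^ 2 ≤ n ^ (3/32:ℝ) := by
    have h1 : (s ^ 2) ^ 8 ≤ (n ^ (3/32:ℝ)) ^ 8 := by
      rw [← pow_mul, ← Real.rpow_natCast (n ^ (3/32:ℝ)), ← Real.rpow_mul hn0.le]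
      norm_num
      exact hs16
    exact le_of_pow_le_pow_left₀ (by norm_num) (by positivity) h1
  have e3 : 1 / s ^ 7 * ((s ^ 8) ^ 2 * (b * √w)) ≤ n ^ (59/64:ℝ) := by
    have h1 : 1 / s ^ 7 * ((s ^ 8) ^ 2 * (b * √w)) = s ^ 9 * b * √w := by field_simp
    rw [h1]
    have h2 : (s ^ 9 * b * √w) ^ 2 ≤ (n ^ (59/64:ℝ)) ^ 2 := by
      calc (s ^ 9 * b * √w) ^ 2 = s ^ 18 * b ^ 2 * w := by
            rw [mul_pow, Real.sq_sqrt hw0]; ring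
        _ ≤ s ^ 18 * b ^ 2 * X := by gcongr
        _ = s ^ 2 * (s ^ 8 * b) * (X * (s ^ 8 * b)) := by ring
        _ = s ^ 2 * (s ^ 8 * b) * n := by rw [hX]
        _ ≤ n ^ (3/32:ℝ) * n ^ (3/4:ℝ) * n := by gcongr
        _ = n ^ (3/32:ℝ) * n ^ (3/4:ℝ) * n ^ (1:ℝ) := by rw [Real.rpow_one]
        _ = _ := by
          rw [← Real.rpow_add hn0, ← Real.rpow_add hn0, ← Real.rpow_natCast (n ^ (59/64:ℝ)), ← Real.rpow_mul hn0.le]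
          norm_num
    exact le_of_pow_le_pow_left₀ (by norm_num) (by positivity) h2
  rw [mul_add, mul_add]
  linarith

lemma class_uv : ∃ K : ℝ, 0 < K ∧ ∀ (n : ℕ) (_ : 1 ≤ n) (A : Finset ℕ) (_ : Good A) (_ : A ⊆ Icc 1 n)
    (B : Finset ℕ) (_ : B ⊆ A) (f : ℕ → ℕ × ℕ × ℕ) (κ T : ℝ) (_ : 0 ≤ κ) (_ : 1 ≤ T) (Wp : Finset ℕ)
    (_ : ∀ X : ℝ, (n:ℝ) ^ (1/4:ℝ) ≤ X → ((Wp ∩ Icc 1 ⌊X⌋₊).card : ℝ) ≤ κ * X)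
    (_ : ∀ a ∈ B, (f a).1 * (f a).2.1 * (f a).2.2 = a)
    (_ : ∀ a ∈ B, T ≤ (f a).1 ∧ (f a).1 ≤ (f a).2.1 ∧ (f a).2.1 ≤ (f a).1 ^ 16 ∧
      (n:ℝ) ^ (1/4:ℝ) ≤ (f a).2.2 ∧ (f a).2.2 ∈ Wp),
    (B.card : ℝ) ≤ K * (κ * n * T ^ (-(1/16):ℝ)) + 16 * ((Nat.log 2 n + 1 : ℕ) : ℝ) ^ 2 * (n:ℝ) ^ (59/64:ℝ) := by
  set ρ : ℝ := (2:ℝ) ^ (-(1/16):ℝ) with hρ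
  have hρ0 : 0 < ρ := by positivity
  have hρ1 : ρ < 1 := Real.rpow_lt_one_of_one_lt_of_neg (by norm_num) (by norm_num)
  have hsum : Summable (fun i : ℕ => 4 * ((16 * (i:ℝ) + 16) * ρ ^ i)) := by
    have h1 : Summable (fun i : ℕ => (i:ℝ) ^ 1 * ρ ^ i) :=
      summable_pow_mul_geometric_of_norm_lt_one 1 (by rw [Real.norm_of_nonneg hρ0.le]; exact hρ1)
    have h2 : Summable (fun i : ℕ => ρ ^ i) := summable_geometric_of_lt_one hρ0.le hρ1
    have := (h1.mul_left 64).add (h2.mul_left 64)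
    refine this.congr fun i => ?_
    ring
  refine ⟨∑' i : ℕ, 4 * ((16 * (i:ℝ) + 16) * ρ ^ i), ?_, ?_⟩
  · exact hsum.tsum_pos (fun i => by positivity) 0 (by positivity)
  intro n hn A hA hAn B hB f κ T hκ hT Wp hW hf hf2
  have hn1 : (1:ℝ) ≤ n := by exact_mod_cast hn
  have hn0 : (0:ℝ) < n := by linarith
  set J := Nat.log 2 n + 1 with hJ
  have hA0 : 0 ∉ A := fun h => by simpa using hAn h
  have han : ∀ a ∈ B, 1 ≤ a ∧ a ≤ n := fun a ha => mem_Icc.1 (hAn (hB ha))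
  have hu1 : ∀ a ∈ B, 1 ≤ (f a).1 := fun a ha => by
    have := hT.trans (hf2 a ha).1
    exact_mod_cast this
  set φ : ℕ → (_ : ℕ) × ℕ := fun a => ⟨Nat.log 2 (f a).1, Nat.log 2 (f a).2.1⟩ with hφ
  have hmaps : ∀ a ∈ B, φ a ∈ (range J).sigma (fun i => range (16 * i + 16)) := by
    intro a ha
    have h1 := hu1 a ha
    obtain ⟨h2, h3, h4, h5, h6⟩ := hf2 a ha
    simp only [hφ, mem_sigma, mem_range]
    constructor
    · rw [hJ, Nat.lt_succ_iff]
      apply Nat.log_mono_right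
      refine le_trans ?_ (han a ha).2
      have h7 := hf a ha
      apply Nat.le_of_dvd (han a ha).1
      exact Dvd.intro ((f a).2.1 * (f a).2.2) (by rw [← mul_assoc]; exact h7)
    · apply Nat.log_lt_of_lt_pow (by omega)
      refine h4.trans_lt ?_
      have : (f a).1 < 2 ^ (Nat.log 2 (f a).1 + 1) := Nat.lt_pow_succ_log_self (by norm_num) _
      calc (f a).1 ^ 16 < (2 ^ (Nat.log 2 (f a).1 + 1)) ^ 16 := Nat.pow_lt_pow_left this (by norm_num)
        _ = _ := by rw [← pow_mul]; ring_nf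
  have hTp : 0 < T ^ (-(1/16):ℝ) := by positivity
  have hfib : ∀ x ∈ (range J).sigma (fun i => range (16 * i + 16)),
      ((B.filter (fun a => φ a = x)).card : ℝ) ≤ 4 * ρ ^ x.1 * (κ * n * T ^ (-(1/16):ℝ)) + (n:ℝ) ^ (59/64:ℝ) := by
    rintro ⟨i, j⟩ hx
    set B' := B.filter (fun a => φ a = ⟨i, j⟩) with hB'
    rcases B'.eq_empty_or_nonempty with hemp | hne
    · rw [hemp]; simp only [card_empty, Nat.cast_zero]; positivity
    have hB'p : ∀ a ∈ B', a ∈ B ∧ Nat.log 2 (f a).1 = i ∧ Nat.log 2 (f a).2.1 = j := by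
      intro a ha
      rw [hB', mem_filter] at ha
      refine ⟨ha.1, ?_⟩
      have := ha.2
      simp only [hφ, Sigma.mk.injEq, heq_eq_eq] at this
      exact this
    set X : ℝ := n / (2 ^ i * 2 ^ j) with hX
    have hX0 : 0 < X := by positivity
    have hmem : ∀ a ∈ B', (2 ^ i ≤ (f a).1 ∧ (f a).1 < 2 ^ (i+1)) ∧ (2 ^ j ≤ (f a).2.1 ∧ (f a).2.1 < 2 ^ (j+1)) ∧
        ((f a).2.2 : ℝ) ≤ X := by
      intro a ha
      obtain ⟨haB, h1, h2⟩ := hB'p a ha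
      have hu := hu1 a haB
      obtain ⟨_, h3, h4, h5, h6⟩ := hf2 a haB
      have r1 : 2 ^ i ≤ (f a).1 := by rw [← h1]; exact Nat.pow_log_le_self 2 (by omega)
      have r2 : 2 ^ j ≤ (f a).2.1 := by rw [← h2]; exact Nat.pow_log_le_self 2 (by omega)
      refine ⟨⟨r1, ?_⟩, ⟨r2, ?_⟩, ?_⟩
      · rw [← h1]; exact Nat.lt_pow_succ_log_self (by norm_num) _
      · rw [← h2]; exact Nat.lt_pow_succ_log_self (by norm_num) _
      · rw [hX, le_div_iff₀ (by positivity)]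
        have : (f a).2.2 * (2 ^ i * 2 ^ j) ≤ n := by
          calc (f a).2.2 * (2 ^ i * 2 ^ j) ≤ (f a).2.2 * ((f a).1 * (f a).2.1) := by gcongr
            _ = a := by rw [mul_comm, hf a haB]
            _ ≤ n := (han a haB).2
        exact_mod_cast this
    obtain ⟨a0, ha0⟩ := hne
    obtain ⟨ha0B, hi0, hj0⟩ := hB'p a0 ha0
    obtain ⟨hTu, huv, _, hwX, _⟩ := hf2 a0 ha0B
    obtain ⟨⟨hu0, hu0'⟩, _, hwX'⟩ := hmem a0 ha0
    have hij : i ≤ j := by rw [← hi0, ← hj0]; exact Nat.log_mono_right huv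
    have hXn : (n:ℝ) ^ (1/4:ℝ) ≤ X := hwX.trans hwX'
    set s : ℝ := (2:ℝ) ^ ((i:ℝ)/8) with hs
    have hs1 : 1 ≤ s := Real.one_le_rpow (by norm_num) (by positivity)
    have hs8 : s ^ 8 = 2 ^ i := by
      rw [hs, ← Real.rpow_natCast, ← Real.rpow_mul (by norm_num), ← Real.rpow_natCast]
      congr 1
      push_cast; ring
    set W := Wp ∩ Icc 1 ⌊X⌋₊ with hWd
    have hb := blk hA hA0 B' ((filter_subset _ _).trans hB) f (Ico (2^i) (2^(i+1))) (Ico (2^j) (2^(j+1))) W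
      (fun a ha => hf a (hB'p a ha).1) (by
        intro a ha
        obtain ⟨h1, h2, h3⟩ := hmem a ha
        obtain ⟨_, _, _, h5, h6⟩ := hf2 a (hB'p a ha).1
        refine ⟨mem_Ico.2 h1, mem_Ico.2 h2, ?_⟩
        rw [hWd, mem_inter, mem_Icc]
        refine ⟨h6, ?_, Nat.le_floor h3⟩
        have : (0:ℝ) < (f a).2.2 := lt_of_lt_of_le (by positivity) h5
        exact_mod_cast this) (s ^ 7) (one_le_pow₀ hs1)
    have hUc : ((Ico (2^i) (2^(i+1)) : Finset ℕ).card : ℝ) = 2 ^ i := by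
      rw [Nat.card_Ico, pow_succ]
      have : 2 ^ i * 2 - 2 ^ i = 2 ^ i := by omega
      rw [this]; push_cast; rfl
    have hVc : ((Ico (2^j) (2^(j+1)) : Finset ℕ).card : ℝ) = 2 ^ j := by
      rw [Nat.card_Ico, pow_succ]
      have : 2 ^ j * 2 - 2 ^ j = 2 ^ j := by omega
      rw [this]; push_cast; rfl
    have himg : ((B'.image (fun a => (f a).2)).card : ℝ) ≤ 2 ^ j * W.card := by
      rw [← hVc]
      have : (B'.image (fun a => (f a).2)).card ≤ ((Ico (2^j) (2^(j+1)) : Finset ℕ) ×ˢ W).card := by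
        apply card_le_card
        intro t ht
        obtain ⟨a, ha, rfl⟩ := mem_image.1 ht
        obtain ⟨h1, h2, h3⟩ := hmem a ha
        obtain ⟨_, _, _, h5, h6⟩ := hf2 a (hB'p a ha).1
        rw [mem_product]
        refine ⟨mem_Ico.2 h2, ?_⟩
        rw [hWd, mem_inter, mem_Icc]
        refine ⟨h6, ?_, Nat.le_floor h3⟩
        have : (0:ℝ) < (f a).2.2 := lt_of_lt_of_le (by positivity) h5
        exact_mod_cast this
      rw [card_product] at this
      exact_mod_cast this
    have hwle : (W.card : ℝ) ≤ X := by
      have : W.card ≤ ⌊X⌋₊ := by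
        refine (card_le_card inter_subset_right).trans ?_
        simp
      calc (W.card : ℝ) ≤ (⌊X⌋₊ : ℝ) := by exact_mod_cast this
        _ ≤ X := Nat.floor_le hX0.le
    have halg := alg1 n s (2 ^ j) X κ hn1 hs1 (by
      rw [hs8]; exact pow_le_pow_right₀ (by norm_num) hij) (by rw [hs8, hX]; field_simp) hκ hXn W.card
      (by positivity) (hW X hXn) hwle
    rw [hUc, hVc, ← hs8] at hb
    have hb2 : (B'.card : ℝ) ≤ s ^ 7 * (2 ^ j * W.card) + 1 / s ^ 7 * ((s ^ 8) ^ 2 * (W.card + 2 ^ j * √W.card)) := by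
      refine hb.trans ?_
      gcongr
    refine (hb2.trans halg).trans ?_
    refine add_le_add ?_ le_rfl
    have hρi : ρ ^ i ≤ 2 * T ^ (-(1/16):ℝ) := by
      have h1 : T ≤ 2 * 2 ^ i := by
        have h2 : ((f a0).1 : ℝ) ≤ (2 ^ (i+1) : ℕ) := by exact_mod_cast hu0'.le
        push_cast at h2
        rw [pow_succ] at h2
        linarith
      have h2 : ρ ^ i = ((2:ℝ) ^ i) ^ (-(1/16):ℝ) := by
        rw [hρ, ← Real.rpow_natCast, ← Real.rpow_natCast, ← Real.rpow_mul (by norm_num), ← Real.rpow_mul (by norm_num)]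
        ring_nf
      have h3 : T ^ (1/16:ℝ) ≤ 2 * ((2:ℝ) ^ i) ^ (1/16:ℝ) := by
        calc T ^ (1/16:ℝ) ≤ (2 * 2 ^ i) ^ (1/16:ℝ) := by gcongr
          _ = (2:ℝ) ^ (1/16:ℝ) * (2 ^ i) ^ (1/16:ℝ) := Real.mul_rpow (by norm_num) (by positivity)
          _ ≤ (2:ℝ) ^ (1:ℝ) * (2 ^ i) ^ (1/16:ℝ) := by
            gcongr
            · norm_num
            · norm_num
          _ = _ := by rw [Real.rpow_one]
      rw [h2, Real.rpow_neg (by positivity), Real.rpow_neg (by positivity), ← div_eq_mul_inv,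
        inv_eq_one_div, div_le_div_iff₀ (by positivity) (by positivity)]
      linarith
    have hsρ : 1 / s = ρ ^ i * ρ ^ i := by
      rw [hs, hρ, ← pow_add, ← Real.rpow_natCast, ← Real.rpow_mul (by norm_num), one_div,
        ← Real.rpow_neg (by norm_num)]
      congr 1
      push_cast
      ring
    rw [hsρ]
    calc 2 * κ * n * (ρ ^ i * ρ ^ i) ≤ 2 * κ * n * (ρ ^ i * (2 * T ^ (-(1/16):ℝ))) := by gcongr
      _ = _ := by ring
  rw [card_eq_sum_card_fiberwise hmaps, Nat.cast_sum]
  refine (sum_le_sum hfib).trans ?_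
  rw [sum_sigma]
  simp only [sum_const, card_range, nsmul_eq_mul]
  set Q := κ * n * T ^ (-(1/16):ℝ) with hQ
  have hQ0 : 0 ≤ Q := by positivity
  have hstep : ∀ i ∈ range J, ((16 * i + 16 : ℕ) : ℝ) * (4 * ρ ^ i * Q + (n:ℝ) ^ (59/64:ℝ)) ≤
      4 * ((16 * (i:ℝ) + 16) * ρ ^ i) * Q + 16 * (J:ℝ) * (n:ℝ) ^ (59/64:ℝ) := by
    intro i hi
    have : i + 1 ≤ J := mem_range.1 hi
    have h1 : ((i:ℝ) + 1) ≤ J := by exact_mod_cast this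
    push_cast
    have h2 : 0 ≤ (n:ℝ) ^ (59/64:ℝ) := by positivity
    nlinarith
  refine (sum_le_sum hstep).trans ?_
  rw [sum_add_distrib, sum_const, card_range, nsmul_eq_mul, ← sum_mul]
  have h1 : ∑ i ∈ range J, 4 * ((16 * (i:ℝ) + 16) * ρ ^ i) ≤ ∑' i : ℕ, 4 * ((16 * (i:ℝ) + 16) * ρ ^ i) :=
    hsum.sum_le_tsum _ (fun i _ => by positivity)
  have h2 := mul_le_mul_of_nonneg_right h1 hQ0
  have h3 : (J:ℝ) * (16 * J * (n:ℝ) ^ (59/64:ℝ)) = 16 * (J:ℝ)^2 * (n:ℝ) ^ (59/64:ℝ) := by ring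
  linarith

end PNTaux

open Finset Filter

namespace PNTaux
open Topology

lemma alg2 (n b X w C l u : ℝ) (hn : 1 ≤ n) (hb : 1 ≤ b) (hbn : b * b ≤ n) (hX : X = n / b) (hw0 : 0 ≤ w)
    (hwX : w ≤ X) (hl : 0 < l) (hC : 0 ≤ C) (hw : w ≤ 2 * C * X / l) (hu0 : 0 ≤ u) (hu : u ≤ (2 * b) ^ (1/8:ℝ)) :
    u ^ 2 * (w + b * √w) ≤ 4 * C * b ^ (-(3/4):ℝ) * (n / l) + 2 * n ^ (7/8:ℝ) := by
  have hn0 : 0 < n := by linarith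
  have hb0 : 0 < b := by linarith
  have hX0 : 0 ≤ X := hw0.trans hwX
  have hu2 : u ^ 2 ≤ 2 * b ^ (1/4:ℝ) := by
    calc u ^ 2 ≤ ((2 * b) ^ (1/8:ℝ)) ^ 2 := by gcongr
      _ = (2 * b) ^ (1/4:ℝ) := by
        rw [← Real.rpow_natCast, ← Real.rpow_mul (by positivity)]; norm_num
      _ = 2 ^ (1/4:ℝ) * b ^ (1/4:ℝ) := Real.mul_rpow (by norm_num) hb0.le
      _ ≤ 2 ^ (1:ℝ) * b ^ (1/4:ℝ) := by
        gcongr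
        · norm_num
        · norm_num
      _ = _ := by rw [Real.rpow_one]
  have e1 : u ^ 2 * w ≤ 4 * C * b ^ (-(3/4):ℝ) * (n / l) := by
    calc u ^ 2 * w ≤ (2 * b ^ (1/4:ℝ)) * (2 * C * X / l) := by gcongr
      _ = 4 * C * (b ^ (1/4:ℝ) * b ^ (-1:ℝ)) * (n / l) := by
        rw [hX, Real.rpow_neg_one]; field_simp; ring
      _ = _ := by rw [← Real.rpow_add hb0]; norm_num
  have hbs : b ≤ n ^ (1/2:ℝ) := by
    rw [← Real.sqrt_eq_rpow]; apply Real.le_sqrt_of_sq_le; nlinarith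
  have e2 : u ^ 2 * (b * √w) ≤ 2 * n ^ (7/8:ℝ) := by
    calc u ^ 2 * (b * √w) ≤ (2 * b ^ (1/4:ℝ)) * (b * √X) := by gcongr
      _ = 2 * (b ^ (1/4:ℝ) * b ^ (1:ℝ) * b ^ (-(1/2):ℝ)) * n ^ (1/2:ℝ) := by
        rw [hX, Real.sqrt_div hn0.le, Real.sqrt_eq_rpow, Real.sqrt_eq_rpow, Real.rpow_neg hb0.le, Real.rpow_one]
        field_simp
      _ = 2 * b ^ (3/4:ℝ) * n ^ (1/2:ℝ) := by
        rw [← Real.rpow_add hb0, ← Real.rpow_add hb0]; norm_num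
      _ ≤ 2 * (n ^ (1/2:ℝ)) ^ (3/4:ℝ) * n ^ (1/2:ℝ) := by gcongr
      _ = _ := by
        rw [← Real.rpow_mul hn0.le, mul_assoc, ← Real.rpow_add hn0]; norm_num
  rw [mul_add]
  linarith

lemma class_one : ∃ K : ℝ, 0 < K ∧ ∀ (n : ℕ) (_ : 4 ≤ n) (A : Finset ℕ) (_ : Good A) (_ : A ⊆ Icc 1 n)
    (B : Finset ℕ) (_ : B ⊆ A) (f : ℕ → ℕ × ℕ × ℕ)
    (_ : ∀ a ∈ B, (f a).1 * (f a).2.1 * (f a).2.2 = a)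
    (_ : ∀ a ∈ B, (f a).2.1.Prime ∧ (f a).2.2.Prime ∧ (f a).2.1 ≤ (f a).2.2 ∧ (f a).1 ^ 8 ≤ (f a).2.1),
    (B.card : ℝ) ≤ (SP n).card + K * (n / Real.log n) + 2 * ((Nat.log 2 n + 1 : ℕ) : ℝ) * (n:ℝ) ^ (7/8:ℝ) := by
  obtain ⟨C, hC1, hC⟩ := cheb
  set ρ : ℝ := (2:ℝ) ^ (-(3/4):ℝ) with hρ
  have hρ0 : 0 < ρ := by positivity
  have hρ1 : ρ < 1 := Real.rpow_lt_one_of_one_lt_of_neg (by norm_num) (by norm_num)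
  have hsum : Summable (fun i : ℕ => 4 * C * ρ ^ i) := 
    (summable_geometric_of_lt_one hρ0.le hρ1).mul_left _
  refine ⟨∑' i : ℕ, 4 * C * ρ ^ i, ?_, ?_⟩
  · exact hsum.tsum_pos (fun i => by positivity) 0 (by positivity)
  intro n hn A hA hAn B hB f hf hf2
  have hn4 : (4:ℝ) ≤ n := by exact_mod_cast hn
  have hn0 : (0:ℝ) < n := by linarith
  have hl : 0 < Real.log n := Real.log_pos (by linarith)
  set J := Nat.log 2 n + 1 with hJ
  have hA0 : 0 ∉ A := fun h => by simpa using hAn h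
  have han : ∀ a ∈ B, 1 ≤ a ∧ a ≤ n := fun a ha => mem_Icc.1 (hAn (hB ha))
  have hr1 : ∀ a ∈ B, 1 ≤ (f a).1 := fun a ha => by
    apply Nat.pos_of_ne_zero
    intro h0
    have := hf a ha
    rw [h0] at this
    have := (han a ha).1
    omega
  have hpq : ∀ a ∈ B, (f a).2.1 * (f a).2.2 ≤ n := fun a ha => by
    refine le_trans ?_ (han a ha).2
    have h1 := hf a ha
    have h2 := hr1 a ha
    calc (f a).2.1 * (f a).2.2 ≤ (f a).1 * ((f a).2.1 * (f a).2.2) := Nat.le_mul_of_pos_left _ h2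
      _ = a := by rw [← mul_assoc, h1]
  have hmaps : ∀ a ∈ B, Nat.log 2 (f a).2.1 ∈ range J := by
    intro a ha
    rw [mem_range, hJ, Nat.lt_succ_iff]
    apply Nat.log_mono_right
    exact (Nat.le_mul_of_pos_right _ (hf2 a ha).2.1.pos).trans (hpq a ha)
  have hfib : ∀ j ∈ range J, ((B.filter (fun a => Nat.log 2 (f a).2.1 = j)).card : ℝ) ≤
      (((B.filter (fun a => Nat.log 2 (f a).2.1 = j)).image (fun a => (f a).2)).card : ℝ) +
      (4 * C * ρ ^ j * (n / Real.log n) + 2 * (n:ℝ) ^ (7/8:ℝ)) := by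
    intro j hj
    set B' := B.filter (fun a => Nat.log 2 (f a).2.1 = j) with hB'
    rcases B'.eq_empty_or_nonempty with hemp | hne
    · rw [hemp]; simp only [card_empty, Nat.cast_zero]; positivity
    set X : ℝ := n / 2 ^ j with hX
    have hmem : ∀ a ∈ B', a ∈ B ∧ (2 ^ j ≤ (f a).2.1 ∧ (f a).2.1 < 2 ^ (j+1)) ∧ ((f a).2.2 : ℝ) ≤ X := by
      intro a ha
      rw [hB', mem_filter] at ha
      obtain ⟨haB, h2⟩ := ha
      have r2 : 2 ^ j ≤ (f a).2.1 := by rw [← h2]; exact Nat.pow_log_le_self 2 (hf2 a haB).1.ne_zero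
      refine ⟨haB, ⟨r2, ?_⟩, ?_⟩
      · rw [← h2]; exact Nat.lt_pow_succ_log_self (by norm_num) _
      · rw [hX, le_div_iff₀ (by positivity)]
        have : (f a).2.2 * 2 ^ j ≤ n := by
          calc (f a).2.2 * 2 ^ j ≤ (f a).2.2 * (f a).2.1 := by gcongr
            _ ≤ n := by rw [mul_comm]; exact hpq a haB
        exact_mod_cast this
    obtain ⟨a0, ha0⟩ := hne
    obtain ⟨ha0B, ⟨hp0, _⟩, hq0⟩ := hmem a0 ha0
    have hbn : (2:ℝ) ^ j * 2 ^ j ≤ n := by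
      have : 2 ^ j * 2 ^ j ≤ n := by
        refine le_trans ?_ (hpq a0 ha0B)
        exact Nat.mul_le_mul hp0 (hp0.trans (hf2 a0 ha0B).2.2.1)
      exact_mod_cast this
    have hXs : √n ≤ X := by
      rw [hX, le_div_iff₀ (by positivity)]
      have : (2:ℝ) ^ j ≤ √n := Real.le_sqrt_of_sq_le (by nlinarith)
      calc √n * 2 ^ j ≤ √n * √n := by gcongr
        _ = n := Real.mul_self_sqrt hn0.le
    have hs2 : 2 ≤ √(n:ℝ) := Real.le_sqrt_of_sq_le (by linarith)
    have hX2 : 2 ≤ X := hs2.trans hXs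
    have hX0 : 0 < X := by linarith
    have hlX : Real.log n / 2 ≤ Real.log X := by
      rw [← Real.log_sqrt hn0.le]
      exact Real.log_le_log (by linarith) hXs
    set W := Nat.primesLE ⌊X⌋₊ with hWd
    set U := Icc 1 ⌊(2 * 2 ^ j : ℝ) ^ (1/8:ℝ)⌋₊ with hUd
    have hb := blk hA hA0 B' ((filter_subset _ _).trans hB) f U (Ico (2^j) (2^(j+1))) W
      (fun a ha => hf a (hmem a ha).1) (by
        intro a ha
        obtain ⟨haB, h2, h3⟩ := hmem a ha
        obtain ⟨g1, g2, g3, g4⟩ := hf2 a haB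
        refine ⟨?_, mem_Ico.2 h2, ?_⟩
        · rw [hUd, mem_Icc]
          refine ⟨hr1 a haB, Nat.le_floor ?_⟩
          have h5 : ((f a).1 : ℝ) ^ 8 ≤ 2 * 2 ^ j := by
            have : (f a).1 ^ 8 ≤ 2 * 2 ^ j := by
              rw [pow_succ] at h2; omega
            exact_mod_cast this
          calc ((f a).1 : ℝ) = (((f a).1 : ℝ) ^ 8) ^ (1/8:ℝ) := by
                rw [← Real.rpow_natCast, ← Real.rpow_mul (by positivity)]; norm_num
            _ ≤ _ := by gcongr
        · rw [hWd, Nat.mem_primesLE]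
          exact ⟨Nat.le_floor h3, g2⟩) 1 le_rfl
    have hVc : ((Ico (2^j) (2^(j+1)) : Finset ℕ).card : ℝ) = 2 ^ j := by
      rw [Nat.card_Ico, pow_succ]
      have : 2 ^ j * 2 - 2 ^ j = 2 ^ j := by omega
      rw [this]; push_cast; rfl
    have hUc : (U.card : ℝ) ≤ (2 * 2 ^ j : ℝ) ^ (1/8:ℝ) := by
      rw [hUd, Nat.card_Icc, Nat.add_sub_cancel]
      exact Nat.floor_le (by positivity)
    have hwle : (W.card : ℝ) ≤ X := by
      have : W.card ≤ ⌊X⌋₊ := by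
        rw [hWd, Nat.primesLE_eq_filter_Icc_one]
        refine (card_filter_le _ _).trans ?_
        simp
      calc (W.card : ℝ) ≤ (⌊X⌋₊ : ℝ) := by exact_mod_cast this
        _ ≤ X := Nat.floor_le hX0.le
    have hwC : (W.card : ℝ) ≤ 2 * C * X / Real.log n := by
      rw [hWd, Nat.primesLE_card_eq_primeCounting]
      refine (hC X hX2).trans ?_
      calc C * (X / Real.log X) ≤ C * (X / (Real.log n / 2)) := by gcongr
        _ = _ := by field_simp
    have halg := alg2 n (2 ^ j) X W.card C (Real.log n) U.card (by linarith) (one_le_pow₀ (by norm_num)) hbn hX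
      (by positivity) hwle hl (by linarith) hwC (by positivity) hUc
    rw [hVc, one_mul, div_one, one_mul] at hb
    refine hb.trans ?_
    have hρj : ((2:ℝ) ^ j) ^ (-(3/4):ℝ) = ρ ^ j := by
      rw [hρ, ← Real.rpow_natCast, ← Real.rpow_natCast, ← Real.rpow_mul (by norm_num), ← Real.rpow_mul (by norm_num)]
      ring_nf
    rw [hρj] at halg
    linarith
  have himg : ∑ j ∈ range J, (((B.filter (fun a => Nat.log 2 (f a).2.1 = j)).image (fun a => (f a).2)).card : ℝ)
      ≤ (SP n).card := by
    rw [← Nat.cast_sum, ← card_biUnion]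
    · have : ((range J).biUnion (fun j => (B.filter (fun a => Nat.log 2 (f a).2.1 = j)).image (fun a => (f a).2))).card
          ≤ (SP n).card := by
        apply card_le_card
        intro t ht
        obtain ⟨j, _, ht⟩ := mem_biUnion.1 ht
        obtain ⟨a, ha, rfl⟩ := mem_image.1 ht
        have haB := (mem_filter.1 ha).1
        obtain ⟨g1, g2, g3, g4⟩ := hf2 a haB
        exact mem_SP.2 ⟨g1, g2, g3, hpq a haB⟩
      exact_mod_cast this
    · intro j _ k _ hjk
      simp only [Function.onFun]
      rw [disjoint_left]
      intro t ht ht'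
      obtain ⟨a, ha, rfl⟩ := mem_image.1 ht
      obtain ⟨b, hb, hab⟩ := mem_image.1 ht'
      apply hjk
      rw [← (mem_filter.1 ha).2, ← (mem_filter.1 hb).2]
      rw [hab]
  rw [card_eq_sum_card_fiberwise hmaps, Nat.cast_sum]
  refine (sum_le_sum hfib).trans ?_
  rw [sum_add_distrib, sum_add_distrib, sum_const, card_range, nsmul_eq_mul, ← sum_mul]
  have h1 : ∑ i ∈ range J, 4 * C * ρ ^ i ≤ ∑' i : ℕ, 4 * C * ρ ^ i :=
    hsum.sum_le_tsum _ (fun i _ => by positivity)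
  have h2 := mul_le_mul_of_nonneg_right h1 (show 0 ≤ n / Real.log n by positivity)
  have h3 : (J:ℝ) * (2 * (n:ℝ) ^ (7/8:ℝ)) = 2 * (J:ℝ) * (n:ℝ) ^ (7/8:ℝ) := by ring
  linarith

end PNTaux

open Finset Filter

namespace PNTaux
open Topology

lemma exists_max_prime (a : ℕ) (ha : 2 ≤ a) : ∃ q b, q.Prime ∧ a = b * q ∧ ∀ l, l.Prime → l ∣ a → l ≤ q := by
  obtain ⟨q, hq, hmax⟩ := exists_max_image a.primeFactors (fun x => x) (Nat.nonempty_primeFactors.2 (by omega))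
  rw [Nat.mem_primeFactors] at hq
  obtain ⟨b, hb⟩ := hq.2.1
  refine ⟨q, b, hq.1, by rw [hb, mul_comm], fun l hl hla => ?_⟩
  exact hmax l (Nat.mem_primeFactors.2 ⟨hl, hla, by omega⟩)

lemma sort_pair (x y : ℕ) : ∃ u v, u * v = x * y ∧ u ≤ v ∧ (u = x ∨ u = y) := by
  rcases le_total x y with h | h
  · exact ⟨x, y, rfl, h, Or.inl rfl⟩
  · exact ⟨y, x, mul_comm _ _, h, Or.inr rfl⟩

def Cl1 (t : ℕ × ℕ × ℕ) : Prop := t.2.1.Prime ∧ t.2.2.Prime ∧ t.2.1 ≤ t.2.2 ∧ t.1 ^ 8 ≤ t.2.1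

def Cluv (n : ℕ) (T : ℝ) (t : ℕ × ℕ × ℕ) : Prop := T ≤ t.1 ∧ t.1 ≤ t.2.1 ∧ t.2.1 ≤ t.1 ^ 16 ∧
      (n:ℝ) ^ (1/4:ℝ) ≤ t.2.2

lemma decomp3 (n a q : ℕ) (ha1 : 1 ≤ a) (han : a ≤ n) (hbig : (n:ℝ) ^ (15/16:ℝ) < a) (hq1 : q.Prime)
    (hq : ∀ l, l.Prime → l ∣ a → l ≤ q) (hqn : (q:ℝ) < (n:ℝ) ^ (1/4:ℝ)) :
    ∃ t : ℕ × ℕ × ℕ, t.1 * t.2.1 * t.2.2 = a ∧ Cluv n ((n:ℝ) ^ (1/16:ℝ)) t := by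
  set N := (n:ℝ) with hN
  have hN1 : 1 ≤ N := by rw [hN]; exact_mod_cast ha1.trans han
  have hN0 : 0 < N := by linarith
  have hmono : ∀ x y : ℝ, x ≤ y → N ^ x ≤ N ^ y := fun x y h => Real.rpow_le_rpow_of_exponent_le hN1 h
  have hone : ∀ x : ℝ, 0 ≤ x → 1 ≤ N ^ x := fun x h => Real.one_le_rpow hN1 h
  obtain ⟨w, hwa, hw1, hw2⟩ := split_div a q ha1 hq1.one_le hq (N ^ (1/4:ℝ)) (hone _ (by norm_num))
    ((hmono _ _ (by norm_num)).trans hbig.le)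
  obtain ⟨m, hm⟩ := hwa
  have hw3 : (w:ℝ) ≤ N ^ (1/2:ℝ) := by
    refine hw2.trans ?_
    calc N ^ (1/4:ℝ) * q ≤ N ^ (1/4:ℝ) * N ^ (1/4:ℝ) := by gcongr
      _ = _ := by rw [← Real.rpow_add hN0]; norm_num
  have hm0 : 0 < m := by
    rcases Nat.eq_zero_or_pos m with h | h
    · rw [h] at hm; omega
    · exact h
  have hmbig : N ^ (7/16:ℝ) ≤ m := by
    have h1 : N ^ (7/16:ℝ) * N ^ (1/2:ℝ) ≤ m * N ^ (1/2:ℝ) := by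
      rw [← Real.rpow_add hN0]
      calc N ^ (7/16 + 1/2:ℝ) = N ^ (15/16:ℝ) := by norm_num
        _ ≤ a := hbig.le
        _ = m * w := by rw [hm]; push_cast; ring
        _ ≤ _ := by gcongr
    exact le_of_mul_le_mul_right h1 (by positivity)
  obtain ⟨d, hdm, hd1, hd2⟩ := split_div m q hm0 hq1.one_le (fun l hl hlm => hq l hl (hm ▸ hlm.mul_left w))
    (N ^ (1/16:ℝ)) (hone _ (by norm_num)) ((hmono _ _ (by norm_num)).trans hmbig)
  obtain ⟨e, he⟩ := hdm
  have hd3 : (d:ℝ) ≤ N ^ (5/16:ℝ) := by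
    refine hd2.trans ?_
    calc N ^ (1/16:ℝ) * q ≤ N ^ (1/16:ℝ) * N ^ (1/4:ℝ) := by gcongr
      _ = _ := by rw [← Real.rpow_add hN0]; norm_num
  have hebig : N ^ (1/8:ℝ) ≤ e := by
    have h1 : N ^ (1/8:ℝ) * N ^ (5/16:ℝ) ≤ e * N ^ (5/16:ℝ) := by
      rw [← Real.rpow_add hN0]
      calc N ^ (1/8 + 5/16:ℝ) = N ^ (7/16:ℝ) := by norm_num
        _ ≤ m := hmbig
        _ = e * d := by rw [he]; push_cast; ring
        _ ≤ _ := by gcongr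
    exact le_of_mul_le_mul_right h1 (by positivity)
  obtain ⟨u, v, huv, hle, hor⟩ := sort_pair d e
  have hu : N ^ (1/16:ℝ) ≤ u := by
    rcases hor with rfl | rfl
    · exact hd1
    · exact (hmono _ _ (by norm_num)).trans hebig
  refine ⟨(u, v, w), ?_, hu, hle, ?_, hw1⟩
  · simp only; rw [huv, ← he, hm, mul_comm]
  · simp only
    have h1 : n ≤ u ^ 16 := by
      have : N ≤ (u:ℝ) ^ 16 := by
        calc N = (N ^ (1/16:ℝ)) ^ 16 := by rw [← Real.rpow_natCast, ← Real.rpow_mul hN0.le]; norm_num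
          _ ≤ _ := by gcongr
      rw [hN] at this
      exact_mod_cast this
    refine le_trans ?_ h1
    refine le_trans (Nat.le_of_dvd ha1 ?_) han
    rw [hm, he, ← huv]
    exact ((dvd_refl v).mul_left u).mul_left w

lemma decomp12 (n a q b : ℕ) (ha1 : 1 ≤ a) (hq1 : q.Prime) (hb : 2 ≤ b) (hab : a = b * q)
    (hq : ∀ l, l.Prime → l ∣ a → l ≤ q) (hqn : (n:ℝ) ^ (1/4:ℝ) ≤ q) :
    ∃ t : ℕ × ℕ × ℕ, t.1 * t.2.1 * t.2.2 = a ∧ (Cl1 t ∨ (Cluv n 1 t ∧ t.2.2.Prime)) := by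
  obtain ⟨p, r, hp, hbr, hpm⟩ := exists_max_prime b hb
  have hpq : p ≤ q := hq p hp (by rw [hab, hbr]; exact ((dvd_refl p).mul_left r).mul_right q)
  have hr0 : 0 < r := by
    rcases Nat.eq_zero_or_pos r with h | h
    · rw [h] at hbr; omega
    · exact h
  by_cases h8 : r ^ 8 ≤ p
  · exact ⟨(r, p, q), by rw [hab, hbr], Or.inl ⟨hp, hq1, hpq, h8⟩⟩
  push Not at h8
  suffices h : ∃ u v, u * v = b ∧ 1 ≤ u ∧ u ≤ v ∧ v ≤ u ^ 16 by
    obtain ⟨u, v, h1, h2, h3, h4⟩ := h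
    exact ⟨(u, v, q), by simp only; rw [h1, hab], Or.inr ⟨⟨by exact_mod_cast h2, h3, h4, hqn⟩, hq1⟩⟩
  rcases lt_or_ge r p with hrp | hrp
  · exact ⟨r, p, hbr.symm, hr0, hrp.le, h8.le.trans (Nat.pow_le_pow_right hr0 (by norm_num))⟩
  · have hb0 : 0 < b := by omega
    have hr1 : (1:ℝ) ≤ r := by exact_mod_cast hr0
    have hp1 : (1:ℝ) ≤ p := by exact_mod_cast hp.one_le
    have hz1 : 1 ≤ √(r:ℝ) := Real.one_le_sqrt.2 hr1
    have hzz : √(r:ℝ) * √(r:ℝ) = r := Real.mul_self_sqrt (by linarith)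
    have hbR : (b:ℝ) = r * p := by rw [hbr]; push_cast; ring
    obtain ⟨d, hdb, hd1, hd2⟩ := split_div b p hb0 hp.one_le hpm (√r) hz1 (by rw [hbR]; nlinarith)
    obtain ⟨e, he⟩ := hdb
    have hebig : √(r:ℝ) ≤ e := by
      have h1 : √(r:ℝ) * (√(r:ℝ) * p) ≤ e * (√(r:ℝ) * p) := by
        calc √(r:ℝ) * (√(r:ℝ) * p) = b := by rw [hbR, ← mul_assoc, hzz]
          _ = e * d := by rw [he]; push_cast; ring
          _ ≤ _ := by gcongr
      exact le_of_mul_le_mul_right h1 (by positivity)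
    obtain ⟨u, v, huv, hle, hor⟩ := sort_pair d e
    have hu : √(r:ℝ) ≤ u := by
      rcases hor with rfl | rfl
      · exact hd1
      · exact hebig
    have hu2 : r ≤ u ^ 2 := by
      have : (r:ℝ) ≤ (u:ℝ) ^ 2 := by rw [← hzz]; nlinarith
      exact_mod_cast this
    have hu0 : 1 ≤ u := by
      have := hz1.trans hu
      exact_mod_cast this
    refine ⟨u, v, by rw [huv, he], hu0, hle, ?_⟩
    calc v ≤ u * v := Nat.le_mul_of_pos_left _ hu0
      _ = b := by rw [huv, he]
      _ = r * p := hbr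
      _ ≤ r * r := Nat.mul_le_mul_left _ hrp
      _ ≤ u ^ 2 * u ^ 2 := Nat.mul_le_mul hu2 hu2
      _ = u ^ 4 := by ring
      _ ≤ u ^ 16 := Nat.pow_le_pow_right hu0 (by norm_num)

lemma small_terms (c M : ℝ) (hc : c < 1) (hM : 0 < M) :
    ∀ᶠ n : ℕ in atTop, M * Real.log n ^ 2 * (n:ℝ) ^ c ≤ n / Real.log n := by
  have h := (isLittleO_log_rpow_rpow_atTop (3:ℝ) (show 0 < 1 - c by linarith)).def (show 0 < 1 / M by positivity)
  have h2 := (tendsto_natCast_atTop_atTop (R := ℝ)).eventually h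
  filter_upwards [h2, eventually_gt_atTop 1] with n hn h1
  have hn1 : (1:ℝ) < n := by exact_mod_cast h1
  have hn0 : (0:ℝ) < n := by linarith
  have hl : 0 < Real.log n := Real.log_pos hn1
  rw [Real.norm_of_nonneg (by positivity), Real.norm_of_nonneg (by positivity)] at hn
  rw [le_div_iff₀ hl]
  have h3 : Real.log n ^ (3:ℝ) = Real.log n ^ 2 * Real.log n := by
    rw [← pow_succ]
    exact_mod_cast Real.rpow_natCast (Real.log n) 3
  rw [h3] at hn
  calc M * Real.log n ^ 2 * (n:ℝ) ^ c * Real.log n = M * (Real.log n ^ 2 * Real.log n) * (n:ℝ) ^ c := by ring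
    _ ≤ M * (1 / M * (n:ℝ) ^ (1 - c)) * (n:ℝ) ^ c := by gcongr
    _ = (n:ℝ) ^ (1 - c) * (n:ℝ) ^ c := by field_simp
    _ = n := by rw [← Real.rpow_add hn0]; norm_num

lemma J_le (n : ℕ) (hn : 3 ≤ n) : ((Nat.log 2 n + 1 : ℕ) : ℝ) ≤ 3 * Real.log n := by
  have hn3 : (3:ℝ) ≤ n := by exact_mod_cast hn
  have h1 : (1:ℝ) ≤ Real.log n := by
    rw [Real.le_log_iff_exp_le (by linarith)]
    linarith [Real.exp_one_lt_d9]
  have h2 : (2:ℝ) ^ (Nat.log 2 n) ≤ n := by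
    exact_mod_cast Nat.pow_log_le_self 2 (by omega : n ≠ 0)
  have h3 := Real.log_le_log (by positivity) h2
  rw [Real.log_pow] at h3
  have := Real.log_two_gt_d9
  push_cast
  have h4 : (0:ℝ) ≤ (Nat.log 2 n : ℝ) := by positivity
  nlinarith

lemma upper : ∃ K : ℝ, 0 < K ∧ ∀ᶠ n : ℕ in atTop, ∀ A : Finset ℕ, Good A → A ⊆ Icc 1 n →
    (A.card : ℝ) ≤ (SP n).card + K * (n / Real.log n) := by
  classical
  obtain ⟨C, hC1, hC⟩ := cheb
  obtain ⟨K1, hK1, hcl1⟩ := class_one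
  obtain ⟨K2, hK2, hcl2⟩ := class_uv
  refine ⟨C + K1 + 4 * C * K2 + 5, by positivity, ?_⟩
  filter_upwards [eventually_ge_atTop 16, small_terms (15/16) 1 (by norm_num) one_pos,
    small_terms (7/8) 6 (by norm_num) (by norm_num), small_terms (59/64) 144 (by norm_num) (by norm_num),
    small_terms (255/256) K2 (by norm_num) hK2] with n hn16 s1 s2 s3 s4 A hA hAn
  have hn : (16:ℝ) ≤ n := by exact_mod_cast hn16
  have hn0 : (0:ℝ) < n := by linarith
  have hn1 : (1:ℝ) ≤ n := by linarith
  have hl : 0 < Real.log n := Real.log_pos (by linarith)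
  have hl1 : (1:ℝ) ≤ Real.log n := by
    rw [Real.le_log_iff_exp_le (by linarith)]
    linarith [Real.exp_one_lt_d9]
  have hJ := J_le n (by omega)
  set J : ℝ := ((Nat.log 2 n + 1 : ℕ) : ℝ) with hJd
  have hJ0 : 0 ≤ J := by positivity
  set A0 := Icc 1 ⌊(n:ℝ) ^ (15/16:ℝ)⌋₊ with hA0
  set P := Nat.primesLE n with hP
  set E1 : ℕ → ℕ × ℕ × ℕ → Prop := fun a t => t.1 * t.2.1 * t.2.2 = a ∧ Cl1 t with hE1
  set E2 : ℕ → ℕ × ℕ × ℕ → Prop := fun a t => t.1 * t.2.1 * t.2.2 = a ∧ Cluv n 1 t ∧ t.2.2.Prime with hE2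
  set E3 : ℕ → ℕ × ℕ × ℕ → Prop := fun a t => t.1 * t.2.1 * t.2.2 = a ∧ Cluv n ((n:ℝ) ^ (1/16:ℝ)) t with hE3
  set B1 := A.filter (fun a => ∃ t, E1 a t) with hB1
  set B2 := A.filter (fun a => ∃ t, E2 a t) with hB2
  set B3 := A.filter (fun a => ∃ t, E3 a t) with hB3
  have hcover : A ⊆ A0 ∪ (P ∪ (B1 ∪ (B2 ∪ B3))) := by
    intro a ha
    obtain ⟨ha1, han⟩ := mem_Icc.1 (hAn ha)
    simp only [mem_union]
    by_cases hsm : (a:ℝ) ≤ (n:ℝ) ^ (15/16:ℝ)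
    · left; rw [hA0, mem_Icc]; exact ⟨ha1, Nat.le_floor hsm⟩
    right
    push Not at hsm
    have ha2 : 2 ≤ a := by
      have : (1:ℝ) < a := lt_of_le_of_lt (Real.one_le_rpow hn1 (by norm_num)) hsm
      exact_mod_cast this
    obtain ⟨q, b, hq, hab, hmax⟩ := exists_max_prime a ha2
    rcases lt_or_ge (q:ℝ) ((n:ℝ) ^ (1/4:ℝ)) with hqn | hqn
    · right; right; right
      exact mem_filter.2 ⟨ha, decomp3 n a q ha1 han hsm hq hmax hqn⟩
    · by_cases hb : 2 ≤ b
      · obtain ⟨t, ht, h1 | h2⟩ := decomp12 n a q b ha1 hq hb hab hmax hqn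
        · right; left; exact mem_filter.2 ⟨ha, t, ht, h1⟩
        · right; right; left; exact mem_filter.2 ⟨ha, t, ht, h2⟩
      · left
        have hb1 : b = 1 := by
          rcases Nat.eq_zero_or_pos b with h | h
          · rw [h] at hab; omega
          · omega
        rw [hP, Nat.mem_primesLE]
        refine ⟨han, ?_⟩
        rw [hab, hb1, one_mul]; exact hq
  have hcard : A.card ≤ A0.card + (P.card + (B1.card + (B2.card + B3.card))) := by
    refine (card_le_card hcover).trans ((card_union_le _ _).trans ?_)
    gcongr
    refine (card_union_le _ _).trans ?_
    gcongr
    refine (card_union_le _ _).trans ?_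
    gcongr
    exact card_union_le _ _
  have hcardR : (A.card : ℝ) ≤ A0.card + (P.card + (B1.card + (B2.card + B3.card))) := by exact_mod_cast hcard
  have b0 : (A0.card : ℝ) ≤ n / Real.log n := by
    refine le_trans ?_ s1
    rw [hA0, Nat.card_Icc, Nat.add_sub_cancel, one_mul]
    refine (Nat.floor_le (by positivity)).trans ?_
    have : (0:ℝ) ≤ (n:ℝ) ^ (15/16:ℝ) := by positivity
    have hl2 : (1:ℝ) ≤ Real.log n ^ 2 := one_le_pow₀ hl1
    nlinarith [mul_le_mul_of_nonneg_right hl2 this]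
  have bP : (P.card : ℝ) ≤ C * (n / Real.log n) := by
    have := hC n (by linarith)
    rw [Nat.floor_natCast] at this
    rw [hP, Nat.primesLE_card_eq_primeCounting]
    exact this
  have hch : ∀ E : ℕ → ℕ × ℕ × ℕ → Prop, ∃ f : ℕ → ℕ × ℕ × ℕ, ∀ a, (∃ t, E a t) → E a (f a) := by
    intro E
    refine ⟨fun a => if h : ∃ t, E a t then h.choose else (0, 0, 0), fun a h => ?_⟩
    simp only [dif_pos h]
    exact h.choose_spec
  have b1 : (B1.card : ℝ) ≤ (SP n).card + K1 * (n / Real.log n) + n / Real.log n := by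
    obtain ⟨f, hf⟩ := hch E1
    have h := hcl1 n (by omega) A hA hAn B1 (filter_subset _ _) f
      (fun a ha => (hf a (mem_filter.1 ha).2).1) (fun a ha => (hf a (mem_filter.1 ha).2).2)
    refine h.trans ?_
    gcongr
    refine le_trans ?_ s2
    have : (0:ℝ) ≤ (n:ℝ) ^ (7/8:ℝ) := by positivity
    rw [← hJd]
    refine mul_le_mul_of_nonneg_right ?_ this
    nlinarith
  have h59 : 16 * J ^ 2 * (n:ℝ) ^ (59/64:ℝ) ≤ n / Real.log n := by
    refine le_trans ?_ s3
    refine mul_le_mul_of_nonneg_right ?_ (by positivity)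
    nlinarith [pow_le_pow_left₀ hJ0 hJ 2]
  have b2 : (B2.card : ℝ) ≤ 4 * C * K2 * (n / Real.log n) + n / Real.log n := by
    obtain ⟨f, hf⟩ := hch E2
    have h := hcl2 n (by omega) A hA hAn B2 (filter_subset _ _) f (4 * C / Real.log n) 1 (by positivity) le_rfl
      (Nat.primesLE n) (by
        intro X hX
        have hq2 : (2:ℝ) ≤ (n:ℝ) ^ (1/4:ℝ) := by
          calc (2:ℝ) = (16:ℝ) ^ (1/4:ℝ) := by
                rw [show (16:ℝ) = 2 ^ (4:ℝ) by norm_num, ← Real.rpow_mul (by norm_num)]; norm_num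
            _ ≤ _ := by gcongr
        have hX2 : 2 ≤ X := hq2.trans hX
        have hlX : Real.log n / 4 ≤ Real.log X := by
          have := Real.log_le_log (by positivity) hX
          rw [Real.log_rpow hn0] at this
          linarith
        have hsub : (Nat.primesLE n ∩ Icc 1 ⌊X⌋₊).card ≤ Nat.primeCounting ⌊X⌋₊ := by
          rw [← Nat.primesLE_card_eq_primeCounting]
          apply card_le_card
          intro w hw
          rw [mem_inter, Nat.mem_primesLE, mem_Icc] at hw
          exact Nat.mem_primesLE.2 ⟨hw.2.2, hw.1.2⟩
        calc ((Nat.primesLE n ∩ Icc 1 ⌊X⌋₊).card : ℝ) ≤ (Nat.primeCounting ⌊X⌋₊ : ℝ) := by exact_mod_cast hsub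
          _ ≤ C * (X / Real.log X) := hC X hX2
          _ ≤ C * (X / (Real.log n / 4)) := by gcongr
          _ = _ := by field_simp)
      (fun a ha => (hf a (mem_filter.1 ha).2).1)
      (fun a ha => by
        obtain ⟨e1, ⟨e2, e3, e4, e5⟩, e6⟩ := hf a (mem_filter.1 ha).2
        refine ⟨e2, e3, e4, e5, Nat.mem_primesLE.2 ⟨?_, e6⟩⟩
        obtain ⟨g1, g2⟩ := mem_Icc.1 (hAn (mem_filter.1 ha).1)
        exact (Nat.le_of_dvd g1 (Dvd.intro_left _ e1)).trans g2)
    rw [Real.one_rpow] at h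
    refine h.trans ?_
    rw [← hJd]
    have : K2 * (4 * C / Real.log n * n * 1) = 4 * C * K2 * (n / Real.log n) := by ring
    linarith
  have b3 : (B3.card : ℝ) ≤ n / Real.log n + n / Real.log n := by
    obtain ⟨f, hf⟩ := hch E3
    have h := hcl2 n (by omega) A hA hAn B3 (filter_subset _ _) f 1 ((n:ℝ) ^ (1/16:ℝ)) (by positivity)
      (Real.one_le_rpow hn1 (by norm_num)) (Icc 1 n) (by
        intro X hX
        have hX0 : 0 ≤ X := le_trans (by positivity) hX
        have hsub : (Icc 1 n ∩ Icc 1 ⌊X⌋₊).card ≤ ⌊X⌋₊ := by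
          refine (card_le_card inter_subset_right).trans ?_
          simp
        calc ((Icc 1 n ∩ Icc 1 ⌊X⌋₊).card : ℝ) ≤ (⌊X⌋₊ : ℝ) := by exact_mod_cast hsub
          _ ≤ X := Nat.floor_le hX0
          _ = _ := by ring)
      (fun a ha => (hf a (mem_filter.1 ha).2).1)
      (fun a ha => by
        obtain ⟨e1, ⟨e2, e3, e4, e5⟩⟩ := hf a (mem_filter.1 ha).2
        obtain ⟨g1, g2⟩ := mem_Icc.1 (hAn (mem_filter.1 ha).1)
        have hd := Dvd.intro_left _ e1
        exact ⟨e2, e3, e4, e5, mem_Icc.2 ⟨Nat.pos_of_dvd_of_pos hd g1, (Nat.le_of_dvd g1 hd).trans g2⟩⟩)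
    refine h.trans ?_
    rw [← hJd]
    refine add_le_add ?_ h59
    refine le_trans ?_ s4
    have e : (1:ℝ) * n * ((n:ℝ) ^ (1/16:ℝ)) ^ (-(1/16):ℝ) = (n:ℝ) ^ (255/256:ℝ) := by
      rw [← Real.rpow_mul hn0.le, one_mul]
      nth_rewrite 1 [← Real.rpow_one (n:ℝ)]
      rw [← Real.rpow_add hn0]; norm_num
    rw [e]
    have : (0:ℝ) ≤ (n:ℝ) ^ (255/256:ℝ) := by positivity
    gcongr
    exact le_mul_of_one_le_right hK2.le (one_le_pow₀ hl1)
  have hx : 0 < n / Real.log n := by positivity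
  linarith

end PNTaux

namespace PNTaux
open Finset Filter

lemma Fkd_bdd (n : ℕ) : BddAbove {m : ℕ | ∃ A : Finset ℕ, A ⊆ Finset.Icc 1 n ∧ A.card = m ∧
    ∀ (a : Fin 6 → ℕ) (x : ℕ), (∀ i, a i ∈ A) → StrictMono a → 0 < x →
      (∏ i, a i) ≠ x ^ 3} := by
  refine ⟨n, ?_⟩
  rintro m ⟨A, hA, rfl, -⟩
  simpa using card_le_card hA

lemma Fkd_attained (n : ℕ) : ∃ A : Finset ℕ, A ⊆ Icc 1 n ∧ A.card = Fkd 6 3 n ∧ Good A := by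
  refine Nat.sSup_mem (s := {m : ℕ | ∃ A : Finset ℕ, A ⊆ Finset.Icc 1 n ∧ A.card = m ∧
    ∀ (a : Fin 6 → ℕ) (x : ℕ), (∀ i, a i ∈ A) → StrictMono a → 0 < x →
      (∏ i, a i) ≠ x ^ 3}) ⟨0, ∅, by simp, by simp, ?_⟩ (Fkd_bdd n)
  intro a x ha
  exact absurd (ha 0) (by simp)

lemma Fkd_ge (n : ℕ) : (LP n).card ≤ Fkd 6 3 n := by
  have hT : ∀ t ∈ LP n, t.1.Prime ∧ t.2.Prime ∧ t.1 ≤ ⌊(n:ℝ) ^ (1/4:ℝ)⌋₊ ∧ ⌊(n:ℝ) ^ (1/4:ℝ)⌋₊ < t.2 := by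
    intro t ht
    unfold LP at ht
    rw [mem_filter, mem_product, Nat.mem_primesLE, Nat.mem_primesLE] at ht
    exact ⟨ht.1.1.2, ht.1.2.2, ht.1.1.1, ht.2.1⟩
  obtain ⟨h1, h2⟩ := good_semi _ _ hT
  refine le_csSup (Fkd_bdd n) ⟨_, ?_, h2, h1⟩
  intro a ha
  obtain ⟨t, ht, rfl⟩ := mem_image.1 ha
  obtain ⟨p1, p2, -, -⟩ := hT t ht
  unfold LP at ht
  rw [mem_filter] at ht
  exact mem_Icc.2 ⟨Nat.mul_pos p1.pos p2.pos, ht.2.2⟩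

lemma main_final : Tendsto
      (fun n : ℕ => (Fkd 6 3 n : ℝ) * Real.log n / ((n : ℝ) * Real.log (Real.log n)))
      atTop (nhds 1) := by
  obtain ⟨K, hK, hup⟩ := upper
  have tL : Tendsto (fun n : ℕ => LL n) atTop atTop := tendsto_LL.comp tendsto_natCast_atTop_atTop
  have tl : Tendsto (fun n : ℕ => Real.log n) atTop atTop :=
    Real.tendsto_log_atTop.comp tendsto_natCast_atTop_atTop
  rw [Metric.tendsto_nhds]
  intro ε hε
  filter_upwards [hup, SP_upper (ε/4) (by positivity), LP_lower (ε/4) (by positivity),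
    tL.eventually_ge_atTop (4 * K / ε), tL.eventually_gt_atTop 0, tl.eventually_gt_atTop 0,
    eventually_gt_atTop 0] with n h1 h2 h3 h4 h5 h6 h7
  obtain ⟨A, hA, hc, hg⟩ := Fkd_attained n
  have u := h1 A hg hA
  rw [hc] at u
  have l : ((LP n).card : ℝ) ≤ Fkd 6 3 n := by exact_mod_cast Fkd_ge n
  have hn : (0:ℝ) < n := by exact_mod_cast h7
  have hx : 0 < (n:ℝ) / Real.log n := by positivity
  have hKL : K ≤ ε / 4 * LL n := by
    rw [div_le_iff₀ hε] at h4
    linarith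
  have hKx : K * (n / Real.log n) ≤ ε / 4 * (n * LL n / Real.log n) := by
    calc K * (n / Real.log n) ≤ (ε / 4 * LL n) * (n / Real.log n) := by gcongr
      _ = _ := by ring
  have hY : 0 < n * LL n / Real.log n := by positivity
  change dist ((Fkd 6 3 n : ℝ) * Real.log n / ((n : ℝ) * LL n)) 1 < ε
  have e : (Fkd 6 3 n : ℝ) * Real.log n / ((n : ℝ) * LL n) = Fkd 6 3 n / (n * LL n / Real.log n) := by
    field_simp
  rw [e, Real.dist_eq, abs_lt]
  set Y := n * LL n / Real.log n with hYd
  have hεY : 0 < ε * Y := by positivity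
  constructor
  · have : 1 - ε < (Fkd 6 3 n : ℝ) / Y := by
      rw [lt_div_iff₀ hY]; nlinarith
    linarith
  · have : (Fkd 6 3 n : ℝ) / Y < 1 + ε := by
      rw [div_lt_iff₀ hY]; nlinarith
    linarith

end PNTaux

theorem stmt_9 :
    Filter.Tendsto
      (fun n : ℕ => (Fkd 6 3 n : ℝ) * Real.log n / ((n : ℝ) * Real.log (Real.log n)))
      Filter.atTop (nhds 1) := by
  exact PNTaux.main_final
end

section
/- There exist positive real constants c1 and c2 such that for every sufficiently large positive integer n, π(n) + c1·n^{2/3}/(log n)^{4/3} ≤ f_{9,3}(n) ≤ π(n) + c2·n^{2/3}·log n. -/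
open Finset Filter

/-- The multiset of the values of `a` can be partitioned into groups,
each consisting of `d` copies of a single number. -/
def TrivialSol (d : ℕ) {k : ℕ} (a : Fin k → ℕ) : Prop :=
  ∀ y : ℕ, d ∣ (List.ofFn a : Multiset ℕ).count y

/-- `fkd k d n` is the maximum cardinality of a set `A ⊆ {1,…,n}` such that whenever
`a_1, …, a_k ∈ A` (not necessarily distinct) and `a_1 ⋯ a_k = x ^ d` for a positive integer
`x`, the multiset of the `a_i` is trivial. -/
noncomputable def fkd (k d n : ℕ) : ℕ :=
  sSup {m : ℕ | ∃ A : Finset ℕ, A ⊆ Finset.Icc 1 n ∧ A.card = m ∧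
    ∀ (a : Fin k → ℕ) (x : ℕ), (∀ i, a i ∈ A) → 0 < x →
      (∏ i, a i) = x ^ d → TrivialSol d a}

def Good (E : Finset (ℕ × ℕ)) : Prop := ∀ u1 u2 u3 v1 v2 v3 : ℕ,
  (u1,v1) ∈ E → (u1,v2) ∈ E → (u2,v2) ∈ E → (u2,v3) ∈ E → (u3,v3) ∈ E → (u3,v1) ∈ E →
  u1 ≠ u3 → v1 ≠ v2 → u1 = u2 ∧ v1 = v3

lemma good_mono {E F : Finset (ℕ × ℕ)} (h : F ⊆ E) (hE : Good E) : Good F :=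
  fun u1 u2 u3 v1 v2 v3 h1 h2 h3 h4 h5 h6 =>
    hE u1 u2 u3 v1 v2 v3 (h h1) (h h2) (h h3) (h h4) (h h5) (h h6)

lemma good_of (A : Finset ℕ) (hA : ∀ (a : Fin 9 → ℕ) (x : ℕ), (∀ i, a i ∈ A) → 0 < x →
      (∏ i, a i) = x ^ 3 → TrivialSol 3 a) (E : Finset (ℕ × ℕ))
    (hE : ∀ e ∈ E, e.1 * e.2 ∈ A) (h0 : ∀ e ∈ E, 0 < e.1 ∧ 0 < e.2)
    (inj : ∀ e ∈ E, ∀ e' ∈ E, e.1 * e.2 = e'.1 * e'.2 → e = e') : Good E := by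
  intro u1 u2 u3 v1 v2 v3 h1 h2 h3 h4 h5 h6 hu hv
  by_contra hne
  have hx : 0 < u1 * u2 * u3 * v1 * v2 * v3 := by
    have := h0 _ h1
    have := h0 _ h3
    have := h0 _ h5
    simp only at *
    have a1 : 0 < u1 := by tauto
    have a2 : 0 < u2 := by tauto
    have a3 : 0 < u3 := by tauto
    have b1 : 0 < v1 := by tauto
    have b2 : 0 < v2 := by tauto
    have b3 : 0 < v3 := by tauto
    positivity
  have ht := hA ![u1*v1, u1*v2, u1*v2, u2*v2, u2*v3, u2*v3, u3*v3, u3*v1, u3*v1] _ (by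
    have := hE _ h1
    have := hE _ h2
    have := hE _ h3
    have := hE _ h4
    have := hE _ h5
    have := hE _ h6
    simp only at *
    intro i
    fin_cases i <;> assumption) hx (by
    simp [Fin.prod_univ_succ]; ring)
  have n2 : u1 * v2 ≠ u1 * v1 := fun h => hv (Prod.mk.inj (inj _ h2 _ h1 h)).2.symm
  have n3 : u2 * v2 ≠ u1 * v1 := fun h => hv (Prod.mk.inj (inj _ h3 _ h1 h)).2.symm
  have n4 : u2 * v3 ≠ u1 * v1 := fun h => hne (by have := Prod.mk.inj (inj _ h4 _ h1 h); exact ⟨this.1.symm, this.2.symm⟩)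
  have n5 : u3 * v3 ≠ u1 * v1 := fun h => hu (Prod.mk.inj (inj _ h5 _ h1 h)).1.symm
  have n6 : u3 * v1 ≠ u1 * v1 := fun h => hu (Prod.mk.inj (inj _ h6 _ h1 h)).1.symm
  have h := ht (u1 * v1)
  simp only [List.ofFn_succ, List.ofFn_zero, Multiset.coe_count] at h
  simp only [Matrix.cons_val_zero, Matrix.cons_val_succ, Fin.succ_zero_eq_one] at h
  simp [List.count_cons, n2, n3, n4, n5, n6, -mul_eq_mul_left_iff, -mul_eq_mul_right_iff] at h

lemma good_c4 {E : Finset (ℕ × ℕ)} (hE : Good E) {u u' v v' : ℕ} (h1 : (u,v) ∈ E)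
    (h2 : (u,v') ∈ E) (h3 : (u',v) ∈ E) (h4 : (u',v') ∈ E) (hv : v ≠ v') : u = u' := by
  by_contra hu
  exact hu (hE u u' u' v v' v h1 h2 h4 h3 h3 h3 hu hv).1

/-- degree functions -/
def dL (E : Finset (ℕ × ℕ)) (u : ℕ) : ℕ := (E.filter (fun e => e.1 = u)).card
def dR (E : Finset (ℕ × ℕ)) (v : ℕ) : ℕ := (E.filter (fun e => e.2 = v)).card

lemma paths {E : Finset (ℕ × ℕ)} (hE : Good E) (U V : Finset ℕ) (hU : ∀ e ∈ E, e.1 ∈ U)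
    (hV : ∀ e ∈ E, e.2 ∈ V) :
    ∑ e ∈ E, (dL E e.1 - 1) * (dR E e.2 - 1) ≤ U.card * V.card := by
  classical
  have key : ∀ e ∈ E, (dL E e.1 - 1) * (dR E e.2 - 1) =
      (((E.filter (fun f => f.1 = e.1)).erase e) ×ˢ ((E.filter (fun f => f.2 = e.2)).erase e)).card := by
    intro e he
    rw [Finset.card_product, Finset.card_erase_of_mem, Finset.card_erase_of_mem]
    · rfl
    · simp [he]
    · simp [he]
  rw [Finset.sum_congr rfl key, ← Finset.card_sigma, ← Finset.card_product]
  apply Finset.card_le_card_of_injOn (fun x => (x.2.2.1, x.2.1.2))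
  · rintro ⟨⟨a, b⟩, ⟨c, d⟩, ⟨f, g⟩⟩ h
    simp only [Finset.mem_coe, Finset.mem_sigma, Finset.mem_product, Finset.mem_erase, Finset.mem_filter] at h ⊢
    exact ⟨hU _ h.2.2.2.1, hV _ h.2.1.2.1⟩
  · rintro ⟨⟨a, b⟩, ⟨c, d⟩, ⟨f, g⟩⟩ h ⟨⟨a', b'⟩, ⟨c', d'⟩, ⟨f', g'⟩⟩ h' heq
    simp only [Finset.mem_coe, Finset.mem_sigma, Finset.mem_product, Finset.mem_erase, Finset.mem_filter] at h h'
    simp only [Prod.mk.injEq] at heq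
    obtain ⟨e1, ⟨n1, e2, rfl⟩, n2, e3, rfl⟩ := h
    obtain ⟨e1', ⟨n1', e2', rfl⟩, n2', e3', rfl⟩ := h'
    obtain ⟨rfl, rfl⟩ := heq
    -- paths f - g - c - d ; f - g' - c' - d
    have hgg : g = g' := by
      by_contra hne
      have := (hE f c' c g g' d e3 e3' e1' e2' e2 e1 (by rintro rfl; simp at n2) hne).1
      subst this
      simp at n2'
    subst hgg
    have hcc : c = c' := good_c4 hE e1 e2 e1' e2' (by rintro rfl; simp at n1)
    subst hcc
    rfl

lemma sum_inv_dL (E : Finset (ℕ × ℕ)) (U : Finset ℕ) (hU : ∀ e ∈ E, e.1 ∈ U) :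
    ∑ e ∈ E, (1 : ℝ) / dL E e.1 ≤ U.card := by
  rw [← Finset.sum_fiberwise_of_maps_to hU]
  calc _ ≤ ∑ u ∈ U, (1 : ℝ) := by
        apply Finset.sum_le_sum
        intro u _
        rw [Finset.sum_congr rfl (g := fun _ => (1 : ℝ) / dL E u)
          (by intro x hx; rw [(Finset.mem_filter.mp hx).2])]
        rw [Finset.sum_const, nsmul_eq_mul, mul_one_div]
        exact div_self_le_one _
    _ = _ := by simp

lemma sum_inv_dR (E : Finset (ℕ × ℕ)) (V : Finset ℕ) (hV : ∀ e ∈ E, e.2 ∈ V) :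
    ∑ e ∈ E, (1 : ℝ) / dR E e.2 ≤ V.card := by
  rw [← Finset.sum_fiberwise_of_maps_to hV]
  calc _ ≤ ∑ u ∈ V, (1 : ℝ) := by
        apply Finset.sum_le_sum
        intro u _
        rw [Finset.sum_congr rfl (g := fun _ => (1 : ℝ) / dR E u)
          (by intro x hx; rw [(Finset.mem_filter.mp hx).2])]
        rw [Finset.sum_const, nsmul_eq_mul, mul_one_div]
        exact div_self_le_one _
    _ = _ := by simp

lemma amgm3 (p q r : ℝ) (hp : 0 < p) (hq : 0 < q) (hr : 0 < r) (h : p * q * r = 1) :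
    3 ≤ p + q + r := by
  by_contra hlt
  push Not at hlt
  have h1 : 27 * (p * q * r) ≤ (p + q + r) ^ 3 := by
    nlinarith [mul_nonneg hp.le (sq_nonneg (q - r)), mul_nonneg hq.le (sq_nonneg (p - r)),
      mul_nonneg hr.le (sq_nonneg (p - q)), mul_nonneg (add_pos (add_pos hp hq) hr).le (sq_nonneg (q - r)),
      mul_nonneg (add_pos (add_pos hp hq) hr).le (sq_nonneg (p - r)),
      mul_nonneg (add_pos (add_pos hp hq) hr).le (sq_nonneg (p - q))]
  have h2 : (p + q + r) ^ 3 < 3 ^ 3 := pow_lt_pow_left₀ hlt (by positivity) (by norm_num)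
  rw [h] at h1
  linarith

lemma edge_ineq (a b : ℕ) (ha : 1 ≤ a) (hb : 1 ≤ b) (Y Z : ℝ) (hY : 0 < Y) (hZ : 0 < Z) :
    (3 : ℝ) ≤ 4 / (Y * Z) * ((a - 1) * (b - 1) : ℕ) + (Y + 3) * (1 / a) + (Z + 3) * (1 / b) := by
  have ha0 : (0 : ℝ) < a := by exact_mod_cast ha
  have hb0 : (0 : ℝ) < b := by exact_mod_cast hb
  by_cases h1 : a = 1
  · subst h1
    have : (0:ℝ) ≤ (Z + 3) * (1 / b) := by positivity
    simp at this ⊢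
    linarith
  by_cases h2 : b = 1
  · subst h2
    have : (0:ℝ) ≤ (Y + 3) * (1 / a) := by positivity
    simp at this ⊢
    linarith
  have key := amgm3 (a * b / (Y * Z)) (Y / a) (Z / b) (by positivity) (by positivity)
    (by positivity) (by field_simp)
  have hab : (a * b : ℝ) ≤ 4 * ((a - 1) * (b - 1) : ℕ) := by
    obtain ⟨a, rfl⟩ : ∃ c, a = c + 2 := ⟨a - 2, by omega⟩
    obtain ⟨b, rfl⟩ : ∃ c, b = c + 2 := ⟨b - 2, by omega⟩
    have : (a + 2) * (b + 2) ≤ 4 * ((a + 2 - 1) * (b + 2 - 1)) := by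
      simp only [show a + 2 - 1 = a + 1 by omega, show b + 2 - 1 = b + 1 by omega]
      nlinarith [Nat.zero_le (a * b)]
    exact_mod_cast this
  have h3 : (a * b / (Y * Z) : ℝ) ≤ 4 / (Y * Z) * ((a - 1) * (b - 1) : ℕ) := by
    rw [div_mul_eq_mul_div]
    gcongr
  have h4 : Y / a ≤ (Y + 3) * (1 / a) := by
    rw [mul_one_div]; gcongr; linarith
  have h5 : Z / b ≤ (Z + 3) * (1 / b) := by
    rw [mul_one_div]; gcongr; linarith
  linarith

lemma edges_bound {E : Finset (ℕ × ℕ)} (hE : Good E) (U V : Finset ℕ) (hU : ∀ e ∈ E, e.1 ∈ U)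
    (hV : ∀ e ∈ E, e.2 ∈ V) (Y Z : ℝ) (hY : 0 < Y) (hZ : 0 < Z) :
    3 * (E.card : ℝ) ≤ 4 / (Y * Z) * (U.card * V.card) + (Y + 3) * U.card + (Z + 3) * V.card := by
  have h1 : ∑ e ∈ E, (3 : ℝ) ≤ ∑ e ∈ E, (4 / (Y * Z) * ((dL E e.1 - 1) * (dR E e.2 - 1) : ℕ)
      + (Y + 3) * (1 / dL E e.1) + (Z + 3) * (1 / dR E e.2)) := by
    apply Finset.sum_le_sum
    intro e he
    apply edge_ineq _ _ _ _ _ _ hY hZ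
    · exact Finset.card_pos.mpr ⟨e, by simp [he]⟩
    · exact Finset.card_pos.mpr ⟨e, by simp [he]⟩
  rw [Finset.sum_add_distrib, Finset.sum_add_distrib, ← Finset.mul_sum, ← Finset.mul_sum,
    ← Finset.mul_sum, ← Nat.cast_sum] at h1
  have h2 : ((∑ e ∈ E, (dL E e.1 - 1) * (dR E e.2 - 1) : ℕ) : ℝ) ≤ U.card * V.card := by
    exact_mod_cast paths hE U V hU hV
  have h3 := sum_inv_dL E U hU
  have h4 := sum_inv_dR E V hV
  calc 3 * (E.card : ℝ) = ∑ e ∈ E, (3 : ℝ) := by simp [mul_comm]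
    _ ≤ _ := h1
    _ ≤ _ := by gcongr

lemma star_bound {E : Finset (ℕ × ℕ)} (hE : Good E) (U V : Finset ℕ) (hU : ∀ e ∈ E, e.1 ∈ U)
    (hV : ∀ e ∈ E, e.2 ∈ V) : E.card ≤ U.card + V.card * V.card := by
  classical
  -- choose for each u the least neighbour
  let m : ℕ → ℕ := fun u => sInf {v | (u, v) ∈ E}
  have hm : ∀ e ∈ E, (e.1, m e.1) ∈ E := by
    intro e he
    exact Nat.sInf_mem (s := {v | (e.1, v) ∈ E}) ⟨e.2, he⟩
  rw [← Finset.card_filter_add_card_filter_not (s := E) (fun e => e.2 = m e.1)]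
  apply Nat.add_le_add
  · apply Finset.card_le_card_of_injOn (fun e => e.1)
    · intro e he; simp at he; exact hU _ he.1
    · rintro ⟨a, b⟩ he ⟨a', b'⟩ he' h
      simp at *
      obtain ⟨_, rfl⟩ := he
      obtain ⟨_, rfl⟩ := he'
      simp [h]
  · rw [← Finset.card_product]
    apply Finset.card_le_card_of_injOn (fun e => (e.2, m e.1))
    · intro e he; simp at he ⊢; exact ⟨hV _ he.1, hV _ (hm _ he.1)⟩
    · rintro ⟨a, b⟩ he ⟨a', b'⟩ he' h
      simp at he he' h
      have q1 := hm _ he.1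
      have q2 := hm _ he'.1
      simp only at q1 q2
      obtain ⟨rfl, h⟩ := h
      suffices hs : a = a' by rw [hs]
      refine good_c4 hE he.1 q1 he'.1 ?_ he.2
      rw [h]; exact q2

lemma factor (n T a : ℕ) (hT : n ≤ T ^ 3) (hT0 : 0 < T) (ha : a ∈ Finset.Icc 1 n) :
    ∃ e : ℕ × ℕ, e.1 * e.2 = a ∧ ((e.1 ≤ T ^ 2 ∧ e.2 ≤ T ^ 2) ∨
      (e.1.Prime ∧ e.1 ≤ n ∧ e.2 ≤ T)) := by
  classical
  rw [Finset.mem_Icc] at ha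
  have key : ∀ d v, d * v = a → T ≤ d → v ≤ T ^ 2 := by
    intro d v h1 h2
    by_contra h3
    push Not at h3
    have : T * (T ^ 2) < d * v := Nat.mul_lt_mul_of_le_of_lt h2 h3 (by omega)
    have : T * T ^ 2 = T ^ 3 := by ring
    omega
  by_cases haT : a < T
  · refine ⟨(a, 1), by simp, Or.inl ⟨?_, ?_⟩⟩
    · simp only; nlinarith
    · exact Nat.one_le_pow _ _ hT0
  push Not at haT
  have hex : ∃ d, d ∣ a ∧ T ≤ d := ⟨a, dvd_rfl, haT⟩
  let d := Nat.find hex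
  obtain ⟨⟨v, hv⟩, hd⟩ : d ∣ a ∧ T ≤ d := Nat.find_spec hex
  have hmin : ∀ c, c ∣ a → T ≤ c → d ≤ c := fun c h1 h2 => Nat.find_min' hex ⟨h1, h2⟩
  clear_value d
  by_cases hd2 : d ≤ T ^ 2
  · exact ⟨(d, v), hv.symm, Or.inl ⟨hd2, key d v hv.symm hd⟩⟩
  push Not at hd2
  have hd1 : d ≠ 1 := by
    have : 1 ≤ T ^ 2 := Nat.one_le_pow _ _ hT0
    omega
  have hpp := Nat.minFac_prime hd1
  obtain ⟨w, hw⟩ := Nat.minFac_dvd d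
  have hwd : w ∣ a := ⟨d.minFac * v, by rw [hv]; nth_rewrite 1 [hw]; ring⟩
  have hw0 : 0 < w := by
    rcases Nat.eq_zero_or_pos w with h | h
    · subst h; simp at hw; omega
    · exact h
  have hwT : w < T := by
    by_contra h
    have h1 := hmin w hwd (by omega)
    have := hpp.two_le
    nlinarith
  have hpT : T ≤ d.minFac := by
    by_contra h
    push Not at h
    have : d.minFac * w < T * T := Nat.mul_lt_mul_of_lt_of_lt h hwT
    rw [← hw] at this
    nlinarith
  have hdp : d = d.minFac := le_antisymm (hmin _ ((Nat.minFac_dvd d).trans ⟨v, hv⟩) hpT)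
    (Nat.minFac_le (by omega))
  refine ⟨(d, v), hv.symm, Or.inr ⟨hdp ▸ hpp, ?_, ?_⟩⟩
  · exact (Nat.le_of_dvd (by omega) ⟨v, hv⟩).trans ha.2
  · by_contra h3
    simp only at h3
    push Not at h3
    have : T ^ 2 * T < d * v := Nat.mul_lt_mul_of_le_of_lt hd2.le h3 (by omega)
    have : T ^ 2 * T = T ^ 3 := by ring
    omega

lemma block_bound {E : Finset (ℕ × ℕ)} (hE : Good E) (n T i : ℕ) (hT : n ≤ T ^ 3) (hT0 : 0 < T)
    (hn : ∀ e ∈ E, 0 < e.1 ∧ 0 < e.2 ∧ e.1 * e.2 ≤ n ∧ e.1 ≤ T ^ 2 ∧ e.2 ≤ T ^ 2 ∧ Nat.log 2 e.1 = i) :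
    E.card ≤ 4 * T ^ 2 := by
  rcases E.eq_empty_or_nonempty with rfl | ⟨e0, he0⟩
  · simp
  have hlog : ∀ e ∈ E, 2 ^ i ≤ e.1 ∧ e.1 < 2 ^ i + 2 ^ i := by
    intro e he
    obtain ⟨h1, _, _, _, _, h2⟩ := hn e he
    refine ⟨h2 ▸ Nat.pow_log_le_self 2 (by omega), ?_⟩
    have := Nat.lt_pow_succ_log_self (b := 2) (by norm_num) e.1
    rw [h2, pow_succ] at this
    omega
  have hi : 2 ^ i ≤ T ^ 2 := (hlog e0 he0).1.trans (hn e0 he0).2.2.2.1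
  let t := min (n / 2 ^ i) (T ^ 2)
  have ht1 : 2 ^ i * t ≤ n := (Nat.mul_le_mul_left _ (min_le_left _ _)).trans (Nat.mul_div_le _ _)
  have ht2 : t ≤ T ^ 2 := min_le_right _ _
  have hb := edges_bound hE (Finset.Ico (2 ^ i) (2 ^ i + 2 ^ i)) (Finset.Icc 1 t)
    (fun e he => by rw [Finset.mem_Ico]; exact hlog e he)
    (fun e he => by
      obtain ⟨h1, h2, h3, h4, h5, h6⟩ := hn e he
      rw [Finset.mem_Icc]
      refine ⟨h2, le_min ?_ h5⟩
      rw [Nat.le_div_iff_mul_le (by positivity), mul_comm]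
      exact (Nat.mul_le_mul_right _ (hlog e he).1).trans h3)
    ((T : ℝ) ^ 2 / 2 ^ i) (2 ^ i / T) (by positivity) (by positivity)
  clear_value t
  simp only [Nat.card_Ico, Nat.card_Icc, Nat.add_sub_cancel, Nat.add_sub_cancel_left] at hb
  have ht3 : (2 : ℝ) ^ i * t ≤ T ^ 3 := by exact_mod_cast ht1.trans hT
  have ht4 : (t : ℝ) ≤ T ^ 2 := by exact_mod_cast ht2
  have hi' : (2 : ℝ) ^ i ≤ T ^ 2 := by exact_mod_cast hi
  have hTr : (0 : ℝ) < T := by exact_mod_cast hT0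
  have e1 : (4 / ((T : ℝ) ^ 2 / 2 ^ i * (2 ^ i / T))) * (2 ^ i * t) ≤ 4 * T ^ 2 := by
    have : (4 / ((T : ℝ) ^ 2 / 2 ^ i * (2 ^ i / T))) = 4 / T := by field_simp
    rw [this, div_mul_eq_mul_div, div_le_iff₀ hTr]
    nlinarith
  have e2 : ((T : ℝ) ^ 2 / 2 ^ i) * 2 ^ i = T ^ 2 := by field_simp
  have e3 : ((2 : ℝ) ^ i / T) * t ≤ T ^ 2 := by
    rw [div_mul_eq_mul_div, div_le_iff₀ hTr]
    nlinarith
  push_cast at hb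
  have : (E.card : ℝ) ≤ 4 * T ^ 2 := by nlinarith
  exact_mod_cast this

lemma upper_nat (n T : ℕ) (hT : n ≤ T ^ 3) (hT0 : 0 < T) (A : Finset ℕ) (hAn : A ⊆ Finset.Icc 1 n)
    (hA : ∀ (a : Fin 9 → ℕ) (x : ℕ), (∀ i, a i ∈ A) → 0 < x →
      (∏ i, a i) = x ^ 3 → TrivialSol 3 a) :
    A.card ≤ Nat.primeCounting n + T ^ 2 + (Nat.log 2 n + 1) * (4 * T ^ 2) := by
  classical
  have hf : ∀ a : ℕ, ∃ e : ℕ × ℕ, a ∈ A → e.1 * e.2 = a ∧ ((e.1 ≤ T ^ 2 ∧ e.2 ≤ T ^ 2) ∨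
      (e.1.Prime ∧ e.1 ≤ n ∧ e.2 ≤ T)) := by
    intro a
    by_cases h : a ∈ A
    · obtain ⟨e, he⟩ := factor n T a hT hT0 (hAn h)
      exact ⟨e, fun _ => he⟩
    · exact ⟨0, fun h' => absurd h' h⟩
  choose φ hφ using hf
  have hinj : Set.InjOn φ A := by
    intro a ha b hb h
    rw [← (hφ a ha).1, ← (hφ b hb).1, h]
  let E := A.image φ
  have hmem : ∀ e ∈ E, e.1 * e.2 ∈ A ∧ φ (e.1 * e.2) = e ∧ ((e.1 ≤ T ^ 2 ∧ e.2 ≤ T ^ 2) ∨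
      (e.1.Prime ∧ e.1 ≤ n ∧ e.2 ≤ T)) := by
    intro e he
    obtain ⟨a, ha, rfl⟩ := Finset.mem_image.mp he
    rw [(hφ a ha).1]
    exact ⟨ha, rfl, (hφ a ha).2⟩
  have hpos : ∀ e ∈ E, 0 < e.1 ∧ 0 < e.2 ∧ e.1 * e.2 ≤ n := by
    intro e he
    have h := Finset.mem_Icc.mp (hAn (hmem e he).1)
    have h1 : 0 < e.1 * e.2 := h.1
    exact ⟨Nat.pos_of_mul_pos_right h1, Nat.pos_of_mul_pos_left h1, h.2⟩
  have hG : Good E := good_of A hA E (fun e he => (hmem e he).1)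
    (fun e he => ⟨(hpos e he).1, (hpos e he).2.1⟩)
    (fun e he e' he' h => by rw [← (hmem e he).2.1, ← (hmem e' he').2.1, h])
  have hcard : A.card = E.card := (Finset.card_image_of_injOn hinj).symm
  rw [hcard, ← Finset.card_filter_add_card_filter_not (s := E) (fun e => e.1.Prime ∧ e.1 ≤ n ∧ e.2 ≤ T)]
  apply Nat.add_le_add
  · refine (star_bound (good_mono (Finset.filter_subset _ _) hG) (Nat.primesLE n) (Finset.Icc 1 T)
      ?_ ?_).trans ?_
    · intro e he
      have := (Finset.mem_filter.mp he).2
      rw [Nat.mem_primesLE]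
      tauto
    · intro e he
      have h1 := Finset.mem_filter.mp he
      rw [Finset.mem_Icc]
      exact ⟨(hpos e h1.1).2.1, h1.2.2.2⟩
    · rw [Nat.primesLE_card_eq_primeCounting]
      simp [sq]
  · have hmaps : ∀ e ∈ E.filter (fun e => ¬ (e.1.Prime ∧ e.1 ≤ n ∧ e.2 ≤ T)),
        Nat.log 2 e.1 ∈ Finset.range (Nat.log 2 n + 1) := by
      intro e he
      have h1 := hpos e (Finset.mem_filter.mp he).1
      rw [Finset.mem_range]
      have : Nat.log 2 e.1 ≤ Nat.log 2 n := Nat.log_mono_right (by nlinarith)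
      omega
    rw [Finset.card_eq_sum_card_fiberwise hmaps]
    refine (Finset.sum_le_card_nsmul _ _ (4 * T ^ 2) ?_).trans (by simp)
    intro i _
    apply block_bound (good_mono ((Finset.filter_subset _ _).trans (Finset.filter_subset _ _)) hG) n T i hT hT0
    intro e he
    simp only [Finset.mem_filter] at he
    have h1 := hpos e he.1.1
    have h2 := (hmem e he.1.1).2.2
    have h3 : e.1 ≤ T ^ 2 ∧ e.2 ≤ T ^ 2 := h2.resolve_right he.1.2
    exact ⟨h1.1, h1.2.1, h1.2.2, h3.1, h3.2, he.2⟩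

lemma fkd_le (n B : ℕ) (h : ∀ A : Finset ℕ, A ⊆ Finset.Icc 1 n →
    (∀ (a : Fin 9 → ℕ) (x : ℕ), (∀ i, a i ∈ A) → 0 < x →
      (∏ i, a i) = x ^ 3 → TrivialSol 3 a) → A.card ≤ B) : fkd 9 3 n ≤ B := by
  apply csSup_le'
  rintro m ⟨A, h1, rfl, h2⟩
  exact h A h1 h2

lemma le_fkd (n : ℕ) (A : Finset ℕ) (h1 : A ⊆ Finset.Icc 1 n)
    (h2 : ∀ (a : Fin 9 → ℕ) (x : ℕ), (∀ i, a i ∈ A) → 0 < x →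
      (∏ i, a i) = x ^ 3 → TrivialSol 3 a) : A.card ≤ fkd 9 3 n := by
  apply le_csSup
  · refine ⟨n, ?_⟩
    rintro m ⟨B, h3, rfl, -⟩
    simpa using Finset.card_le_card h3
  · exact ⟨A, h1, rfl, h2⟩

lemma upper (n : ℕ) (hn : 2 ≤ n) : (fkd 9 3 n : ℝ)
        ≤ (Nat.primeCounting n : ℝ) + 100 * (n : ℝ) ^ ((2 : ℝ)/3) * Real.log n := by
  have hn2 : (2 : ℝ) ≤ n := by exact_mod_cast hn
  let M : ℝ := (n : ℝ) ^ ((1 : ℝ) / 3)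
  have hM3 : M ^ 3 = n := by
    rw [← Real.rpow_natCast, ← Real.rpow_mul (by positivity)]; norm_num
  have hM2 : M ^ 2 = (n : ℝ) ^ ((2 : ℝ)/3) := by
    rw [← Real.rpow_natCast, ← Real.rpow_mul (by positivity)]; norm_num
  have hM1 : 1 ≤ M := Real.one_le_rpow (by linarith) (by norm_num)
  have hT1 : M ≤ (⌈M⌉₊ : ℝ) := Nat.le_ceil M
  have hT2 : (⌈M⌉₊ : ℝ) ≤ 2 * M := by
    have := Nat.ceil_lt_add_one (show 0 ≤ M by linarith)
    linarith
  have hT3 : n ≤ ⌈M⌉₊ ^ 3 := by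
    have : (n : ℝ) ≤ (⌈M⌉₊ : ℝ) ^ 3 := by rw [← hM3]; gcongr
    exact_mod_cast this
  have hb := fkd_le n _ (fun A h1 h2 => upper_nat n ⌈M⌉₊ hT3 (Nat.ceil_pos.mpr (by linarith)) A h1 h2)
  have hb' : (fkd 9 3 n : ℝ) ≤ Nat.primeCounting n + (⌈M⌉₊ : ℝ) ^ 2
    + (Nat.log 2 n + 1) * (4 * (⌈M⌉₊ : ℝ) ^ 2) := by exact_mod_cast hb
  have hTT : (⌈M⌉₊ : ℝ) ^ 2 ≤ 4 * M ^ 2 := by nlinarith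
  rw [← hM2]
  have hl2 : (0.69 : ℝ) < Real.log 2 := by have := Real.log_two_gt_d9; linarith
  have hl : Real.log 2 ≤ Real.log n := Real.log_le_log (by norm_num) hn2
  have hlog : (Nat.log 2 n : ℝ) ≤ 2 * Real.log n := by
    have : ((2 ^ (Nat.log 2 n) : ℕ) : ℝ) ≤ n := by exact_mod_cast Nat.pow_log_le_self 2 (by omega)
    push_cast at this
    have := Real.log_le_log (by positivity) this
    rw [Real.log_pow] at this
    have h0 : (0 : ℝ) ≤ Nat.log 2 n := by positivity
    nlinarith
  have h1 : (Nat.log 2 n + 1) * (4 * (⌈M⌉₊ : ℝ) ^ 2) ≤ (4 * Real.log n) * (4 * (4 * M ^ 2)) := by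
    gcongr; linarith
  nlinarith [sq_nonneg M]

def Adj {K : Type*} [Field K] (p l : K × K × K) : Prop :=
  p.2.1 + l.2.1 = p.1 * l.1 ∧ p.2.2 + l.2.2 = p.1 * l.2.1

lemma adj_pt {K : Type*} [Field K] {p p' l : K × K × K} (h : Adj p l) (h' : Adj p' l)
    (hx : p.1 = p'.1) : p = p' := by
  obtain ⟨a, b, c⟩ := p
  obtain ⟨a', b', c'⟩ := p'
  obtain ⟨x, y, z⟩ := l
  simp only [Adj] at *
  obtain ⟨h1, h2⟩ := h
  obtain ⟨h3, h4⟩ := h'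
  subst hx
  have e1 : b = b' := by linear_combination h1 - h3
  have e2 : c = c' := by linear_combination h2 - h4
  rw [e1, e2]

lemma adj_ln {K : Type*} [Field K] {p l l' : K × K × K} (h : Adj p l) (h' : Adj p l')
    (hx : l.1 = l'.1) : l = l' := by
  obtain ⟨a, b, c⟩ := l
  obtain ⟨a', b', c'⟩ := l'
  obtain ⟨x, y, z⟩ := p
  simp only [Adj] at *
  obtain ⟨h1, h2⟩ := h
  obtain ⟨h3, h4⟩ := h'
  subst hx
  have e1 : b = b' := by linear_combination h1 - h3
  subst e1
  have e2 : c = c' := by linear_combination h2 - h4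
  rw [e2]

lemma adj_c4 {K : Type*} [Field K] {p p' l l' : K × K × K} (h1 : Adj p l) (h2 : Adj p l')
    (h3 : Adj p' l) (h4 : Adj p' l') (hp : p ≠ p') : l = l' := by
  have hx : p.1 - p'.1 ≠ 0 := fun h => hp (adj_pt h1 h3 (sub_eq_zero.mp h))
  apply adj_ln h1 h2
  apply mul_left_cancel₀ hx
  linear_combination - h1.1 + h3.1 + h2.1 - h4.1

lemma adj_c6 {K : Type*} [Field K] {p p' p'' l l' l'' : K × K × K} (h1 : Adj p l) (h2 : Adj p' l)
    (h3 : Adj p' l') (h4 : Adj p'' l') (h5 : Adj p'' l'') (h6 : Adj p l'')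
    (hp : p ≠ p') (hp' : p' ≠ p'') (hp'' : p ≠ p'') : l = l'' := by
  have hx : p.1 - p'.1 ≠ 0 := fun h => hp (adj_pt h1 h2 (sub_eq_zero.mp h))
  have hx' : p'.1 - p''.1 ≠ 0 := fun h => hp' (adj_pt h3 h4 (sub_eq_zero.mp h))
  have hx'' : p.1 - p''.1 ≠ 0 := fun h => hp'' (adj_pt h6 h5 (sub_eq_zero.mp h))
  apply adj_ln h1 h6
  obtain ⟨x, y, z⟩ := p
  obtain ⟨x', y', z'⟩ := p'
  obtain ⟨x'', y'', z''⟩ := p''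
  obtain ⟨a, A, u⟩ := l
  obtain ⟨b, B, v⟩ := l'
  obtain ⟨c, C, w⟩ := l''
  simp only [Adj] at *
  obtain ⟨h1, g1⟩ := h1
  obtain ⟨h2, g2⟩ := h2
  obtain ⟨h3, g3⟩ := h3
  obtain ⟨h4, g4⟩ := h4
  obtain ⟨h5, g5⟩ := h5
  obtain ⟨h6, g6⟩ := h6
  have k1 : A - C = x * (a - c) := by linear_combination h1 - h6
  have k2 : B - A = x' * (b - a) := by linear_combination h3 - h2
  have k3 : C - B = x'' * (c - b) := by linear_combination h5 - h4
  have m1 : x * (a - c) + x' * (b - a) + x'' * (c - b) = 0 := by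
    linear_combination -k1 - k2 - k3
  have m2 : x * (A - C) + x' * (B - A) + x'' * (C - B) = 0 := by
    linear_combination -g1 + g2 - g3 + g4 - g5 + g6
  rw [k1, k2, k3] at m2
  have : (x - x') * (x - x'') * (a - c) = 0 := by
    linear_combination m2 - (x' + x'') * m1
  have := (mul_eq_zero.mp this).resolve_left (mul_ne_zero hx hx'')
  exact sub_eq_zero.mp this

lemma dvd_aux {ι β : Type*} [Fintype β] [DecidableEq β] (s : Finset ι) (f : ι → β)
    (hs : 3 ∣ s.card) (z : β) (hz : ¬ 3 ∣ (s.filter (fun i => f i = z)).card) :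
    ∃ z', z' ≠ z ∧ ¬ 3 ∣ (s.filter (fun i => f i = z')).card := by
  by_contra hcon
  push Not at hcon
  rw [Finset.card_eq_sum_card_fiberwise (f := f) (t := Finset.univ) (by intro i _; simp),
    ← Finset.add_sum_erase _ _ (Finset.mem_univ z)] at hs
  apply hz
  refine (Nat.dvd_add_left (Finset.dvd_sum ?_)).mp hs
  intro z' hz'
  exact hcon z' (Finset.ne_of_mem_erase hz')

lemma comb {K : Type*} [Field K] [Fintype K] [DecidableEq K] (s : Finset (Fin 9))
    (f g : Fin 9 → K × K × K) (hadj : ∀ i ∈ s, Adj (f i) (g i))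
    (hf : ∀ x, 3 ∣ (s.filter (fun i => f i = x)).card)
    (hg : ∀ x, 3 ∣ (s.filter (fun i => g i = x)).card) (x z : K × K × K) :
    3 ∣ (s.filter (fun i => f i = x ∧ g i = z)).card := by
  by_contra hH0
  let H : K × K × K → K × K × K → Prop :=
    fun x z => ¬ 3 ∣ (s.filter (fun i => f i = x ∧ g i = z)).card
  have hne : ∀ x z, H x z → ∃ i ∈ s, f i = x ∧ g i = z := by
    intro x z h
    by_contra hc
    push Not at hc
    apply h
    rw [Finset.card_eq_zero.mpr]
    · simp
    · rw [Finset.filter_eq_empty_iff]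
      intro i hi h'
      exact hc i hi h'.1 h'.2
  have hA : ∀ x z, H x z → Adj x z := by
    intro x z h
    obtain ⟨i, hi, rfl, rfl⟩ := hne x z h
    exact hadj i hi
  have nz : ∀ x z, H x z → ∃ z', z' ≠ z ∧ H x z' := by
    intro x z h
    have := dvd_aux (s.filter (fun i => f i = x)) g (hf x) z (by rw [Finset.filter_filter]; exact h)
    simpa only [Finset.filter_filter] using this
  have nx : ∀ x z, H x z → ∃ x', x' ≠ x ∧ H x' z := by
    intro x z h
    have := dvd_aux (s.filter (fun i => g i = z)) f (hg z) x (by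
      rw [Finset.filter_filter]; simp only [and_comm (a := g _ = z)]; exact h)
    simpa only [Finset.filter_filter, and_comm (a := g _ = z)] using this
  have h3 : ∀ x z, H x z → 3 ≤ (s.filter (fun i => g i = z)).card := by
    intro x z h
    obtain ⟨i, hi, _, h2⟩ := hne x z h
    exact Nat.le_of_dvd (Finset.card_pos.mpr ⟨i, by simp [hi, h2]⟩) (hg z)
  have H00 : H x z := hH0
  obtain ⟨z1, hz1, H01⟩ := nz x z H00
  obtain ⟨x1, hx1, H11⟩ := nx x z1 H01
  obtain ⟨x2, hx2, H20⟩ := nx x z H00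
  obtain ⟨z2, hz2, H12⟩ := nz x1 z1 H11
  obtain ⟨z3, hz3, H23⟩ := nz x2 z H20
  have c0 : x1 ≠ x2 := by
    rintro rfl
    exact hz1 (adj_c4 (hA _ _ H01) (hA _ _ H00) (hA _ _ H11) (hA _ _ H20) hx1.symm)
  have c1 : z2 ≠ z := by
    rintro rfl
    exact hz1 (adj_c4 (hA _ _ H01) (hA _ _ H00) (hA _ _ H11) (hA _ _ H12) hx1.symm)
  have c2 : z3 ≠ z1 := by
    rintro rfl
    exact hz1 (adj_c4 (hA _ _ H01) (hA _ _ H00) (hA _ _ H23) (hA _ _ H20) hx2.symm)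
  have c3 : z3 ≠ z2 := by
    rintro rfl
    exact hz1 (adj_c6 (hA _ _ H01) (hA _ _ H11) (hA _ _ H12) (hA _ _ H23) (hA _ _ H20) (hA _ _ H00)
      hx1.symm c0 hx2.symm)
  have hcard : ({z, z1, z2, z3} : Finset (K × K × K)).card = 4 := by
    rw [Finset.card_insert_of_notMem, Finset.card_insert_of_notMem, Finset.card_insert_of_notMem,
      Finset.card_singleton]
    · simpa using c3.symm
    · simp [hz2.symm, c2.symm]
    · simp [hz1.symm, c1.symm, hz3.symm]
  have e1 : 4 * 3 ≤ ∑ b ∈ ({z, z1, z2, z3} : Finset (K × K × K)), (s.filter (fun i => g i = b)).card := by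
    rw [← hcard, ← smul_eq_mul]
    apply Finset.card_nsmul_le_sum
    intro b hb
    simp only [Finset.mem_insert, Finset.mem_singleton] at hb
    rcases hb with rfl | rfl | rfl | rfl
    · exact h3 _ _ H00
    · exact h3 _ _ H01
    · exact h3 _ _ H12
    · exact h3 _ _ H23
  have e2 : s.card = ∑ b, (s.filter (fun i => g i = b)).card :=
    Finset.card_eq_sum_card_fiberwise (by intro i _; simp)
  have e3 := Finset.sum_le_sum_of_subset (f := fun b => (s.filter (fun i => g i = b)).card)
    (Finset.subset_univ ({z, z1, z2, z3} : Finset (K × K × K)))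
  have e4 : s.card ≤ 9 := by simpa using Finset.card_le_univ s
  omega

lemma pfac {p r : ℕ} (hp : p.Prime) : p.factorization r = if p = r then 1 else 0 := by
  rw [hp.factorization, Finsupp.single_apply]

lemma count_ofFn_eq (a : Fin 9 → ℕ) (y : ℕ) :
    (List.ofFn a : Multiset ℕ).count y = (Finset.univ.filter (fun i => a i = y)).card := by
  rw [← Fin.univ_val_map, Multiset.count_map, Finset.card_def, Finset.filter_val]
  simp only [eq_comm]

lemma lower_nat (n N q : ℕ) (hN : N * N ≤ n) (hN1 : 1 ≤ N) (hq : q.Prime)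
    (hqN : 2 * q ^ 3 ≤ Nat.primeCounting N) :
    Nat.primeCounting n + q ^ 4 ≤ fkd 9 3 n + Nat.primeCounting N := by
  classical
  haveI : Fact q.Prime := ⟨hq⟩
  let K := ZMod q
  have hNn : N ≤ n := by nlinarith
  have hcK : Fintype.card (ZMod q) = q := ZMod.card q
  obtain ⟨ι⟩ : Nonempty (((K × K × K) ⊕ (K × K × K)) ↪ (Nat.primesLE N)) := by
    apply Function.Embedding.nonempty_of_card_le
    simp only [Fintype.card_sum, Fintype.card_prod, K, hcK, Fintype.card_coe,
      Nat.primesLE_card_eq_primeCounting]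
    refine le_trans (le_of_eq ?_) hqN
    ring
  let P : K × K × K → ℕ := fun x => ι (Sum.inl x)
  let L : K × K × K → ℕ := fun x => ι (Sum.inr x)
  have hP : ∀ x, (P x).Prime ∧ P x ≤ N := fun x => by
    have := Nat.mem_primesLE.mp (ι (Sum.inl x)).2; tauto
  have hL : ∀ x, (L x).Prime ∧ L x ≤ N := fun x => by
    have := Nat.mem_primesLE.mp (ι (Sum.inr x)).2; tauto
  have hPi : ∀ x y, P x = P y ↔ x = y := fun x y => by
    simp [P, Subtype.coe_inj]
  have hLi : ∀ x y, L x = L y ↔ x = y := fun x y => by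
    simp [L, Subtype.coe_inj]
  have hPL : ∀ x y, P x ≠ L y := fun x y => by
    simp [P, L, Subtype.coe_inj]
  clear_value P L
  have hfac : ∀ x z r, (P x * L z).factorization r =
      (if P x = r then 1 else 0) + (if L z = r then 1 else 0) := by
    intro x z r
    rw [Nat.factorization_mul (hP x).1.ne_zero (hL z).1.ne_zero, Finsupp.add_apply,
      pfac (hP x).1, pfac (hL z).1]
  have hinj : ∀ x z x' z', P x * L z = P x' * L z' → x = x' ∧ z = z' := by
    intro x z x' z' h
    have h1 := hfac x z (P x)
    rw [h, hfac] at h1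
    have h2 := hfac x z (L z)
    rw [h, hfac] at h2
    simp only [hPi, hLi, hPL, (hPL _ _).symm, if_true, if_false] at h1 h2
    constructor
    · by_contra hc
      rw [if_neg (fun h => hc h.symm)] at h1
      omega
    · by_contra hc
      rw [if_neg (fun h => hc h.symm)] at h2
      omega
  let B := Nat.primesLE n \ Nat.primesLE N
  let φ : K × K × K × K → ℕ := fun t =>
    P (t.1, t.2.1, t.2.2.1) * L (t.2.2.2, t.1 * t.2.2.2 - t.2.1, t.1 * (t.1 * t.2.2.2 - t.2.1) - t.2.2.1)
  have hφ : Function.Injective φ := by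
    rintro ⟨a, b, c, d⟩ ⟨a', b', c', d'⟩ h
    have := hinj _ _ _ _ h
    simp only [Prod.mk.injEq] at this ⊢
    tauto
  let C := Finset.univ.image φ
  have hB : ∀ y, y ∈ B ↔ y.Prime ∧ y ≤ n ∧ N < y := by
    intro y
    simp only [B, Finset.mem_sdiff, Nat.mem_primesLE]
    constructor
    · rintro ⟨h1, h2⟩
      refine ⟨by tauto, by tauto, ?_⟩
      by_contra h
      exact h2 (by push Not at h; tauto)
    · rintro ⟨h1, h2, h3⟩
      refine ⟨by tauto, fun h => ?_⟩
      have : y ≤ N := by tauto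
      omega
  have hC : ∀ y ∈ C, ∃ x z, Adj x z ∧ y = P x * L z := by
    intro y hy
    obtain ⟨⟨a, b, c, d⟩, -, rfl⟩ := Finset.mem_image.mp hy
    refine ⟨_, _, ?_, rfl⟩
    simp [Adj]
  have hdisj : Disjoint B C := by
    rw [Finset.disjoint_left]
    intro y h1 h2
    obtain ⟨x, z, -, rfl⟩ := hC y h2
    exact Nat.not_prime_mul (hP x).1.one_lt.ne' (hL z).1.one_lt.ne' ((hB _).mp h1).1
  have hcC : C.card = q ^ 4 := by
    rw [Finset.card_image_of_injective _ hφ, Finset.card_univ]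
    simp only [Fintype.card_prod, K, hcK]
    ring
  have hcB : Nat.primeCounting n ≤ B.card + Nat.primeCounting N := by
    rw [← Nat.primesLE_card_eq_primeCounting, ← Nat.primesLE_card_eq_primeCounting]
    exact (Finset.card_le_card_sdiff_add_card)
  have hmain : (B ∪ C).card ≤ fkd 9 3 n := by
    apply le_fkd
    · intro y hy
      rw [Finset.mem_Icc]
      rcases Finset.mem_union.mp hy with h | h
      · have := (hB y).mp h
        exact ⟨this.1.one_lt.le, this.2.1⟩
      · obtain ⟨x, z, -, rfl⟩ := hC y h
        exact ⟨Nat.mul_pos (hP x).1.pos (hL z).1.pos, (Nat.mul_le_mul (hP x).2 (hL z).2).trans hN⟩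
    · intro a w ha hw hprod y
      rw [count_ofFn_eq]
      have ha0 : ∀ i, a i ≠ 0 := by
        intro i h0
        have : ∏ i, a i = 0 := Finset.prod_eq_zero (Finset.mem_univ i) h0
        rw [hprod] at this
        exact (pow_pos hw 3).ne' this
      have hv : ∀ p, 3 ∣ ∑ i, (a i).factorization p := by
        intro p
        have := congrArg (fun m => m.factorization p) hprod
        simp only [Nat.factorization_pow, Nat.factorization_prod (fun i _ => ha0 i),
          Finsupp.smul_apply, smul_eq_mul, Finsupp.finsetSum_apply] at this
        exact ⟨_, this⟩
      -- edges data
      have hdat : ∀ i, ∃ xz : (K × K × K) × (K × K × K), a i ∈ C → Adj xz.1 xz.2 ∧ a i = P xz.1 * L xz.2 := by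
        intro i
        by_cases h : a i ∈ C
        · obtain ⟨x, z, h1, h2⟩ := hC _ h
          exact ⟨(x, z), fun _ => ⟨h1, h2⟩⟩
        · exact ⟨0, fun h' => absurd h' h⟩
      choose e he using hdat
      by_cases hy : ∃ i, a i = y
      swap
      · push Not at hy
        rw [Finset.filter_false_of_mem (fun i _ => hy i)]
        simp
      obtain ⟨i0, rfl⟩ := hy
      rcases Finset.mem_union.mp (ha i0) with h | h
      · -- big prime
        convert hv (a i0) using 1
        rw [Finset.card_filter]
        apply Finset.sum_congr rfl
        intro i _
        rcases Finset.mem_union.mp (ha i) with h' | h'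
        · rw [pfac ((hB _).mp h').1]
        · have h1 := (he i h').2
          have h2 := ((hB _).mp h).2.2
          have h3 := hP (e i).1
          have h4 := hL (e i).2
          have h5 : a i ≠ a i0 := by
            intro h6
            rw [h6] at h'
            exact (Finset.disjoint_left.mp hdisj) h h'
          rw [if_neg h5, h1, hfac, if_neg (by omega), if_neg (by omega)]
      · -- edge
        have hf : ∀ x, 3 ∣ ((Finset.univ.filter (fun i => a i ∈ C)).filter (fun i => (e i).1 = x)).card := by
          intro x
          convert hv (P x) using 1
          rw [Finset.filter_filter, Finset.card_filter]
          apply Finset.sum_congr rfl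
          intro i _
          by_cases h' : a i ∈ C
          · have h1 := (he i h').2
            rw [h1, hfac, ← h1]
            simp [h', hPi, (hPL _ _).symm]
          · have h2 := (hB _).mp ((Finset.mem_union.mp (ha i)).resolve_right h')
            have := (hP x).2
            rw [pfac h2.1, if_neg (by tauto), if_neg (by omega)]
        have hg : ∀ x, 3 ∣ ((Finset.univ.filter (fun i => a i ∈ C)).filter (fun i => (e i).2 = x)).card := by
          intro x
          convert hv (L x) using 1
          rw [Finset.filter_filter, Finset.card_filter]
          apply Finset.sum_congr rfl
          intro i _
          by_cases h' : a i ∈ C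
          · have h1 := (he i h').2
            rw [h1, hfac, ← h1]
            simp [h', hLi, hPL]
          · have h2 := (hB _).mp ((Finset.mem_union.mp (ha i)).resolve_right h')
            have := (hL x).2
            rw [pfac h2.1, if_neg (by tauto), if_neg (by omega)]
        have := comb (K := ZMod q) (Finset.univ.filter (fun i => a i ∈ C)) (fun i => (e i).1) (fun i => (e i).2)
          (fun i hi => (he i (Finset.mem_filter.mp hi).2).1) hf hg (e i0).1 (e i0).2
        convert this using 2
        ext i
        simp only [Finset.mem_filter, Finset.mem_univ, true_and]
        constructor
        · intro h1
          have h2 : a i ∈ C := h1 ▸ h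
          refine ⟨h2, hinj _ _ _ _ ?_⟩
          rw [← (he i h2).2, ← (he i0 h).2, h1]
        · rintro ⟨h1, h2, h3⟩
          rw [(he i h1).2, (he i0 h).2, h2, h3]
  rw [Finset.card_union_of_disjoint hdisj] at hmain
  omega

lemma cheb (N : ℕ) (hN : 4 ≤ N) : (N : ℝ) / (4 * Real.log N) ≤ Nat.primeCounting N := by
  have h := Chebyshev.pi_ge N
  have hN' : (4 : ℝ) ≤ N := by exact_mod_cast hN
  have hl : 0 < Real.log N := Real.log_pos (by linarith)
  refine le_trans ?_ h
  rw [div_le_div_iff₀ (by positivity) hl]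
  have h1 := Real.log_le_sub_one_of_pos (show (0:ℝ) < (N + 1) / 4 by positivity)
  rw [Real.log_div (by positivity) (by norm_num)] at h1
  have h4 : Real.log 4 = 2 * Real.log 2 := by
    rw [show (4 : ℝ) = 2 ^ 2 by norm_num, Real.log_pow]; norm_num
  have a1 := Real.log_two_gt_d9
  have a2 := Real.log_two_lt_d9
  have : (N : ℝ) / 4 ≤ N * Real.log 2 - Real.log (N + 1) := by nlinarith
  nlinarith

lemma exists_q (m : ℕ) (hm : 16 * 32 ^ 3 ≤ m) :
    ∃ q : ℕ, q.Prime ∧ 2 * q ^ 3 ≤ m ∧ m < 16 * q ^ 3 := by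
  have hex : ∃ r, m < 16 * (r + 1) ^ 3 := ⟨m, by nlinarith [sq_nonneg (m : ℤ), Nat.zero_le (m ^ 3), Nat.zero_le (m^2)]⟩
  have h1 := Nat.find_spec hex
  have h2 : ∀ r < Nat.find hex, ¬ m < 16 * (r + 1) ^ 3 := fun r hr => Nat.find_min hex hr
  generalize Nat.find hex = r at h1 h2
  have hr : r ≠ 0 := by
    rintro rfl
    omega
  have h3 : 16 * r ^ 3 ≤ m := by
    have := h2 (r - 1) (by omega)
    rw [Nat.sub_add_cancel (by omega)] at this
    omega
  obtain ⟨q, hq, hq1, hq2⟩ := Nat.exists_prime_lt_and_le_two_mul r hr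
  refine ⟨q, hq, ?_, ?_⟩
  · have : q ^ 3 ≤ (2 * r) ^ 3 := Nat.pow_le_pow_left hq2 3
    rw [mul_pow] at this
    omega
  · have : (r + 1) ^ 3 ≤ q ^ 3 := Nat.pow_le_pow_left hq1 3
    omega

lemma lower (n : ℕ) (hn : 16 ≤ n) (hm : 16 * 32 ^ 3 ≤ Nat.primeCounting (Nat.sqrt n)) :
    (Nat.primeCounting n : ℝ) + 1 / 512 * (n : ℝ) ^ ((2 : ℝ)/3) / (Real.log n) ^ ((4 : ℝ)/3)
        ≤ (fkd 9 3 n : ℝ) := by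
  obtain ⟨q, hq, hq1, hq2⟩ := exists_q _ hm
  have hN4 : 4 ≤ Nat.sqrt n := Nat.le_sqrt.mpr (by omega)
  have hlow := lower_nat n (Nat.sqrt n) q (Nat.sqrt_le n) (by omega) hq hq1
  have hlow' : (Nat.primeCounting n : ℝ) + (q : ℝ) ^ 4 ≤ fkd 9 3 n + Nat.primeCounting (Nat.sqrt n) := by
    exact_mod_cast hlow
  have hch := cheb _ hN4
  have hq2' : (Nat.primeCounting (Nat.sqrt n) : ℝ) ≤ 16 * (q : ℝ) ^ 3 := by exact_mod_cast hq2.le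
  have hq32 : 32 ≤ q := by
    by_contra h
    have : q ^ 3 ≤ 32 ^ 3 := Nat.pow_le_pow_left (by omega) 3
    omega
  have hq32' : (32 : ℝ) ≤ q := by exact_mod_cast hq32
  generalize hNdef : Nat.sqrt n = N at *
  have hN4' : (4 : ℝ) ≤ N := by exact_mod_cast hN4
  have hn16 : (16 : ℝ) ≤ n := by exact_mod_cast hn
  have hs : √(n : ℝ) ≤ 2 * N := by
    rw [Real.sqrt_le_left (by positivity)]
    have : n < (N + 1) * (N + 1) := by rw [← hNdef]; exact Nat.lt_succ_sqrt n
    have : (n : ℝ) < (N + 1) * (N + 1) := by exact_mod_cast this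
    nlinarith
  have hNn : (N : ℝ) ^ 2 ≤ n := by
    have : N * N ≤ n := by rw [← hNdef]; exact Nat.sqrt_le n
    rw [sq]; exact_mod_cast this
  have hlog : 2 * Real.log N ≤ Real.log n := by
    have := Real.log_le_log (by positivity) hNn
    rw [Real.log_pow] at this
    exact_mod_cast this
  have hlN : 0 < Real.log N := Real.log_pos (by linarith)
  have hln : 0 < Real.log n := by linarith
  have hR : √(n : ℝ) / (64 * Real.log n) ≤ (q : ℝ) ^ 3 := by
    have h1 : √(n : ℝ) / (4 * Real.log n) ≤ N / (4 * Real.log N) := by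
      rw [div_le_div_iff₀ (by positivity) (by positivity)]
      calc √(n : ℝ) * (4 * Real.log N) ≤ 2 * N * (4 * Real.log N) := by gcongr
        _ = N * (4 * (2 * Real.log N)) := by ring
        _ ≤ _ := by gcongr
    have h2 : √(n : ℝ) / (64 * Real.log n) = √(n : ℝ) / (4 * Real.log n) / 16 := by
      field_simp; norm_num
    rw [h2, div_le_iff₀ (by norm_num)]
    linarith
  have hpow := Real.rpow_le_rpow (by positivity) hR (show (0:ℝ) ≤ 4 / 3 by norm_num)
  rw [Real.div_rpow (by positivity) (by positivity), Real.mul_rpow (by norm_num) hln.le,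
    Real.sqrt_eq_rpow, ← Real.rpow_mul (by positivity), ← Real.rpow_natCast (q : ℝ) 3,
    ← Real.rpow_mul (by positivity)] at hpow
  have e1 : (64 : ℝ) ^ ((4 : ℝ) / 3) = 256 := by
    rw [show (64 : ℝ) = (4 : ℝ) ^ (3 : ℝ) by norm_num, ← Real.rpow_mul (by norm_num)]
    norm_num
  have e2 : (q : ℝ) ^ (((3 : ℕ) : ℝ) * (4 / 3)) = (q : ℝ) ^ 4 := by
    rw [← Real.rpow_natCast]; norm_num
  rw [e1, e2, show (1 : ℝ) / 2 * (4 / 3) = 2 / 3 by norm_num] at hpow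
  have e3 : 1 / 512 * (n : ℝ) ^ ((2 : ℝ)/3) / (Real.log n) ^ ((4 : ℝ)/3)
      = 1 / 2 * ((n : ℝ) ^ ((2 : ℝ)/3) / (256 * (Real.log n) ^ ((4 : ℝ)/3))) := by
    have : 0 < (Real.log n) ^ ((4 : ℝ)/3) := by positivity
    field_simp; norm_num
  rw [e3]
  have e4 : 32 * (q : ℝ) ^ 3 ≤ (q : ℝ) ^ 4 := by
    rw [pow_succ (q : ℝ) 3, mul_comm]
    gcongr
  linarith

theorem stmt_10 : ∃ c1 c2 : ℝ, 0 < c1 ∧ 0 < c2 ∧ ∀ᶠ n : ℕ in Filter.atTop,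
    (Nat.primeCounting n : ℝ) + c1 * (n : ℝ) ^ ((2 : ℝ)/3) / (Real.log n) ^ ((4 : ℝ)/3)
        ≤ (fkd 9 3 n : ℝ) ∧
    (fkd 9 3 n : ℝ)
        ≤ (Nat.primeCounting n : ℝ) + c2 * (n : ℝ) ^ ((2 : ℝ)/3) * Real.log n := by
  refine ⟨1 / 512, 100, by norm_num, by norm_num, ?_⟩
  obtain ⟨M, hM⟩ := (Filter.tendsto_atTop.mp Nat.tendsto_primeCounting (16 * 32 ^ 3)).exists_forall_of_atTop
  filter_upwards [Filter.eventually_ge_atTop 16, Filter.eventually_ge_atTop (M * M)] with n h1 h2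
  exact ⟨lower n h1 (hM _ (Nat.le_sqrt.mpr h2)), upper n (by omega)⟩
end
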